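/- Let (u, π, v, θ) be a smooth solution of the stationary 3D tropical climate model. Suppose p ∈ [3, 9/2], q ∈ [1, 2), r ∈ [2p′, 6] where p′ = p/(p−1), α ∈ [0, 3/p − 2/3], β ∈ [0, 3/q − 1/2], γ ∈ [0, 3/r − 1/2], and the inequalities α + ((4p−6)q/((6−q)p))·β ≤ 1, α + 2γ ≤ 3/p + 6/r − 2, and (2q/(6−q))·β + γ ≤ (6−r)/(2r) hold. Assume there exists a sequence R_j → +∞ such that X_{α,p,R_j} → 0 as j → ∞ and the limits lim_{j→∞} Y_{β,q,R_j} and lim_{j→∞} Z_{γ,r,R_j} exist and are finite. Then u = 0, v = 0 and θ = 0 identically on ℝ³. -/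

import Mathlib

open MeasureTheory Filter Metric

noncomputable section

abbrev R3 : Type := EuclideanSpace ℝ (Fin 3)

/-- Partial derivative of `f` in the `j`-th coordinate direction. -/
def pd (f : R3 → ℝ) (j : Fin 3) (x : R3) : ℝ :=
  fderiv ℝ f x (EuclideanSpace.single j 1)

/-- Laplacian of `f`. -/
def lap (f : R3 → ℝ) (x : R3) : ℝ := ∑ j, pd (pd f j) j x

/-- The stationary 3D tropical climate model:
`-Δu + (u·∇)u + ∇π + div(v⊗v) = 0`, `-Δv + (u·∇)v + ∇θ + (v·∇)u = 0`,
`-Δθ + u·∇θ + div v = 0`, `div u = 0`. -/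
def TCM (u v : R3 → R3) (pr θ : R3 → ℝ) : Prop :=
  (∀ i x, -lap (fun y => u y i) x + (∑ j, u x j * pd (fun y => u y i) j x)
      + pd pr i x + (∑ j, pd (fun y => v y j * v y i) j x) = 0) ∧
  (∀ i x, -lap (fun y => v y i) x + (∑ j, u x j * pd (fun y => v y i) j x)
      + pd θ i x + (∑ j, v x j * pd (fun y => u y i) j x) = 0) ∧
  (∀ x, -lap θ x + (∑ j, u x j * pd θ j x) + (∑ j, pd (fun y => v y j) j x) = 0) ∧
  (∀ x, (∑ j, pd (fun y => u y j) j x) = 0)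

/-- The annulus `B_{2R} \ B_R`. -/
def annulus (R : ℝ) : Set R3 := ball (0 : R3) (2 * R) \ ball 0 R

/-- `L^p` norm of a scalar function on a set `E`. -/
def lpS (g : R3 → ℝ) (p : ℝ) (E : Set R3) : ℝ := (∫ x in E, |g x| ^ p) ^ (1 / p)

/-- `X_{α,p,R} = R^{-α} ‖f‖_{L^p(B_{2R} \ B_R)}` for a vector field `f`. -/
def XnV (f : R3 → R3) (a p R : ℝ) : ℝ := R ^ (-a) * lpS (fun x => ‖f x‖) p (annulus R)

/-- `X_{α,p,R} = R^{-α} ‖f‖_{L^p(B_{2R} \ B_R)}` for a scalar function `f`. -/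
def XnS (f : R3 → ℝ) (a p R : ℝ) : ℝ := R ^ (-a) * lpS f p (annulus R)

open MeasureTheory Filter Metric
noncomputable section

/-- smooth -/
abbrev Sm (f : R3 → ℝ) : Prop := ContDiff ℝ (⊤ : ℕ∞) f

/-- basis vector -/
def bv (j : Fin 3) : R3 := EuclideanSpace.single j 1

lemma pd_def (f : R3 → ℝ) (j : Fin 3) (x : R3) : pd f j x = fderiv ℝ f x (bv j) := rfl

lemma norm_bv (j : Fin 3) : ‖bv j‖ = 1 := by simp [bv]

lemma Sm.diff {f : R3 → ℝ} (hf : Sm f) : Differentiable ℝ f := hf.differentiable (by simp)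

lemma Sm.pd {f : R3 → ℝ} (hf : Sm f) (j : Fin 3) : Sm (pd f j) := by
  have : ContDiff ℝ (⊤ : ℕ∞) (fderiv ℝ f) := hf.fderiv_right (by simp)
  exact this.clm_apply contDiff_const

lemma Sm.cont {f : R3 → ℝ} (hf : Sm f) : Continuous f := hf.continuous

lemma Sm.mul {f g : R3 → ℝ} (hf : Sm f) (hg : Sm g) : Sm (fun x => f x * g x) := ContDiff.mul hf hg
lemma Sm.add {f g : R3 → ℝ} (hf : Sm f) (hg : Sm g) : Sm (fun x => f x + g x) := ContDiff.add hf hg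
lemma Sm.sub {f g : R3 → ℝ} (hf : Sm f) (hg : Sm g) : Sm (fun x => f x - g x) := ContDiff.sub hf hg
lemma Sm.neg {f : R3 → ℝ} (hf : Sm f) : Sm (fun x => - f x) := ContDiff.neg hf
lemma Sm.const (c : ℝ) : Sm (fun _ => c) := contDiff_const
lemma Sm.cmul {f : R3 → ℝ} (hf : Sm f) (c : ℝ) : Sm (fun x => c * f x) := (Sm.const c).mul hf
lemma Sm.sum {ι : Type*} {s : Finset ι} {f : ι → R3 → ℝ} (h : ∀ i ∈ s, Sm (f i)) :
    Sm (fun x => ∑ i ∈ s, f i x) := ContDiff.sum h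
lemma Sm.pow {f : R3 → ℝ} (hf : Sm f) (n : ℕ) : Sm (fun x => f x ^ n) := ContDiff.pow hf n
lemma Sm.coord (i : Fin 3) : Sm (fun x : R3 => x i) := (EuclideanSpace.proj (𝕜 := ℝ) i).contDiff
lemma Sm.lap {f : R3 → ℝ} (hf : Sm f) : Sm (lap f) := Sm.sum (fun j _ => (hf.pd j).pd j)
lemma Sm.normsq : Sm (fun x : R3 => ‖x‖ ^ 2) := contDiff_norm_sq ℝ
lemma Sm.comp_add {f : R3 → ℝ} (hf : Sm f) (a : R3) : Sm (fun x => f (x + a)) :=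
  hf.comp (contDiff_id.add contDiff_const)

lemma hasDeriv_line {f : R3 → ℝ} (hf : Differentiable ℝ f) (j : Fin 3) (x : R3) (t : ℝ) :
    HasDerivAt (fun t : ℝ => f (x + t • bv j)) (pd f j (x + t • bv j)) t := by
  have h1 : HasDerivAt (fun t : ℝ => x + t • bv j) (bv j) t := by
    simpa using ((hasDerivAt_id t).smul_const (bv j)).const_add x
  exact (hf (x + t • bv j)).hasFDerivAt.comp_hasDerivAt t h1

lemma pd_of_line {f : R3 → ℝ} {j : Fin 3} {x : R3} {d : ℝ} (hf : DifferentiableAt ℝ f x)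
    (h : HasDerivAt (fun t : ℝ => f (x + t • bv j)) d 0) : pd f j x = d := by
  have h1 : HasDerivAt (fun t : ℝ => x + t • bv j) (bv j) 0 := by
    simpa using ((hasDerivAt_id (0:ℝ)).smul_const (bv j)).const_add x
  have h2 : HasFDerivAt f (fderiv ℝ f x) (x + (0:ℝ) • bv j) := by simpa using hf.hasFDerivAt
  exact (h2.comp_hasDerivAt 0 h1).unique h

lemma pd_mul {f g : R3 → ℝ} (hf : Differentiable ℝ f) (hg : Differentiable ℝ g) (j : Fin 3) (x : R3) :
    pd (fun y => f y * g y) j x = f x * pd g j x + pd f j x * g x := by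
  unfold pd
  rw [fderiv_fun_mul (hf x) (hg x)]
  simp; ring

lemma pd_add {f g : R3 → ℝ} (hf : Differentiable ℝ f) (hg : Differentiable ℝ g) (j : Fin 3) (x : R3) :
    pd (fun y => f y + g y) j x = pd f j x + pd g j x := by
  unfold pd
  rw [fderiv_fun_add (hf x) (hg x)]; simp

lemma pd_sub {f g : R3 → ℝ} (hf : Differentiable ℝ f) (hg : Differentiable ℝ g) (j : Fin 3) (x : R3) :
    pd (fun y => f y - g y) j x = pd f j x - pd g j x := by
  unfold pd
  rw [fderiv_fun_sub (hf x) (hg x)]; simp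

lemma pd_neg (f : R3 → ℝ) (j : Fin 3) (x : R3) :
    pd (fun y => - f y) j x = - pd f j x := by
  unfold pd
  rw [fderiv_fun_neg]; simp

lemma pd_const (c : ℝ) (j : Fin 3) (x : R3) : pd (fun _ => c) j x = 0 := by
  unfold pd; simp

lemma pd_cmul {f : R3 → ℝ} (hf : Differentiable ℝ f) (c : ℝ) (j : Fin 3) (x : R3) :
    pd (fun y => c * f y) j x = c * pd f j x := by
  unfold pd
  rw [fderiv_const_mul (hf x)]; simp

lemma pd_sum {ι : Type*} {s : Finset ι} {f : ι → R3 → ℝ} (h : ∀ i ∈ s, Differentiable ℝ (f i))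
    (j : Fin 3) (x : R3) :
    pd (fun y => ∑ i ∈ s, f i y) j x = ∑ i ∈ s, pd (f i) j x := by
  unfold pd
  rw [fderiv_fun_sum (fun i hi => h i hi x)]
  simp

lemma pd_coord (i j : Fin 3) (x : R3) : pd (fun x : R3 => x i) j x = if i = j then 1 else 0 := by
  unfold pd
  have h2 : fderiv ℝ (fun x : R3 => x i) x = EuclideanSpace.proj (𝕜 := ℝ) i :=
    ContinuousLinearMap.fderiv (EuclideanSpace.proj (𝕜 := ℝ) i : R3 →L[ℝ] ℝ)
  rw [h2]; simp [Pi.single_apply]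

lemma pd_comp_add (f : R3 → ℝ) (a : R3) (j : Fin 3) (x : R3) :
    pd (fun y => f (y + a)) j x = pd f j (x + a) := by
  unfold pd; rw [fderiv_comp_add_right]

lemma pd_comp_smul (f : R3 → ℝ) (c : ℝ) (j : Fin 3) (x : R3) :
    pd (fun y => f (c • y)) j x = c * pd f j (c • x) := by
  unfold pd; rw [fderiv_comp_smul]; simp

lemma pd_comm {f : R3 → ℝ} (hf : Sm f) (i j : Fin 3) (x : R3) :
    pd (pd f i) j x = pd (pd f j) i x := by
  have hd : Differentiable ℝ (fderiv ℝ f) :=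
    (hf.fderiv_right (m := (⊤ : ℕ∞)) (by simp)).differentiable (by simp)
  have key : ∀ i j : Fin 3, pd (pd f i) j x = fderiv ℝ (fderiv ℝ f) x (bv j) (bv i) := by
    intro i j
    have : pd f i = fun y => fderiv ℝ f y (bv i) := rfl
    rw [pd_def, this]
    rw [fderiv_clm_apply (hd x) (differentiableAt_const _)]
    simp
  rw [key, key]
  have := (hf.contDiffAt (x := x)).isSymmSndFDerivAt (by simp; exact WithTop.coe_le_coe.2 le_top)
  exact this.eq _ _

lemma cs_pd {f : R3 → ℝ} (hf : HasCompactSupport f) (j : Fin 3) : HasCompactSupport (pd f j) := by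
  have := hf.fderiv (𝕜 := ℝ)
  exact this.comp_left (g := fun L : R3 →L[ℝ] ℝ => L (bv j)) (by simp)

lemma pd_zero_off {f : R3 → ℝ} {x : R3} (hx : x ∉ tsupport f) (j : Fin 3) : pd f j x = 0 := by
  have : fderiv ℝ f x = 0 := by
    have := Set.notMem_subset (support_fderiv_subset ℝ (f := f)) hx
    simpa using this
  simp [pd, this]

lemma tsup_pd (f : R3 → ℝ) (j : Fin 3) : tsupport (pd f j) ⊆ tsupport f := by
  apply closure_minimal _ (isClosed_tsupport f)
  intro x hx
  by_contra h
  exact hx (pd_zero_off h j)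

lemma cs_mul_left {f g : R3 → ℝ} (hf : HasCompactSupport f) : HasCompactSupport (fun x => f x * g x) :=
  HasCompactSupport.mul_right hf
lemma cs_mul_right {f g : R3 → ℝ} (hg : HasCompactSupport g) : HasCompactSupport (fun x => f x * g x) :=
  HasCompactSupport.mul_left hg

lemma int_cs {f : R3 → ℝ} (hf : Continuous f) (h : HasCompactSupport f) : Integrable f :=
  hf.integrable_of_hasCompactSupport h

lemma ibp_int {f g : R3 → ℝ} (hf : Differentiable ℝ f) (hg : Differentiable ℝ g) (j : Fin 3)
    (h1 : Integrable (fun x => pd f j x * g x)) (h2 : Integrable (fun x => f x * pd g j x))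
    (h3 : Integrable (fun x => f x * g x)) :
    ∫ x, f x * pd g j x = - ∫ x, pd f j x * g x :=
  integral_mul_fderiv_eq_neg_fderiv_mul_of_integrable h1 h2 h3 (fun x _ => hf x) (fun x _ => hg x)

lemma ibp {f g : R3 → ℝ} (hf : Sm f) (hg : Sm g) (hc : HasCompactSupport g) (j : Fin 3) :
    ∫ x, f x * pd g j x = - ∫ x, pd f j x * g x :=
  ibp_int hf.diff hg.diff j (int_cs ((hf.pd j).cont.mul hg.cont) (cs_mul_right hc))
    (int_cs (hf.cont.mul (hg.pd j).cont) (cs_mul_right (cs_pd hc j)))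
    (int_cs (hf.cont.mul hg.cont) (cs_mul_right hc))

lemma int_pd {g : R3 → ℝ} (hg : Sm g) (hc : HasCompactSupport g) (j : Fin 3) : ∫ x, pd g j x = 0 := by
  have := ibp (Sm.const 1) hg hc j
  simpa [pd_const] using this

lemma norm_sq_R3 (x : R3) : ‖x‖ ^ 2 = ∑ i, x i ^ 2 := by
  rw [EuclideanSpace.norm_sq_eq]; simp

lemma coord_le (x : R3) (i : Fin 3) : |x i| ≤ ‖x‖ := by
  simpa using PiLp.norm_apply_le x i

lemma bdd_cs {f : R3 → ℝ} (hf : Continuous f) (h : HasCompactSupport f) : ∃ C, 0 ≤ C ∧ ∀ x, |f x| ≤ C := by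
  obtain ⟨C, hC⟩ := h.exists_bound_of_continuous hf
  exact ⟨max C 0, le_max_right _ _, fun x => (hC x).trans (le_max_left _ _)⟩

lemma int_add_left (f : R3 → ℝ) (a : R3) : ∫ x, f (x + a) = ∫ x, f x := integral_add_right_eq_self f a

end

open MeasureTheory Filter Metric
noncomputable section

/-- raw Gaussian -/
def gau (z : R3) : ℝ := Real.exp (-(1/4) * ‖z‖ ^ 2)

/-- weight -/
def Dw (x : R3) : ℝ := ((1 + ‖x‖) ^ 4)⁻¹

lemma Dw_pos (x : R3) : 0 < Dw x := by unfold Dw; positivity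
lemma Dw_le_one (x : R3) : Dw x ≤ 1 := by
  unfold Dw
  apply inv_le_one_of_one_le₀
  exact one_le_pow₀ (by linarith [norm_nonneg x])

lemma Dw_cont : Continuous Dw := by
  unfold Dw
  apply Continuous.inv₀ (by fun_prop)
  intro x; positivity

lemma Dw_int : Integrable Dw := by
  have h := integrable_one_add_norm (E := R3) (μ := volume) (r := 4) (by simp; norm_num)
  refine h.congr (Eventually.of_forall fun x => ?_)
  unfold Dw
  simp only
  rw [Real.rpow_neg (by positivity)]
  norm_cast

lemma gau_pos (z : R3) : 0 < gau z := Real.exp_pos _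
lemma gau_cont : Continuous gau := by unfold gau; fun_prop
lemma gau_even (z : R3) : gau (-z) = gau z := by simp [gau]

lemma gau_int_b {b : ℝ} (hb : 0 < b) : Integrable (fun z : R3 => Real.exp (-b * ‖z‖ ^ 2)) := by
  have h := GaussianFourier.integral_rexp_neg_mul_sq_norm (V := R3) hb
  by_contra hn
  rw [integral_undef hn] at h
  have : (0:ℝ) < (Real.pi / b) ^ (Module.finrank ℝ R3 / 2 : ℝ) := by positivity
  linarith

lemma gau_int : Integrable gau := gau_int_b (by norm_num)

lemma gau_wt_bd (k : ℕ) : ∃ C, 0 ≤ C ∧ ∀ z : R3, (1 + ‖z‖) ^ k * gau z ≤ C * Real.exp (-(1/8) * ‖z‖ ^ 2) := by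
  refine ⟨k.factorial * Real.exp 3, by positivity, fun z => ?_⟩
  have h1 := Real.pow_div_factorial_le_exp (1 + ‖z‖) (by positivity) k
  rw [div_le_iff₀ (by positivity)] at h1
  have h2 : Real.exp (1 + ‖z‖) * Real.exp (-(1/4) * ‖z‖ ^ 2) ≤ Real.exp 3 * Real.exp (-(1/8) * ‖z‖ ^ 2) := by
    rw [← Real.exp_add, ← Real.exp_add]
    apply Real.exp_le_exp.2
    nlinarith [sq_nonneg (‖z‖ - 4)]
  unfold gau
  calc _ ≤ (Real.exp (1 + ‖z‖) * k.factorial) * Real.exp (-(1/4) * ‖z‖ ^ 2) := by gcongr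
    _ = k.factorial * (Real.exp (1 + ‖z‖) * Real.exp (-(1/4) * ‖z‖ ^ 2)) := by ring
    _ ≤ k.factorial * (Real.exp 3 * Real.exp (-(1/8) * ‖z‖ ^ 2)) := by gcongr
    _ = _ := by ring

lemma gau_wt_int (k : ℕ) : Integrable (fun z : R3 => (1 + ‖z‖) ^ k * gau z) := by
  obtain ⟨C, _, hC⟩ := gau_wt_bd k
  refine ((gau_int_b (b := 1/8) (by norm_num)).const_mul C).mono' ?_ ?_
  · exact (Continuous.mul (by fun_prop) gau_cont).aestronglyMeasurable
  · refine Eventually.of_forall fun z => ?_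
    rw [Real.norm_of_nonneg (mul_nonneg (by positivity) (gau_pos z).le)]
    exact hC z

/-- normalising constant -/
def gc : ℝ := (∫ z, gau z)⁻¹

lemma gau_int_pos : 0 < ∫ z, gau z := by
  rw [integral_pos_iff_support_of_nonneg (fun z => (gau_pos z).le) gau_int]
  have : Function.support gau = Set.univ := by
    ext z; simp [(gau_pos z).ne']
  rw [this]; simp

lemma gc_pos : 0 < gc := inv_pos.2 gau_int_pos

/-- normalised Gaussian -/
def gam (z : R3) : ℝ := gc * gau z

lemma gam_pos (z : R3) : 0 < gam z := mul_pos gc_pos (gau_pos z)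
lemma gam_cont : Continuous gam := continuous_const.mul gau_cont
lemma gam_even (z : R3) : gam (-z) = gam z := by simp [gam, gau_even]
lemma gam_one : ∫ z, gam z = 1 := by
  unfold gam; rw [integral_const_mul]; exact inv_mul_cancel₀ gau_int_pos.ne'
lemma gam_int : Integrable gam := gau_int.const_mul gc
lemma gam_wt_int (k : ℕ) : Integrable (fun z : R3 => (1 + ‖z‖) ^ k * gam z) := by
  refine ((gau_wt_int k).const_mul gc).congr (Eventually.of_forall fun z => ?_)
  simp only [gam]; ring

lemma gau_sm : Sm gau := Real.contDiff_exp.comp (Sm.normsq.cmul (-(1/4)))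
lemma gam_sm : Sm gam := gau_sm.cmul gc

lemma pd_normsq (j : Fin 3) (x : R3) : pd (fun x : R3 => ‖x‖ ^ 2) j x = 2 * x j := by
  have : (fun x : R3 => ‖x‖ ^ 2) = fun x : R3 => ∑ i, x i * x i := by
    funext x; rw [norm_sq_R3]; simp [pow_two]
  rw [this, pd_sum (fun i _ => ((Sm.coord i).mul (Sm.coord i)).diff)]
  simp only [pd_mul (Sm.coord _).diff (Sm.coord _).diff, pd_coord]
  fin_cases j <;> simp [Fin.sum_univ_three] <;> ring

lemma pd_exp {f : R3 → ℝ} (hf : Differentiable ℝ f) (j : Fin 3) (x : R3) :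
    pd (fun y => Real.exp (f y)) j x = Real.exp (f x) * pd f j x := by
  unfold pd
  rw [fderiv_exp (hf x)]; simp

lemma pd_gam (j : Fin 3) (z : R3) : pd gam j z = -(z j / 2) * gam z := by
  unfold gam
  rw [pd_cmul gau_sm.diff]
  unfold gau
  rw [pd_exp (Sm.normsq.cmul (-(1/4))).diff, pd_cmul Sm.normsq.diff, pd_normsq]
  ring

/-- Gaussian average -/
def Pg (s : ℝ) (f : R3 → ℝ) (x : R3) : ℝ := ∫ z, gam z * f (x + s • z)

/-- bounded continuous -/
structure BC (f : R3 → ℝ) : Prop where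
  cont : Continuous f
  bdd : ∃ C, 0 ≤ C ∧ ∀ x, |f x| ≤ C

/-- decaying -/
structure Dec (f : R3 → ℝ) : Prop where
  cont : Continuous f
  dec : ∃ C, 0 ≤ C ∧ ∀ x, |f x| ≤ C * Dw x

lemma Dec.bc {f : R3 → ℝ} (h : Dec f) : BC f := by
  obtain ⟨C, h0, hC⟩ := h.dec
  exact ⟨h.cont, C, h0, fun x => (hC x).trans (by nlinarith [Dw_le_one x])⟩

lemma Dec.int {f : R3 → ℝ} (h : Dec f) : Integrable f := by
  obtain ⟨C, h0, hC⟩ := h.dec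
  exact (Dw_int.const_mul C).mono' h.cont.aestronglyMeasurable (Eventually.of_forall hC)

lemma Dec.mul {f g : R3 → ℝ} (h : Dec f) (hg : BC g) : Dec (fun x => f x * g x) := by
  obtain ⟨C, h0, hC⟩ := h.dec
  obtain ⟨C', h0', hC'⟩ := hg.bdd
  refine ⟨h.cont.mul hg.cont, C * C', by positivity, fun x => ?_⟩
  rw [abs_mul]
  calc _ ≤ (C * Dw x) * C' := mul_le_mul (hC x) (hC' x) (abs_nonneg _) (by have := Dw_pos x; positivity)
    _ = _ := by ring

lemma BC.mul {f g : R3 → ℝ} (h : BC f) (hg : BC g) : BC (fun x => f x * g x) := by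
  obtain ⟨C, h0, hC⟩ := h.bdd
  obtain ⟨C', h0', hC'⟩ := hg.bdd
  refine ⟨h.cont.mul hg.cont, C * C', by positivity, fun x => ?_⟩
  rw [abs_mul]
  exact mul_le_mul (hC x) (hC' x) (abs_nonneg _) h0

lemma Dec.of_le {f g : R3 → ℝ} (hf : Continuous f) (h : Dec g) (hl : ∀ x, |f x| ≤ |g x|) : Dec f := by
  obtain ⟨C, h0, hC⟩ := h.dec
  exact ⟨hf, C, h0, fun x => (hl x).trans (hC x)⟩

lemma Dec.add {f g : R3 → ℝ} (h : Dec f) (hg : Dec g) : Dec (fun x => f x + g x) := by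
  obtain ⟨C, h0, hC⟩ := h.dec
  obtain ⟨C', h0', hC'⟩ := hg.dec
  refine ⟨h.cont.add hg.cont, C + C', by positivity, fun x => ?_⟩
  calc _ ≤ |f x| + |g x| := abs_add_le _ _
    _ ≤ C * Dw x + C' * Dw x := add_le_add (hC x) (hC' x)
    _ = _ := by ring

lemma cs_dec {f : R3 → ℝ} (hf : Continuous f) (h : HasCompactSupport f) : Dec f := by
  have hc : HasCompactSupport (fun x => f x * (1 + ‖x‖) ^ 4) := cs_mul_left h
  obtain ⟨C, h0, hC⟩ := bdd_cs (hf.mul (by fun_prop : Continuous (fun x : R3 => (1 + ‖x‖) ^ 4))) hc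
  refine ⟨hf, C, h0, fun x => ?_⟩
  have : |f x * (1 + ‖x‖) ^ 4| ≤ C := hC x
  rw [abs_mul, abs_of_pos (by positivity : (0:ℝ) < (1 + ‖x‖) ^ 4)] at this
  unfold Dw
  rw [← div_eq_mul_inv, le_div_iff₀ (by positivity)]
  exact this

lemma Dw_shift (x z : R3) {s : ℝ} (hs : |s| ≤ 2) : Dw (x + s • z) ≤ 16 * (1 + ‖z‖) ^ 4 * Dw x := by
  unfold Dw
  have h1 : 1 + ‖x‖ ≤ 2 * (1 + ‖z‖) * (1 + ‖x + s • z‖) := by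
    have h2 : ‖x‖ ≤ ‖x + s • z‖ + ‖s • z‖ := by
      have := norm_sub_le (x + s • z) (s • z); simpa using this
    have h3 : ‖s • z‖ ≤ 2 * ‖z‖ := by
      rw [norm_smul]; exact mul_le_mul_of_nonneg_right hs (norm_nonneg z)
    nlinarith [norm_nonneg z, norm_nonneg (x + s • z), mul_nonneg (norm_nonneg z) (norm_nonneg (x + s • z))]
  rw [← div_eq_mul_inv, le_div_iff₀ (by positivity), inv_mul_le_iff₀ (by positivity)]
  calc (1 + ‖x‖) ^ 4 ≤ (2 * (1 + ‖z‖) * (1 + ‖x + s • z‖)) ^ 4 := by gcongr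
    _ = _ := by ring

lemma Pg_intg {f : R3 → ℝ} (hf : BC f) (s : ℝ) (x : R3) : Integrable (fun z => gam z * f (x + s • z)) := by
  obtain ⟨C, h0, hC⟩ := hf.bdd
  refine (gam_int.const_mul C).mono' ?_ (Eventually.of_forall fun z => ?_)
  · exact (gam_cont.mul (hf.cont.comp (by fun_prop))).aestronglyMeasurable
  · rw [norm_mul, Real.norm_of_nonneg (gam_pos z).le, mul_comm]
    exact mul_le_mul_of_nonneg_right (hC _) (gam_pos z).le

lemma Pg_dec {f : R3 → ℝ} (hf : Dec f) :
    ∃ C, 0 ≤ C ∧ ∀ s x, |s| ≤ 2 → |Pg s f x| ≤ C * Dw x := by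
  obtain ⟨C, h0, hC⟩ := hf.dec
  refine ⟨C * (16 * ∫ z : R3, (1 + ‖z‖) ^ 4 * gam z), ?_, fun s x hs => ?_⟩
  · have : 0 ≤ ∫ z : R3, (1 + ‖z‖) ^ 4 * gam z :=
      integral_nonneg fun z => mul_nonneg (by positivity) (gam_pos z).le
    positivity
  · unfold Pg
    rw [← Real.norm_eq_abs]
    refine (norm_integral_le_of_norm_le (((gam_wt_int 4).const_mul (C * 16 * Dw x))) (Eventually.of_forall fun z => ?_)).trans (le_of_eq ?_)
    · rw [norm_mul, Real.norm_of_nonneg (gam_pos z).le]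
      have h1 := (hC (x + s • z)).trans (mul_le_mul_of_nonneg_left (Dw_shift x z hs) h0)
      calc _ ≤ gam z * (C * (16 * (1 + ‖z‖) ^ 4 * Dw x)) := mul_le_mul_of_nonneg_left h1 (gam_pos z).le
        _ = _ := by ring
    · rw [integral_const_mul]; ring

lemma Pg_bdd {f : R3 → ℝ} {C : ℝ} (hC : ∀ x, |f x| ≤ C) (s : ℝ) (x : R3) :
    |Pg s f x| ≤ C := by
  unfold Pg
  rw [← Real.norm_eq_abs]
  refine (norm_integral_le_of_norm_le (gam_int.const_mul C) (Eventually.of_forall fun z => ?_)).trans (le_of_eq ?_)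
  · rw [norm_mul, Real.norm_of_nonneg (gam_pos z).le, mul_comm]
    exact mul_le_mul_of_nonneg_right (hC _) (gam_pos z).le
  · rw [integral_const_mul, gam_one, mul_one]

lemma Pg_cont {f : R3 → ℝ} (hf : BC f) : Continuous (fun p : ℝ × R3 => Pg p.1 f p.2) := by
  obtain ⟨C, h0, hC⟩ := hf.bdd
  refine continuous_of_dominated (bound := fun z => gam z * C) (fun p => (Pg_intg hf p.1 p.2).aestronglyMeasurable)
    (fun p => Eventually.of_forall fun z => ?_) (gam_int.mul_const C) (Eventually.of_forall fun z => ?_)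
  · rw [norm_mul, Real.norm_of_nonneg (gam_pos z).le]
    exact mul_le_mul_of_nonneg_left (hC _) (gam_pos z).le
  · exact continuous_const.mul (hf.cont.comp (by fun_prop))

lemma Pg_contx {f : R3 → ℝ} (hf : BC f) (s : ℝ) : Continuous (Pg s f) :=
  (Pg_cont hf).comp (f := fun x => (s, x)) (by fun_prop)

lemma Pg_Dec {f : R3 → ℝ} (hf : Dec f) {s : ℝ} (hs : |s| ≤ 2) : Dec (Pg s f) := by
  obtain ⟨C, h0, hC⟩ := Pg_dec hf
  exact ⟨Pg_contx hf.bc s, C, h0, fun x => hC s x hs⟩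

lemma Pg_zero (f : R3 → ℝ) (x : R3) : Pg 0 f x = f x := by
  simp [Pg, integral_mul_const, gam_one]

lemma Pg_mono {f g : R3 → ℝ} (hf : BC f) (hg : BC g) (h : ∀ x, f x ≤ g x) (s : ℝ) (x : R3) :
    Pg s f x ≤ Pg s g x :=
  integral_mono (Pg_intg hf s x) (Pg_intg hg s x) fun z => mul_le_mul_of_nonneg_left (h _) (gam_pos z).le

lemma Pg_abs {f g : R3 → ℝ} (hf : BC f) (hg : BC g) (h : ∀ x, |f x| ≤ g x) (s : ℝ) (x : R3) :
    |Pg s f x| ≤ Pg s g x := by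
  rw [abs_le]
  constructor
  · have : - Pg s g x = Pg s (fun x => - g x) x := by simp [Pg, integral_neg]
    rw [this]
    refine Pg_mono (f := fun x => - g x) ⟨hg.cont.neg, ?_⟩ hf (fun x => by linarith [abs_le.1 (h x)]) s x
    obtain ⟨C, h0, hC⟩ := hg.bdd
    exact ⟨C, h0, fun x => by rw [abs_neg]; exact hC x⟩
  · exact Pg_mono hf hg (fun x => (le_abs_self _).trans (h x)) s x

lemma Pg_sq {f g : R3 → ℝ} (hf : BC f) (hg : BC g) (h : ∀ x, f x ^ 2 ≤ g x) (s : ℝ) (x : R3) :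
    Pg s f x ^ 2 ≤ Pg s g x := by
  have hf2 : BC (fun x => f x * f x) := hf.mul hf
  have h1 : Pg s (fun x => f x * f x) x ≤ Pg s g x :=
    Pg_mono hf2 hg (fun x => by simpa [pow_two] using h x) s x
  refine le_trans ?_ h1
  set m := Pg s f x with hm
  have h2 : 0 ≤ ∫ z, (gam z * (f (x + s • z) * f (x + s • z)) - 2 * m * (gam z * f (x + s • z)) + m ^ 2 * gam z) := by
    apply integral_nonneg
    intro z
    have : gam z * (f (x + s • z) * f (x + s • z)) - 2 * m * (gam z * f (x + s • z)) + m ^ 2 * gam z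
      = gam z * (f (x + s • z) - m) ^ 2 := by ring
    simp only [Pi.zero_apply]
    rw [this]
    exact mul_nonneg (gam_pos z).le (sq_nonneg _)
  have i2 : Integrable (fun z => gam z * (f (x + s • z) * f (x + s • z)) - 2 * m * (gam z * f (x + s • z))) :=
    (Pg_intg hf2 s x).sub ((Pg_intg hf s x).const_mul _)
  rw [integral_add i2 (gam_int.const_mul _),
    integral_sub (Pg_intg hf2 s x) ((Pg_intg hf s x).const_mul _), integral_const_mul, integral_const_mul, gam_one] at h2
  have h3 : ∫ z, gam z * f (x + s • z) = m := rfl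
  have h4 : ∫ z, gam z * (f (x + s • z) * f (x + s • z)) = Pg s (fun x => f x * f x) x := rfl
  rw [h3, h4] at h2
  nlinarith

lemma fderiv_coord (f : R3 → ℝ) (x z : R3) : fderiv ℝ f x z = ∑ j, z j * pd f j x := by
  have : z = ∑ j, z j • bv j := by
    ext i
    fin_cases i <;> simp [Fin.sum_univ_three, bv]
  conv_lhs => rw [this]
  simp [pd_def]

/-- test functions -/
structure Ts (f : R3 → ℝ) : Prop where
  sm : Sm f
  cs : HasCompactSupport f

lemma Ts.pd {f : R3 → ℝ} (h : Ts f) (j : Fin 3) : Ts (pd f j) := ⟨h.sm.pd j, cs_pd h.cs j⟩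
lemma Ts.dec {f : R3 → ℝ} (h : Ts f) : Dec f := cs_dec h.sm.cont h.cs
lemma Ts.bc {f : R3 → ℝ} (h : Ts f) : BC f := h.dec.bc
lemma Ts.int {f : R3 → ℝ} (h : Ts f) : Integrable f := h.dec.int
lemma Ts.lap {f : R3 → ℝ} (h : Ts f) : Ts (lap f) := by
  refine ⟨h.sm.lap, ?_⟩
  have : _root_.lap f = fun x => _root_.pd (_root_.pd f 0) 0 x + _root_.pd (_root_.pd f 1) 1 x + _root_.pd (_root_.pd f 2) 2 x := by
    funext x; simp [_root_.lap, Fin.sum_univ_three]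
  rw [this]
  exact (((h.pd 0).pd 0).cs.add ((h.pd 1).pd 1).cs).add ((h.pd 2).pd 2).cs

lemma Ts.fderiv_bdd {f : R3 → ℝ} (h : Ts f) : ∃ C, 0 ≤ C ∧ ∀ x, ‖fderiv ℝ f x‖ ≤ C := by
  have hc : Continuous (fderiv ℝ f) := h.sm.continuous_fderiv (by simp)
  obtain ⟨C, hC⟩ := (h.cs.fderiv (𝕜 := ℝ)).exists_bound_of_continuous hc
  exact ⟨max C 0, le_max_right _ _, fun x => (hC x).trans (le_max_left _ _)⟩

lemma Pg_hasFDeriv {f : R3 → ℝ} (h : Ts f) (s : ℝ) (x : R3) :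
    HasFDerivAt (Pg s f) (∫ z, gam z • fderiv ℝ f (x + s • z)) x ∧
      Integrable (fun z => gam z • fderiv ℝ f (x + s • z)) := by
  obtain ⟨C, h0, hC⟩ := h.fderiv_bdd
  have hm : ∀ x, AEStronglyMeasurable (fun z => gam z • fderiv ℝ f (x + s • z)) volume := fun x =>
    (gam_cont.smul ((h.sm.continuous_fderiv (by simp)).comp (by fun_prop))).aestronglyMeasurable
  have hb : ∀ x z, ‖gam z • fderiv ℝ f (x + s • z)‖ ≤ gam z * C := fun x z => by
    rw [norm_smul, Real.norm_of_nonneg (gam_pos z).le]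
    exact mul_le_mul_of_nonneg_left (hC _) (gam_pos z).le
  refine ⟨?_, (gam_int.mul_const C).mono' (hm x) (Eventually.of_forall (hb x))⟩
  refine hasFDerivAt_integral_of_dominated_of_fderiv_le (F := fun x z => gam z * f (x + s • z))
    (F' := fun x z => gam z • fderiv ℝ f (x + s • z)) (x₀ := x) (μ := volume)
    (bound := fun z => gam z * C) (s := Set.univ) univ_mem ?_ (Pg_intg h.bc s x) (hm x) ?_
    (gam_int.mul_const C) ?_
  · exact Eventually.of_forall fun x => (Pg_intg h.bc s x).aestronglyMeasurable
  · exact Eventually.of_forall fun z x _ => hb x z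
  · refine Eventually.of_forall fun z x _ => ?_
    have h1 : HasFDerivAt (fun x => f (x + s • z)) (fderiv ℝ f (x + s • z)) x := by
      exact (hasFDerivAt_comp_add_right (s • z)).2 (h.sm.diff (x + s • z)).hasFDerivAt
    exact h1.const_mul (gam z)

lemma Pg_diff {f : R3 → ℝ} (h : Ts f) (s : ℝ) : Differentiable ℝ (Pg s f) :=
  fun x => (Pg_hasFDeriv h s x).1.differentiableAt

lemma Pg_pd {f : R3 → ℝ} (h : Ts f) (s : ℝ) (j : Fin 3) (x : R3) : pd (Pg s f) j x = Pg s (pd f j) x := by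
  rw [pd_def, (Pg_hasFDeriv h s x).1.fderiv, ContinuousLinearMap.integral_apply (Pg_hasFDeriv h s x).2]
  simp [Pg, pd_def]

lemma gauss_ibp {F : R3 → ℝ} (hF : Sm F) {C : ℝ} (hC : ∀ x, |F x| ≤ C) (j : Fin 3) (hC' : ∀ x, |pd F j x| ≤ C) :
    ∫ z, gam z * (z j * F z) = 2 * ∫ z, gam z * pd F j z := by
  have hC0 : 0 ≤ C := (abs_nonneg _).trans (hC 0)
  have i1 : Integrable (fun z => gam z * pd F j z) := by
    have := Pg_intg ⟨(hF.pd j).cont, C, hC0, hC'⟩ 1 0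
    simpa using this
  have i2 : Integrable (fun z => gam z * F z) := by
    have := Pg_intg ⟨hF.cont, C, hC0, hC⟩ 1 0
    simpa using this
  have i3 : Integrable (fun z => pd gam j z * F z) := by
    refine ((gam_wt_int 1).mul_const C).mono' ((gam_sm.pd j).cont.mul hF.cont).aestronglyMeasurable
      (Eventually.of_forall fun z => ?_)
    rw [pd_gam, norm_mul, norm_mul, Real.norm_of_nonneg (gam_pos z).le]
    have h1 : ‖-(z j / 2)‖ ≤ (1 + ‖z‖) ^ 1 := by
      rw [norm_neg, norm_div, Real.norm_eq_abs]; simp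
      linarith [coord_le z j, norm_nonneg z]
    exact mul_le_mul (mul_le_mul_of_nonneg_right h1 (gam_pos z).le) (hC z) (norm_nonneg _) (mul_nonneg (by positivity) (gam_pos z).le)
  have h := ibp_int gam_sm.diff hF.diff j i3 i1 i2
  rw [h, ← integral_neg, ← integral_const_mul]
  congr 1; funext z
  rw [pd_gam]; ring

lemma Pg_hasDeriv {f : R3 → ℝ} (h : Ts f) (x : R3) (s : ℝ) :
    HasDerivAt (fun s => Pg s f x) (2 * s * Pg s (lap f) x) s := by
  obtain ⟨C, h0, hC⟩ := h.fderiv_bdd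
  have hm : ∀ s : ℝ, AEStronglyMeasurable (fun z => gam z * fderiv ℝ f (x + s • z) z) volume := fun s => by
    refine (gam_cont.mul ?_).aestronglyMeasurable
    exact ((h.sm.continuous_fderiv (by simp)).comp (by fun_prop : Continuous fun z : R3 => x + s • z)).clm_apply continuous_id
  have key := hasDerivAt_integral_of_dominated_loc_of_deriv_le (F := fun s z => gam z * f (x + s • z))
    (F' := fun s z => gam z * fderiv ℝ f (x + s • z) z) (x₀ := s) (s := Set.univ) (μ := volume)
    (bound := fun z => (1 + ‖z‖) ^ 1 * gam z * C) univ_mem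
    (Eventually.of_forall fun s => (Pg_intg h.bc s x).aestronglyMeasurable) (Pg_intg h.bc s x) (hm s)
    (Eventually.of_forall fun z s _ => ?_) ((gam_wt_int 1).mul_const C) (Eventually.of_forall fun z s _ => ?_)
  · have e : ∫ z, gam z * fderiv ℝ f (x + s • z) z = 2 * s * Pg s (lap f) x := by
      have e1 : ∀ j, ∫ z, gam z * (z j * pd f j (x + s • z)) = 2 * (s * Pg s (pd (pd f j) j) x) := by
        intro j
        obtain ⟨C1, h01, hC1⟩ := (h.pd j).bc.bdd
        obtain ⟨C2, h02, hC2⟩ := ((h.pd j).pd j).bc.bdd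
        have hFs : Sm (fun z => pd f j (x + s • z)) :=
          (h.sm.pd j).comp (contDiff_const.add (contDiff_const_smul s))
        have hp : ∀ z, pd (fun z => pd f j (x + s • z)) j z = s * pd (pd f j) j (x + s • z) := by
          intro z
          have e := pd_comp_smul (fun y => pd f j (y + x)) s j z
          rw [pd_comp_add] at e
          simpa [add_comm] using e
        have := gauss_ibp hFs (C := max C1 (|s| * C2)) (fun z => (hC1 _).trans (le_max_left _ _)) j
          (fun z => by
            rw [hp, abs_mul]
            exact (mul_le_mul_of_nonneg_left (hC2 _) (abs_nonneg s)).trans (le_max_right _ _))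
        rw [this]
        simp only [hp]
        unfold Pg
        rw [← integral_const_mul s]
        congr 2; funext z; ring
      have e2 : ∀ z, gam z * fderiv ℝ f (x + s • z) z = ∑ j, gam z * (z j * pd f j (x + s • z)) := by
        intro z; rw [fderiv_coord, Finset.mul_sum]
      simp only [e2]
      rw [integral_finsetSum]
      · simp only [e1]
        have : Pg s (lap f) x = ∑ j, Pg s (pd (pd f j) j) x := by
          unfold Pg lap
          rw [← integral_finsetSum _ (fun j _ => Pg_intg ((h.pd j).pd j).bc s x)]
          congr 1; funext z; rw [Finset.mul_sum]
        rw [this, Finset.mul_sum]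
        congr 1; funext j; ring
      · intro j _
        obtain ⟨C1, h01, hC1⟩ := (h.pd j).bc.bdd
        refine ((gam_wt_int 1).mul_const C1).mono' ?_ (Eventually.of_forall fun z => ?_)
        · exact (gam_cont.mul ((Sm.coord j).cont.mul ((h.sm.pd j).cont.comp (by fun_prop)))).aestronglyMeasurable
        · rw [norm_mul, norm_mul, Real.norm_of_nonneg (gam_pos z).le, Real.norm_eq_abs]
          have h1 : |z j| ≤ (1 + ‖z‖) ^ 1 := by linarith [coord_le z j]
          have := mul_le_mul h1 (hC1 (x + s • z)) (abs_nonneg _) (by positivity)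
          calc _ ≤ gam z * ((1 + ‖z‖) ^ 1 * C1) := mul_le_mul_of_nonneg_left this (gam_pos z).le
            _ = _ := by ring
    rw [← e]
    exact key.2
  · rw [norm_mul, Real.norm_of_nonneg (gam_pos z).le]
    have := ((fderiv ℝ f (x + s • z)).le_opNorm z).trans (mul_le_mul_of_nonneg_right (hC _) (norm_nonneg z))
    calc _ ≤ gam z * (C * ‖z‖) := mul_le_mul_of_nonneg_left this (gam_pos z).le
      _ ≤ gam z * (C * (1 + ‖z‖)) := by gcongr; exact (gam_pos z).le; linarith
      _ = _ := by ring
  · have h1 : HasDerivAt (fun s : ℝ => x + s • z) z s := by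
      simpa using ((hasDerivAt_id s).smul_const z).const_add x
    exact ((h.sm.diff (x + s • z)).hasFDerivAt.comp_hasDerivAt s h1).const_mul (gam z)

end

open MeasureTheory Filter Metric
noncomputable section

/-- uniformly decaying family -/
structure DU (F : ℝ → R3 → ℝ) : Prop where
  cont : Continuous (fun p : ℝ × R3 => F p.1 p.2)
  dec : ∃ C, 0 ≤ C ∧ ∀ s x, |s| ≤ 2 → |F s x| ≤ C * Dw x

/-- uniformly bounded family -/
structure BU (F : ℝ → R3 → ℝ) : Prop where
  cont : Continuous (fun p : ℝ × R3 => F p.1 p.2)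
  bdd : ∃ C, 0 ≤ C ∧ ∀ s x, |s| ≤ 2 → |F s x| ≤ C

lemma DU.bu {F : ℝ → R3 → ℝ} (h : DU F) : BU F := by
  obtain ⟨C, h0, hC⟩ := h.dec
  exact ⟨h.cont, C, h0, fun s x hs => (hC s x hs).trans (by nlinarith [Dw_le_one x])⟩

lemma DU.at {F : ℝ → R3 → ℝ} (h : DU F) {s : ℝ} (hs : |s| ≤ 2) : Dec (F s) := by
  obtain ⟨C, h0, hC⟩ := h.dec
  exact ⟨h.cont.comp (f := fun x => (s, x)) (by fun_prop), C, h0, fun x => hC s x hs⟩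

lemma BU.mul {F G : ℝ → R3 → ℝ} (h : BU F) (hG : BU G) : BU (fun s x => F s x * G s x) := by
  obtain ⟨C, h0, hC⟩ := h.bdd
  obtain ⟨C', h0', hC'⟩ := hG.bdd
  refine ⟨h.cont.mul hG.cont, C * C', by positivity, fun s x hs => ?_⟩
  rw [abs_mul]
  exact mul_le_mul (hC s x hs) (hC' s x hs) (abs_nonneg _) h0

lemma DU.mul {F G : ℝ → R3 → ℝ} (h : DU F) (hG : BU G) : DU (fun s x => F s x * G s x) := by
  obtain ⟨C, h0, hC⟩ := h.dec
  obtain ⟨C', h0', hC'⟩ := hG.bdd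
  refine ⟨h.cont.mul hG.cont, C * C', by positivity, fun s x hs => ?_⟩
  rw [abs_mul]
  calc _ ≤ (C * Dw x) * C' := mul_le_mul (hC s x hs) (hC' s x hs) (abs_nonneg _) (by have := Dw_pos x; positivity)
    _ = _ := by ring

lemma DU.mul' {F G : ℝ → R3 → ℝ} (h : BU F) (hG : DU G) : DU (fun s x => F s x * G s x) := by
  have := hG.mul h
  simpa [mul_comm] using this

lemma DU.add {F G : ℝ → R3 → ℝ} (h : DU F) (hG : DU G) : DU (fun s x => F s x + G s x) := by
  obtain ⟨C, h0, hC⟩ := h.dec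
  obtain ⟨C', h0', hC'⟩ := hG.dec
  refine ⟨h.cont.add hG.cont, C + C', by positivity, fun s x hs => ?_⟩
  calc _ ≤ |F s x| + |G s x| := abs_add_le _ _
    _ ≤ C * Dw x + C' * Dw x := add_le_add (hC s x hs) (hC' s x hs)
    _ = _ := by ring

lemma BU.add {F G : ℝ → R3 → ℝ} (h : BU F) (hG : BU G) : BU (fun s x => F s x + G s x) := by
  obtain ⟨C, h0, hC⟩ := h.bdd
  obtain ⟨C', h0', hC'⟩ := hG.bdd
  exact ⟨h.cont.add hG.cont, C + C', by positivity, fun s x hs =>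
    (abs_add_le _ _).trans (add_le_add (hC s x hs) (hC' s x hs))⟩

lemma BU.const (c : ℝ) : BU (fun _ _ => c) := ⟨continuous_const, |c|, abs_nonneg c, fun _ _ _ => le_rfl⟩
lemma BU.s : BU (fun s _ => s) := ⟨continuous_fst, 2, by norm_num, fun _ _ h => h⟩

lemma Pg_DU {f : R3 → ℝ} (hf : Dec f) : DU (fun s => Pg s f) := ⟨Pg_cont hf.bc, Pg_dec hf⟩

/-- Bellman weight -/
def Wt (e G : ℝ) : ℝ := Real.sqrt (G + e ^ 2)

lemma Wt_ge {e G : ℝ} (_ : 0 < e) (hG : 0 ≤ G) : e ≤ Wt e G :=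
  Real.le_sqrt_of_sq_le (by linarith)
lemma Wt_sq {e G : ℝ} (hG : 0 ≤ G) : Wt e G ^ 2 = G + e ^ 2 := Real.sq_sqrt (by positivity)

/-- Bellman function -/
def Bel (e f h W : ℝ) : ℝ := W * (f * f) + W⁻¹ * (h * h) + (3/2) * ((W - e) * ((W - e) * (2 * W + e)))

def Bf (f W : ℝ) : ℝ := 2 * (W * f)
def Bh (h W : ℝ) : ℝ := 2 * (W⁻¹ * h)
def BG (e f h W : ℝ) : ℝ := (1/2) * (W⁻¹ * (f * f)) + (-(1/2)) * (W⁻¹ ^ 3 * (h * h)) + (9/2) * (W - e)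

lemma Wt_deriv {e : ℝ} (he : 0 < e) {G : ℝ → ℝ} {d t : ℝ} (hG : HasDerivAt G d t) (h0 : 0 ≤ G t) :
    HasDerivAt (fun t => Wt e (G t)) ((1/2) * (Wt e (G t))⁻¹ * d) t := by
  have h1 : HasDerivAt (fun t => G t + e ^ 2) d t := hG.add_const _
  have := h1.sqrt (by positivity)
  unfold Wt
  convert this using 1
  field_simp

lemma iWt_deriv {e : ℝ} (he : 0 < e) {G : ℝ → ℝ} {d t : ℝ} (hG : HasDerivAt G d t) (h0 : 0 ≤ G t) :
    HasDerivAt (fun t => (Wt e (G t))⁻¹) (-(1/2) * (Wt e (G t))⁻¹ ^ 3 * d) t := by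
  have hW : Wt e (G t) ≠ 0 := (he.trans_le (Wt_ge he h0)).ne'
  refine ((Wt_deriv he hG h0).inv hW).congr_deriv ?_
  field_simp

lemma Bel_deriv {e : ℝ} (he : 0 < e) {f h G : ℝ → ℝ} {a b d t : ℝ} (hf : HasDerivAt f a t)
    (hh : HasDerivAt h b t) (hG : HasDerivAt G d t) (h0 : 0 ≤ G t) :
    HasDerivAt (fun t => Bel e (f t) (h t) (Wt e (G t)))
      (Bf (f t) (Wt e (G t)) * a + Bh (h t) (Wt e (G t)) * b + BG e (f t) (h t) (Wt e (G t)) * d) t := by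
  have hW : Wt e (G t) ≠ 0 := (he.trans_le (Wt_ge he h0)).ne'
  have w := Wt_deriv he hG h0
  have iw := iWt_deriv he hG h0
  have we := w.sub_const e
  have := ((w.mul (hf.mul hf)).add (iw.mul (hh.mul hh))).add
    ((we.mul (we.mul ((w.const_mul 2).add_const e))).const_mul (3/2))
  unfold Bel Bf Bh BG
  refine this.congr_deriv ?_
  simp only [Pi.mul_apply]
  field_simp
  ring

lemma Bf_deriv {e : ℝ} (he : 0 < e) {f G : ℝ → ℝ} {a d t : ℝ} (hf : HasDerivAt f a t)
    (hG : HasDerivAt G d t) (h0 : 0 ≤ G t) :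
    HasDerivAt (fun t => Bf (f t) (Wt e (G t)))
      (2 * (Wt e (G t) * a) + (Wt e (G t))⁻¹ * (f t * d)) t := by
  have := ((Wt_deriv he hG h0).mul hf).const_mul 2
  unfold Bf
  refine this.congr_deriv ?_
  ring

lemma Bh_deriv {e : ℝ} (he : 0 < e) {h G : ℝ → ℝ} {b d t : ℝ} (hh : HasDerivAt h b t)
    (hG : HasDerivAt G d t) (h0 : 0 ≤ G t) :
    HasDerivAt (fun t => Bh (h t) (Wt e (G t)))
      (2 * ((Wt e (G t))⁻¹ * b) + -((Wt e (G t))⁻¹ ^ 3 * (h t * d))) t := by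
  have := ((iWt_deriv he hG h0).mul hh).const_mul 2
  unfold Bh
  refine this.congr_deriv ?_
  ring

lemma BG_deriv {e : ℝ} (he : 0 < e) {f h G : ℝ → ℝ} {a b d t : ℝ} (hf : HasDerivAt f a t)
    (hh : HasDerivAt h b t) (hG : HasDerivAt G d t) (h0 : 0 ≤ G t) :
    HasDerivAt (fun t => BG e (f t) (h t) (Wt e (G t)))
      ((Wt e (G t))⁻¹ * (f t * a) + -(1/4) * ((Wt e (G t))⁻¹ ^ 3 * (f t * f t * d))
       + (-1) * ((Wt e (G t))⁻¹ ^ 3 * (h t * b)) + (3/4) * ((Wt e (G t))⁻¹ ^ 5 * (h t * h t * d))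
       + (9/4) * ((Wt e (G t))⁻¹ * d)) t := by
  have w := Wt_deriv he hG h0
  have iw := iWt_deriv he hG h0
  have := (((iw.mul (hf.mul hf)).const_mul (1/2)).add (((iw.pow 3).mul (hh.mul hh)).const_mul (-(1/2)))).add
    ((w.sub_const e).const_mul (9/2))
  unfold BG
  refine this.congr_deriv ?_
  simp only [Pi.mul_apply, Pi.pow_apply]
  push_cast
  ring

lemma Bel_Hess {W f h a b d : ℝ} (hW : 0 < W) (hf : f ^ 2 ≤ W ^ 2) (hh : |h| ≤ W ^ 2) :
    W * a ^ 2 + W⁻¹ * b ^ 2 ≤ (2 * (W * a) + W⁻¹ * (f * d)) * a + (2 * (W⁻¹ * b) + -(W⁻¹ ^ 3 * (h * d))) * b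
      + (W⁻¹ * (f * a) + -(1/4) * (W⁻¹ ^ 3 * (f * f * d))
       + (-1) * (W⁻¹ ^ 3 * (h * b)) + (3/4) * (W⁻¹ ^ 5 * (h * h * d))
       + (9/4) * (W⁻¹ * d)) * d := by
  obtain ⟨φ, rfl⟩ : ∃ φ, f = W * φ := ⟨W⁻¹ * f, by field_simp⟩
  obtain ⟨η, rfl⟩ : ∃ η, h = W ^ 2 * η := ⟨W⁻¹ ^ 2 * h, by field_simp⟩
  have h1 : φ ^ 2 ≤ 1 := by
    rw [mul_pow] at hf
    exact le_of_mul_le_mul_left (by linarith) (by positivity : 0 < W ^ 2)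
  have h2 : η ^ 2 ≤ 1 := by
    rw [abs_mul, abs_of_pos (by positivity : 0 < W ^ 2)] at hh
    have : |η| ≤ 1 := le_of_mul_le_mul_left (by linarith) (by positivity : 0 < W ^ 2)
    exact (sq_le_one_iff_abs_le_one η).2 this
  have key : (2 * (W * a) + W⁻¹ * (W * φ * d)) * a + (2 * (W⁻¹ * b) + -(W⁻¹ ^ 3 * (W ^ 2 * η * d))) * b
      + (W⁻¹ * (W * φ * a) + -(1/4) * (W⁻¹ ^ 3 * (W * φ * (W * φ) * d))
       + (-1) * (W⁻¹ ^ 3 * (W ^ 2 * η * b)) + (3/4) * (W⁻¹ ^ 5 * (W ^ 2 * η * (W ^ 2 * η) * d))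
       + (9/4) * (W⁻¹ * d)) * d = W * a ^ 2 + W⁻¹ * b ^ 2 + W * (a + φ * d * W⁻¹) ^ 2 + W⁻¹ * (b - η * d) ^ 2
        + W⁻¹ * d ^ 2 * (9/4 - 5/4 * φ ^ 2 - 1/4 * η ^ 2) := by
    field_simp
    ring
  rw [key]
  have i1 : 0 ≤ W * (a + φ * d * W⁻¹) ^ 2 := by positivity
  have i2 : 0 ≤ W⁻¹ * (b - η * d) ^ 2 := by positivity
  have i3 : 0 ≤ W⁻¹ * d ^ 2 * (9/4 - 5/4 * φ ^ 2 - 1/4 * η ^ 2) := mul_nonneg (by positivity) (by linarith)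
  linarith

lemma amgm_W {W a b : ℝ} (hW : 0 < W) : 2 * (|a| * |b|) ≤ W * a ^ 2 + W⁻¹ * b ^ 2 := by
  have : W * a ^ 2 + W⁻¹ * b ^ 2 - 2 * (|a| * |b|) = W * (|a| - W⁻¹ * |b|) ^ 2 := by
    rw [← sq_abs a, ← sq_abs b]; field_simp; ring
  have h2 : 0 ≤ W * (|a| - W⁻¹ * |b|) ^ 2 := by positivity
  linarith

end

open MeasureTheory Filter Metric
noncomputable section

/-- data of the Bellman lemma -/
structure BD (f0 h0 G1 : R3 → ℝ) : Prop where
  f : Ts f0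
  h : Ts h0
  G : Ts G1
  fG : ∀ x, f0 x ^ 2 ≤ G1 x
  hG : ∀ x, |h0 x| ≤ G1 x

lemma BD.G0 {f h G : R3 → ℝ} (D : BD f h G) (x : R3) : 0 ≤ G x := (abs_nonneg _).trans (D.hG x)

lemma BD.PG0 {f h G : R3 → ℝ} (D : BD f h G) (s : ℝ) (x : R3) : 0 ≤ Pg s G x :=
  (abs_nonneg _).trans (Pg_abs D.h.bc D.G.bc D.hG s x)

lemma Wt_cont (e : ℝ) : Continuous (Wt e) := by unfold Wt; fun_prop

lemma W_BU {G : R3 → ℝ} {e : ℝ} (hG : Ts G) : BU (fun s x => Wt e (Pg s G x)) := by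
  obtain ⟨C, h0, hC⟩ := hG.bc.bdd
  refine ⟨(Wt_cont e).comp (Pg_cont hG.bc), Wt e C, Real.sqrt_nonneg _, fun s x _ => ?_⟩
  rw [abs_of_nonneg (a := Wt e (Pg s G x)) (Real.sqrt_nonneg _)]
  apply Real.sqrt_le_sqrt
  have := (abs_le.1 (Pg_bdd hC s x)).2
  linarith

lemma iW_BU {f h G : R3 → ℝ} (D : BD f h G) {e : ℝ} (he : 0 < e) : BU (fun s x => (Wt e (Pg s G x))⁻¹) := by
  have hp : ∀ s x, e ≤ Wt e (Pg s G x) := fun s x => Wt_ge he (D.PG0 s x)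
  refine ⟨(W_BU D.G).cont.inv₀ (fun p => (he.trans_le (hp p.1 p.2)).ne'), e⁻¹, by positivity, fun s x _ => ?_⟩
  rw [abs_of_pos (inv_pos.2 (he.trans_le (hp s x)))]
  exact inv_anti₀ he (hp s x)

lemma We_DU {f h G : R3 → ℝ} (D : BD f h G) {e : ℝ} (he : 0 < e) : DU (fun s x => Wt e (Pg s G x) - e) := by
  obtain ⟨C, h0, hC⟩ := Pg_dec D.G.dec
  refine ⟨(W_BU D.G).cont.sub continuous_const, e⁻¹ * C, by positivity, fun s x hs => ?_⟩
  have h1 := Wt_ge he (D.PG0 s x)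
  have h2 := Wt_sq (e := e) (D.PG0 s x)
  have h3 := (le_abs_self _).trans (hC s x hs)
  rw [abs_of_nonneg (by linarith), mul_assoc, ← div_eq_inv_mul, le_div_iff₀ he]
  nlinarith

lemma Bel_DU {f h G : R3 → ℝ} (D : BD f h G) {e : ℝ} (he : 0 < e) :
    DU (fun s x => Bel e (Pg s f x) (Pg s h x) (Wt e (Pg s G x))) := by
  have W := W_BU (e := e) D.G
  have iW := iW_BU D he
  have We := We_DU D he
  have f1 := Pg_DU D.f.dec
  have h1 := Pg_DU D.h.dec
  exact ((DU.mul' W (f1.mul f1.bu)).add (DU.mul' iW (h1.mul h1.bu))).add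
    (DU.mul' (BU.const (3/2)) (We.mul (We.bu.mul (((BU.const 2).mul W).add (BU.const e)))))

lemma Bf_BU {f h G : R3 → ℝ} (D : BD f h G) {e : ℝ} :
    BU (fun s x => Bf (Pg s f x) (Wt e (Pg s G x))) :=
  (BU.const 2).mul ((W_BU D.G).mul (Pg_DU D.f.dec).bu)

lemma Bh_BU {f h G : R3 → ℝ} (D : BD f h G) {e : ℝ} (he : 0 < e) :
    BU (fun s x => Bh (Pg s h x) (Wt e (Pg s G x))) :=
  (BU.const 2).mul ((iW_BU D he).mul (Pg_DU D.h.dec).bu)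

lemma BU.pow3 {F : ℝ → R3 → ℝ} (h : BU F) : BU (fun s x => F s x ^ 3) := by
  have := h.mul (h.mul h)
  convert this using 3; ring

lemma BU.pow5 {F : ℝ → R3 → ℝ} (h : BU F) : BU (fun s x => F s x ^ 5) := by
  have := h.pow3.mul (h.mul h)
  convert this using 3; ring

lemma BG_BU {f h G : R3 → ℝ} (D : BD f h G) {e : ℝ} (he : 0 < e) :
    BU (fun s x => BG e (Pg s f x) (Pg s h x) (Wt e (Pg s G x))) := by
  have iW := iW_BU D he
  have We := We_DU D he
  have f1 := Pg_DU D.f.dec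
  have h1 := Pg_DU D.h.dec
  exact (((BU.const (1/2)).mul (iW.mul (f1.bu.mul f1.bu))).add
    ((BU.const (-(1/2))).mul (iW.pow3.mul (h1.bu.mul h1.bu)))).add ((BU.const (9/2)).mul We.bu)

/-- s-derivative of the Bellman function -/
def Bds (e : ℝ) (f h G : R3 → ℝ) (s : ℝ) (x : R3) : ℝ :=
  Bf (Pg s f x) (Wt e (Pg s G x)) * Pg s (lap f) x + Bh (Pg s h x) (Wt e (Pg s G x)) * Pg s (lap h) x
    + BG e (Pg s f x) (Pg s h x) (Wt e (Pg s G x)) * Pg s (lap G) x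

lemma Bds_DU {f h G : R3 → ℝ} (D : BD f h G) {e : ℝ} (he : 0 < e) : DU (Bds e f h G) :=
  ((DU.mul' (Bf_BU D) (Pg_DU D.f.lap.dec)).add (DU.mul' (Bh_BU D he) (Pg_DU D.h.lap.dec))).add
    (DU.mul' (BG_BU D he) (Pg_DU D.G.lap.dec))

/-- the Bellman functional -/
def Phi (e : ℝ) (f h G : R3 → ℝ) (s : ℝ) : ℝ := ∫ x, Bel e (Pg s f x) (Pg s h x) (Wt e (Pg s G x))

lemma Phi_deriv {f h G : R3 → ℝ} (D : BD f h G) {e : ℝ} (he : 0 < e) {s : ℝ} (hs : |s| < 2) :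
    HasDerivAt (Phi e f h G) (2 * s * ∫ x, Bds e f h G s x) s := by
  have hU : DU (fun s x => 2 * s * Bds e f h G s x) := DU.mul' ((BU.const 2).mul BU.s) (Bds_DU D he)
  obtain ⟨C, h0, hC⟩ := hU.dec
  have hB := Bel_DU D he
  have hset : {s : ℝ | |s| < 2} ∈ nhds s := (isOpen_lt continuous_abs continuous_const).mem_nhds hs
  have key := hasDerivAt_integral_of_dominated_loc_of_deriv_le
    (F := fun s x => Bel e (Pg s f x) (Pg s h x) (Wt e (Pg s G x)))
    (F' := fun s x => 2 * s * Bds e f h G s x) (x₀ := s) (s := {s : ℝ | |s| < 2}) (μ := volume)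
    (bound := fun x => C * Dw x) hset
    (Eventually.of_forall fun s => (hB.cont.comp (f := fun x => (s, x)) (by fun_prop)).aestronglyMeasurable)
    (hB.at hs.le).int (hU.at hs.le).cont.aestronglyMeasurable
    (Eventually.of_forall fun x s hs => hC s x (le_of_lt hs)) (Dw_int.const_mul C)
    (Eventually.of_forall fun x s hs => ?_)
  · refine key.2.congr_deriv ?_
    rw [← integral_const_mul]
  · have := Bel_deriv he (Pg_hasDeriv D.f x s) (Pg_hasDeriv D.h x s) (Pg_hasDeriv D.G x s) (D.PG0 s x)
    refine this.congr_deriv ?_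
    unfold Bds; ring

lemma ibp_slice {f F dF : R3 → ℝ} (hf : Ts f) {s : ℝ} (hs : |s| ≤ 2) (j : Fin 3) (hF : Differentiable ℝ F)
    (hFb : BC F) (hd : ∀ x, pd F j x = dF x) (hdF : BC dF) :
    ∫ x, F x * Pg s (pd (pd f j) j) x = - ∫ x, dF x * Pg s (pd f j) x := by
  have e1 : ∀ x, Pg s (pd (pd f j) j) x = pd (Pg s (pd f j)) j x := fun x => (Pg_pd (hf.pd j) s j x).symm
  have e2 : dF = pd F j := by funext x; exact (hd x).symm
  subst e2
  simp only [e1]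
  refine ibp_int hF (Pg_diff (hf.pd j) s) j ?_ ?_ ?_
  · have := ((Pg_Dec (hf.pd j).dec hs).mul hdF).int
    simpa [mul_comm] using this
  · have := ((Pg_Dec ((hf.pd j).pd j).dec hs).mul hFb).int
    simpa [e1, mul_comm] using this
  · have := ((Pg_Dec (hf.pd j).dec hs).mul hFb).int
    simpa [mul_comm] using this

lemma BU.at {F : ℝ → R3 → ℝ} (h : BU F) {s : ℝ} (hs : |s| ≤ 2) : BC (F s) := by
  obtain ⟨C, h0, hC⟩ := h.bdd
  exact ⟨h.cont.comp (f := fun x => (s, x)) (by fun_prop), C, h0, fun x => hC s x hs⟩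

lemma Pg_lap {f : R3 → ℝ} (h : Ts f) (s : ℝ) (x : R3) : Pg s (lap f) x = ∑ j, Pg s (pd (pd f j) j) x := by
  unfold Pg lap
  rw [← integral_finsetSum _ (fun j _ => Pg_intg ((h.pd j).pd j).bc s x)]
  congr 1; funext z; rw [Finset.mul_sum]

lemma intg_add2 {a b : R3 → ℝ} {μ : Measure R3} (ha : Integrable a μ) (hb : Integrable b μ) :
    ∫ x, (a x + b x) ∂μ = (∫ x, a x ∂μ) + ∫ x, b x ∂μ := integral_add ha hb

lemma intg_add3 {a b c : R3 → ℝ} {μ : Measure R3} (ha : Integrable a μ) (hb : Integrable b μ) (hc : Integrable c μ) :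
    ∫ x, (a x + b x + c x) ∂μ = (∫ x, a x ∂μ) + (∫ x, b x ∂μ) + ∫ x, c x ∂μ := by
  have h : Integrable (fun x => a x + b x) μ := ha.add hb
  rw [integral_add h hc, integral_add ha hb]

/-- the sliced inequality -/
lemma slice_ineq {f h G : R3 → ℝ} (D : BD f h G) {e : ℝ} (he : 0 < e) {s : ℝ} (hs : |s| ≤ 2) (i j : Fin 3) :
    2 * ∫ x, |Pg s (pd f i) x| * |Pg s (pd h j) x| ≤ - ∫ x, Bds e f h G s x := by
  have bW := (W_BU (e := e) D.G)
  have biW := (iW_BU D he)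
  have bf := (Pg_DU D.f.dec).bu
  have bh := (Pg_DU D.h.dec).bu
  have ba := fun j => (Pg_DU (D.f.pd j).dec)
  have bb := fun j => (Pg_DU (D.h.pd j).dec)
  have bd := fun j => (Pg_DU (D.G.pd j).dec)
  have lf : ∀ l x, HasDerivAt (fun t : ℝ => Pg s f (x + t • bv l)) (Pg s (pd f l) (x + (0:ℝ) • bv l)) 0 := fun l x => by
    rw [← Pg_pd D.f]; exact hasDeriv_line (Pg_diff D.f s) l x 0
  have lh : ∀ l x, HasDerivAt (fun t : ℝ => Pg s h (x + t • bv l)) (Pg s (pd h l) (x + (0:ℝ) • bv l)) 0 := fun l x => by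
    rw [← Pg_pd D.h]; exact hasDeriv_line (Pg_diff D.h s) l x 0
  have lG : ∀ l x, HasDerivAt (fun t : ℝ => Pg s G (x + t • bv l)) (Pg s (pd G l) (x + (0:ℝ) • bv l)) 0 := fun l x => by
    rw [← Pg_pd D.G]; exact hasDeriv_line (Pg_diff D.G s) l x 0
  have Wp : ∀ x, 0 < Wt e (Pg s G x) := fun x => he.trans_le (Wt_ge he (D.PG0 s x))
  have dW : Differentiable ℝ (fun x => Wt e (Pg s G x)) := by
    unfold Wt
    refine Differentiable.sqrt ((Pg_diff D.G s).add_const _) (fun x => ?_)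
    have := D.PG0 s x; positivity
  have diW : Differentiable ℝ (fun x => (Wt e (Pg s G x))⁻¹) := dW.inv (fun x => (Wp x).ne')
  have df := Pg_diff D.f s
  have dh := Pg_diff D.h s
  set A : Fin 3 → R3 → ℝ := fun l x => 2 * (Wt e (Pg s G x) * Pg s (pd f l) x) + (Wt e (Pg s G x))⁻¹ * (Pg s f x * Pg s (pd G l) x) with hA
  set B : Fin 3 → R3 → ℝ := fun l x => 2 * ((Wt e (Pg s G x))⁻¹ * Pg s (pd h l) x) + -((Wt e (Pg s G x))⁻¹ ^ 3 * (Pg s h x * Pg s (pd G l) x)) with hB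
  set C : Fin 3 → R3 → ℝ := fun l x => (Wt e (Pg s G x))⁻¹ * (Pg s f x * Pg s (pd f l) x) + -(1/4) * ((Wt e (Pg s G x))⁻¹ ^ 3 * (Pg s f x * Pg s f x * Pg s (pd G l) x))
       + (-1) * ((Wt e (Pg s G x))⁻¹ ^ 3 * (Pg s h x * Pg s (pd h l) x)) + (3/4) * ((Wt e (Pg s G x))⁻¹ ^ 5 * (Pg s h x * Pg s h x * Pg s (pd G l) x))
       + (9/4) * ((Wt e (Pg s G x))⁻¹ * Pg s (pd G l) x) with hC
  have cA : ∀ l, BC (A l) := fun l =>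
    (((BU.const 2).mul (bW.mul (ba l).bu)).add (biW.mul (bf.mul (bd l).bu))).at hs
  have cB : ∀ l, BC (B l) := fun l => by
    have := (((BU.const 2).mul (biW.mul (bb l).bu)).add ((BU.const (-1)).mul (biW.pow3.mul (bh.mul (bd l).bu)))).at hs
    simpa [hB] using this
  have cC : ∀ l, BC (C l) := fun l =>
    ((((biW.mul (bf.mul (ba l).bu)).add ((BU.const _).mul (biW.pow3.mul ((bf.mul bf).mul (bd l).bu)))).add
      ((BU.const _).mul (biW.pow3.mul (bh.mul (bb l).bu)))).add
      ((BU.const _).mul (biW.pow5.mul ((bh.mul bh).mul (bd l).bu)))).add ((BU.const _).mul (biW.mul (bd l).bu)) |>.at hs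
  have tf : ∀ l, ∫ x, Bf (Pg s f x) (Wt e (Pg s G x)) * Pg s (pd (pd f l) l) x = - ∫ x, A l x * Pg s (pd f l) x := fun l => by
    have hdiff : Differentiable ℝ (fun x => Bf (Pg s f x) (Wt e (Pg s G x))) := (dW.mul df).const_mul 2
    refine ibp_slice D.f hs l hdiff ((Bf_BU D).at hs) (fun x => ?_) (cA l)
    refine pd_of_line (hdiff x) ((Bf_deriv he (lf l x) (lG l x) (D.PG0 s _)).congr_deriv ?_)
    simp [hA]
  have th : ∀ l, ∫ x, Bh (Pg s h x) (Wt e (Pg s G x)) * Pg s (pd (pd h l) l) x = - ∫ x, B l x * Pg s (pd h l) x := fun l => by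
    have hdiff : Differentiable ℝ (fun x => Bh (Pg s h x) (Wt e (Pg s G x))) := (diW.mul dh).const_mul 2
    refine ibp_slice D.h hs l hdiff ((Bh_BU D he).at hs) (fun x => ?_) (cB l)
    refine pd_of_line (hdiff x) ((Bh_deriv he (lh l x) (lG l x) (D.PG0 s _)).congr_deriv ?_)
    simp [hB]
  have tG : ∀ l, ∫ x, BG e (Pg s f x) (Pg s h x) (Wt e (Pg s G x)) * Pg s (pd (pd G l) l) x = - ∫ x, C l x * Pg s (pd G l) x := fun l => by
    have hdiff : Differentiable ℝ (fun x => BG e (Pg s f x) (Pg s h x) (Wt e (Pg s G x))) :=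
      (((diW.mul (df.mul df)).const_mul _).add (((diW.pow 3).mul (dh.mul dh)).const_mul _)).add ((dW.sub_const e).const_mul _)
    refine ibp_slice D.G hs l hdiff ((BG_BU D he).at hs) (fun x => ?_) (cC l)
    refine pd_of_line (hdiff x) ((BG_deriv he (lf l x) (lh l x) (lG l x) (D.PG0 s _)).congr_deriv ?_)
    simp [hC]
  have iA : ∀ l, Integrable (fun x => A l x * Pg s (pd f l) x) := fun l => by
    simpa [mul_comm] using (((ba l).at hs).mul (cA l)).int
  have iB : ∀ l, Integrable (fun x => B l x * Pg s (pd h l) x) := fun l => by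
    simpa [mul_comm] using (((bb l).at hs).mul (cB l)).int
  have iC : ∀ l, Integrable (fun x => C l x * Pg s (pd G l) x) := fun l => by
    simpa [mul_comm] using (((bd l).at hs).mul (cC l)).int
  have jf : ∀ l, Integrable (fun x => Bf (Pg s f x) (Wt e (Pg s G x)) * Pg s (pd (pd f l) l) x) := fun l => by
    simpa [mul_comm] using ((Pg_Dec ((D.f.pd l).pd l).dec hs).mul ((Bf_BU (e := e) D).at hs)).int
  have jh : ∀ l, Integrable (fun x => Bh (Pg s h x) (Wt e (Pg s G x)) * Pg s (pd (pd h l) l) x) := fun l => by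
    simpa [mul_comm] using ((Pg_Dec ((D.h.pd l).pd l).dec hs).mul ((Bh_BU D he).at hs)).int
  have jG : ∀ l, Integrable (fun x => BG e (Pg s f x) (Pg s h x) (Wt e (Pg s G x)) * Pg s (pd (pd G l) l) x) := fun l => by
    simpa [mul_comm] using ((Pg_Dec ((D.G.pd l).pd l).dec hs).mul ((BG_BU D he).at hs)).int
  have iABC : ∀ l, Integrable (fun x => A l x * Pg s (pd f l) x + B l x * Pg s (pd h l) x + C l x * Pg s (pd G l) x) :=
    fun l => ((iA l).add (iB l)).add (iC l)
  have jABC : ∀ l, Integrable (fun x => Bf (Pg s f x) (Wt e (Pg s G x)) * Pg s (pd (pd f l) l) x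
        + Bh (Pg s h x) (Wt e (Pg s G x)) * Pg s (pd (pd h l) l) x
        + BG e (Pg s f x) (Pg s h x) (Wt e (Pg s G x)) * Pg s (pd (pd G l) l) x) :=
    fun l => ((jf l).add (jh l)).add (jG l)
  have main : - ∫ x, Bds e f h G s x = ∫ x, ∑ l, (A l x * Pg s (pd f l) x + B l x * Pg s (pd h l) x + C l x * Pg s (pd G l) x) := by
    have e1 : ∀ x, Bds e f h G s x = ∑ l, (Bf (Pg s f x) (Wt e (Pg s G x)) * Pg s (pd (pd f l) l) x
        + Bh (Pg s h x) (Wt e (Pg s G x)) * Pg s (pd (pd h l) l) x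
        + BG e (Pg s f x) (Pg s h x) (Wt e (Pg s G x)) * Pg s (pd (pd G l) l) x) := by
      intro x
      unfold Bds
      rw [Pg_lap D.f, Pg_lap D.h, Pg_lap D.G, Finset.mul_sum, Finset.mul_sum, Finset.mul_sum,
        ← Finset.sum_add_distrib, ← Finset.sum_add_distrib]
    simp only [e1]
    rw [integral_finsetSum _ (fun l _ => iABC l), integral_finsetSum _ (fun l _ => jABC l),
      ← Finset.sum_neg_distrib]
    refine Finset.sum_congr rfl fun l _ => ?_
    rw [intg_add3 (iA l) (iB l) (iC l), intg_add3 (jf l) (jh l) (jG l), tf l, th l, tG l]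
    ring
  rw [main, ← integral_const_mul]
  refine integral_mono_of_nonneg (Eventually.of_forall fun x => by positivity) (integrable_finsetSum _ (fun l _ => iABC l))
    (Eventually.of_forall fun x => ?_)
  have hW2 := Wt_sq (e := e) (D.PG0 s x)
  have q : ∀ l, Wt e (Pg s G x) * Pg s (pd f l) x ^ 2 + (Wt e (Pg s G x))⁻¹ * Pg s (pd h l) x ^ 2 ≤
      A l x * Pg s (pd f l) x + B l x * Pg s (pd h l) x + C l x * Pg s (pd G l) x := fun l => by
    have := Bel_Hess (a := Pg s (pd f l) x) (b := Pg s (pd h l) x) (d := Pg s (pd G l) x) (Wp x) (f := Pg s f x) (h := Pg s h x)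
      (by rw [hW2]; have := Pg_sq D.f.bc D.G.bc D.fG s x; nlinarith)
      (by rw [hW2]; have := Pg_abs D.h.bc D.G.bc D.hG s x; nlinarith)
    exact this
  have w := (Wp x).le
  calc 2 * (|Pg s (pd f i) x| * |Pg s (pd h j) x|)
      ≤ Wt e (Pg s G x) * Pg s (pd f i) x ^ 2 + (Wt e (Pg s G x))⁻¹ * Pg s (pd h j) x ^ 2 := amgm_W (Wp x)
    _ ≤ ∑ l, Wt e (Pg s G x) * Pg s (pd f l) x ^ 2 + ∑ l, (Wt e (Pg s G x))⁻¹ * Pg s (pd h l) x ^ 2 := by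
        refine add_le_add ?_ ?_
        · exact Finset.single_le_sum (f := fun l => Wt e (Pg s G x) * Pg s (pd f l) x ^ 2) (fun l _ => by positivity) (Finset.mem_univ i)
        · exact Finset.single_le_sum (f := fun l => (Wt e (Pg s G x))⁻¹ * Pg s (pd h l) x ^ 2) (fun l _ => by positivity) (Finset.mem_univ j)
    _ ≤ _ := by
        rw [← Finset.sum_add_distrib]
        exact Finset.sum_le_sum fun l _ => q l

lemma DU.contOn_int {F : ℝ → R3 → ℝ} (h : DU F) : ContinuousOn (fun s => ∫ x, F s x) (Set.Icc 0 1) := by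
  obtain ⟨C, h0, hC⟩ := h.dec
  have hs2 : ∀ s ∈ Set.Icc (0:ℝ) 1, |s| ≤ 2 := fun s hs => by rw [abs_of_nonneg hs.1]; linarith [hs.2]
  refine continuousOn_of_dominated (bound := fun x => C * Dw x) (fun s hs => (h.at (hs2 s hs)).cont.aestronglyMeasurable)
    (fun s hs => Eventually.of_forall fun x => hC s x (hs2 s hs)) (Dw_int.const_mul C) (Eventually.of_forall fun x => ?_)
  exact (h.cont.comp (f := fun s => (s, x)) (by fun_prop)).continuousOn

lemma DU.abs {F : ℝ → R3 → ℝ} (h : DU F) : DU (fun s x => |F s x|) := by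
  obtain ⟨C, h0, hC⟩ := h.dec
  exact ⟨h.cont.abs, C, h0, fun s x hs => by rw [abs_abs]; exact hC s x hs⟩

/-- square function pairing -/
def Iij (f h : R3 → ℝ) (i j : Fin 3) (s : ℝ) : ℝ := ∫ x, |Pg s (pd f i) x| * |Pg s (pd h j) x|

lemma Iij_cont {f h : R3 → ℝ} (hf : Ts f) (hh : Ts h) (i j : Fin 3) : ContinuousOn (Iij f h i j) (Set.Icc 0 1) :=
  ((Pg_DU (hf.pd i).dec).abs.mul (Pg_DU (hh.pd j).dec).abs.bu).contOn_int

lemma Bel_nonneg {e f h G : ℝ} (he : 0 < e) (hG : 0 ≤ G) : 0 ≤ Bel e f h (Wt e G) := by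
  have := Wt_ge he hG
  have hW : 0 < Wt e G := he.trans_le this
  unfold Bel
  have h1 : 0 ≤ Wt e G - e := by linarith
  have h2 := mul_self_nonneg f
  have h3 := mul_self_nonneg h
  positivity

lemma Bel_le {e f h G : ℝ} (he : 0 < e) (hG : 0 ≤ G) (hf : f ^ 2 ≤ G) (hh : |h| ≤ G) :
    Bel e f h (Wt e G) ≤ 7 * (G * Real.sqrt G) + 7 * e * G := by
  have h1 := Wt_ge he hG
  have hW : 0 < Wt e G := he.trans_le h1
  have h2 := Wt_sq (e := e) hG
  have h3 : Wt e G ≤ Real.sqrt G + e := by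
    apply Real.sqrt_le_iff.2
    refine ⟨by positivity, ?_⟩
    nlinarith [Real.sq_sqrt hG, Real.sqrt_nonneg G, mul_nonneg (Real.sqrt_nonneg G) he.le]
  set W := Wt e G
  have t1 : W * (f * f) ≤ W * G := by gcongr; nlinarith
  have t2 : W⁻¹ * (h * h) ≤ W * G := by
    rw [← div_eq_inv_mul, div_le_iff₀ hW]
    have := abs_mul_abs_self h
    have a0 := abs_nonneg h
    nlinarith [mul_le_mul hh hh a0 hG, mul_nonneg hG (sq_nonneg e)]
  have t3 : (W - e) * ((W - e) * (2 * W + e)) ≤ G * (3 * W) := by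
    have : (W - e) * (W - e) ≤ G := by nlinarith
    calc (W - e) * ((W - e) * (2 * W + e)) = ((W - e) * (W - e)) * (2 * W + e) := by ring
      _ ≤ G * (3 * W) := mul_le_mul this (by linarith) (by positivity) hG
  have t4 : G * W ≤ G * (Real.sqrt G + e) := by gcongr
  unfold Bel
  nlinarith

theorem bellman {f h G : R3 → ℝ} (D : BD f h G) (i j : Fin 3) :
    ∫ s in (0:ℝ)..1, s * Iij f h i j s ≤ 2 * ∫ x, G x * Real.sqrt (G x) := by
  have hX : ∀ e, 0 < e → 4 * ∫ s in (0:ℝ)..1, s * Iij f h i j s ≤ 7 * (∫ x, G x * Real.sqrt (G x)) + 7 * e * ∫ x, G x := by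
    intro e he
    have hs2 : ∀ s ∈ Set.Icc (0:ℝ) 1, |s| < 2 := fun s hs => by rw [abs_of_nonneg hs.1]; linarith [hs.2]
    have hI : ContinuousOn (fun s => 4 * (s * Iij f h i j s)) (Set.Icc 0 1) :=
      continuousOn_const.mul (continuousOn_id.mul (Iij_cont D.f D.h i j))
    have k := intervalIntegral.integral_le_sub_of_hasDeriv_right_of_le (a := 0) (b := 1) (g := fun s => - Phi e f h G s)
      (g' := fun s => -(2 * s * ∫ x, Bds e f h G s x)) (φ := fun s => 4 * (s * Iij f h i j s)) zero_le_one
      (fun s hs => (Phi_deriv D he (hs2 s hs)).neg.continuousAt.continuousWithinAt)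
      (fun s hs => (Phi_deriv D he (hs2 s ⟨hs.1.le, hs.2.le⟩)).neg.hasDerivWithinAt)
      (hI.integrableOn_Icc) (fun s hs => ?_)
    · rw [intervalIntegral.integral_const_mul] at k
      have p1 : 0 ≤ Phi e f h G 1 := integral_nonneg fun x => Bel_nonneg he (D.PG0 1 x)
      have iG : Integrable (fun x => G x * Real.sqrt (G x)) :=
        int_cs (D.G.sm.cont.mul D.G.sm.cont.sqrt) (cs_mul_left D.G.cs)
      have p0 : Phi e f h G 0 ≤ 7 * (∫ x, G x * Real.sqrt (G x)) + 7 * e * ∫ x, G x := by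
        rw [← integral_const_mul, ← integral_const_mul, ← integral_add (iG.const_mul _) (D.G.int.const_mul _)]
        refine integral_mono ((Bel_DU D he).at (by simp)).int ((iG.const_mul _).add (D.G.int.const_mul _)) fun x => ?_
        simp only [Pg_zero]
        exact Bel_le he (D.G0 x) (D.fG x) (D.hG x)
      linarith
    · have := slice_ineq D he (hs2 s ⟨hs.1.le, hs.2.le⟩).le i j
      have h2 : (0:ℝ) < s := hs.1
      unfold Iij
      nlinarith
  have hG0 : 0 ≤ ∫ x, G x := integral_nonneg D.G0
  have hG1 : 0 ≤ ∫ x, G x * Real.sqrt (G x) := integral_nonneg fun x => mul_nonneg (D.G0 x) (Real.sqrt_nonneg _)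
  have : 4 * ∫ s in (0:ℝ)..1, s * Iij f h i j s ≤ 7 * (∫ x, G x * Real.sqrt (G x)) := by
    refine le_of_forall_pos_le_add fun ε hε => ?_
    have := hX (ε / (7 * (∫ x, G x) + 1)) (by positivity)
    refine this.trans (add_le_add le_rfl ?_)
    rw [mul_div_assoc', div_mul_eq_mul_div, div_le_iff₀ (by positivity)]
    nlinarith
  linarith

end

open MeasureTheory Filter Metric
noncomputable section

/-- correlation -/
def cr (f g : R3 → ℝ) (y : R3) : ℝ := ∫ x, f (x + y) * g x

lemma cr_alt (f g : R3 → ℝ) (y : R3) : cr f g y = ∫ z, f z * g (z - y) := by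
  rw [cr, ← integral_add_right_eq_self (fun z => f z * g (z - y)) y]
  simp

lemma cr_conv (f g : R3 → ℝ) : cr f g = convolution f (fun t => g (-t)) (ContinuousLinearMap.mul ℝ ℝ) volume := by
  funext y
  rw [cr_alt]
  simp [convolution]

lemma Ts.reflect {g : R3 → ℝ} (hg : Ts g) : Ts (fun t => g (-t)) :=
  ⟨hg.sm.comp contDiff_neg, hg.cs.comp_homeomorph (Homeomorph.neg R3)⟩

lemma cr_sm {f g : R3 → ℝ} (hf : Sm f) (hg : Ts g) : Sm (cr f g) := by
  rw [cr_conv]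
  exact hg.reflect.cs.contDiff_convolution_right _ hf.cont.locallyIntegrable hg.reflect.sm

lemma cr_ts {f g : R3 → ℝ} (hf : Ts f) (hg : Ts g) : Ts (cr f g) := by
  refine ⟨cr_sm hf.sm hg, ?_⟩
  rw [cr_conv]
  exact HasCompactSupport.convolution _ hf.cs hg.reflect.cs

lemma cr_pd' {f g : R3 → ℝ} (hf : Sm f) (hg : Ts g) (j : Fin 3) (y : R3) :
    pd (cr f g) j y = - cr f (pd g j) y := by
  have h := hg.reflect.cs.hasFDerivAt_convolution_right (ContinuousLinearMap.mul ℝ ℝ) (μ := volume)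
    hf.cont.locallyIntegrable (hg.reflect.sm.of_le (by simp)) y
  rw [← cr_conv] at h
  rw [pd_def, h.fderiv, convolution_precompR_apply _ hf.cont.locallyIntegrable
    (hg.reflect.cs.fderiv (𝕜 := ℝ)) (hg.reflect.sm.continuous_fderiv (by simp)), cr_alt, convolution, ← integral_neg]
  congr 1; funext t
  have : fderiv ℝ (fun t => g (-t)) (y - t) (bv j) = - pd g j (t - y) := by
    have := pd_comp_smul g (-1) j (y - t)
    simp only [neg_smul, one_smul, neg_sub] at this
    rw [pd_def] at this
    rw [this]; ring
  simp [this]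

lemma cr_pd {f g : R3 → ℝ} (hf : Sm f) (hg : Ts g) (j : Fin 3) (y : R3) :
    pd (cr f g) j y = cr (pd f j) g y := by
  rw [cr_pd' hf hg, cr, cr]
  have := ibp (hf.comp_add y) hg.sm hg.cs j
  rw [this, neg_neg]
  simp only [pd_comp_add]

lemma cr_swap (f g : R3 → ℝ) (y : R3) : cr f g y = cr g f (-y) := by
  rw [cr_alt, cr]
  congr 1; funext x; rw [sub_eq_add_neg, mul_comm]

lemma cr_intg_le {f g : R3 → ℝ} (hf : Ts f) (hg : Ts g) :
    ∫ y, |cr f g y| ≤ (∫ x, |f x|) * ∫ x, |g x| := by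
  have h := integral_convolution (ContinuousLinearMap.mul ℝ ℝ) hf.int.abs hg.reflect.int.abs (μ := volume) (ν := volume)
  simp only [ContinuousLinearMap.mul_apply'] at h
  have e : ∫ x, |g (-x)| = ∫ x, |g x| := integral_neg_eq_self (fun x => |g x|) volume
  rw [← e, ← h]
  refine integral_mono (cr_ts hf hg).int.abs ?_ fun y => ?_
  · exact hf.int.abs.integrable_convolution _ hg.reflect.int.abs
  · rw [cr_conv]
    simp only [convolution]
    refine (abs_integral_le_integral_abs).trans (le_of_eq ?_)
    simp [abs_mul]

lemma gprod_int {a b : R3 → ℝ} (ha : BC a) (hb : Dec b) (s : ℝ) :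
    Integrable (fun p : R3 × R3 => gam p.1 * (a (p.2 + s • p.1) * b p.2)) (volume.prod volume) := by
  obtain ⟨C, h0, hC⟩ := ha.bdd
  have h : Integrable (fun p : R3 × R3 => C * (gam p.1 * b p.2)) (volume.prod volume) :=
    (gam_int.mul_prod hb.int).const_mul C
  have c1 := gam_cont
  have c2 := ha.cont
  have c3 := hb.cont
  refine h.mono (by fun_prop) (Eventually.of_forall fun p => ?_)
  simp only [Real.norm_eq_abs, abs_mul]
  have := hC (p.2 + s • p.1)
  rw [abs_of_nonneg h0]
  have e : |gam p.1| * (|a (p.2 + s • p.1)| * |b p.2|) = |a (p.2 + s • p.1)| * (|gam p.1| * |b p.2|) := by ring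
  rw [e]
  gcongr

lemma Pg_cr {a b : R3 → ℝ} (ha : BC a) (hb : Dec b) (s : ℝ) :
    Pg s (cr a b) 0 = ∫ x, Pg s a x * b x := by
  have h := integral_integral_swap (f := fun z x => gam z * (a (x + s • z) * b x)) (gprod_int ha hb s)
  unfold Pg cr
  simp only [zero_add, ← integral_const_mul, ← integral_mul_const]
  rw [h]
  simp only [mul_assoc]

lemma Pg_refl (s : ℝ) (f : R3 → ℝ) : Pg s (fun y => f (-y)) 0 = Pg s f 0 := by
  unfold Pg
  rw [← integral_neg_eq_self (fun z => gam z * f (0 + s • z))]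
  simp [gam_even]

lemma Pg_adj {a b : R3 → ℝ} (ha : Dec a) (hb : Dec b) (s : ℝ) :
    ∫ x, Pg s a x * b x = ∫ x, a x * Pg s b x := by
  rw [← Pg_cr ha.bc hb]
  have : cr a b = fun y => cr b a (-y) := funext fun y => cr_swap a b y
  rw [this, Pg_refl, Pg_cr hb.bc ha]
  simp only [mul_comm]

lemma gam_conv (y : R3) : ∫ z, gam z * gam (y - z) = (Real.sqrt 2 ^ 3)⁻¹ * gam ((Real.sqrt 2)⁻¹ • y) := by
  have h2 : Real.sqrt 2 ^ 2 = 2 := Real.sq_sqrt (by norm_num)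
  have hs : 0 < Real.sqrt 2 := by positivity
  have key : ∀ z, gam z * gam (y - z) = gc * gam ((Real.sqrt 2)⁻¹ • y) * gau (Real.sqrt 2 • (z - (1/2:ℝ) • y)) := by
    intro z
    have par := parallelogram_law_with_norm ℝ (z - (1/2:ℝ) • y) ((1/2:ℝ) • y)
    have e1 : z - (1/2:ℝ) • y + (1/2:ℝ) • y = z := by simp
    have e2 : ‖z - (1/2:ℝ) • y - (1/2:ℝ) • y‖ = ‖y - z‖ := by
      rw [sub_sub, ← add_smul, norm_sub_rev]; norm_num
    have e3 : ‖(1/2:ℝ) • y‖ = (1/2) * ‖y‖ := by rw [norm_smul]; norm_num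
    rw [e1, e2, e3] at par
    unfold gam gau
    have : Real.exp (-(1/4) * ‖z‖ ^ 2) * Real.exp (-(1/4) * ‖y - z‖ ^ 2) =
        Real.exp (-(1/4) * ‖(Real.sqrt 2)⁻¹ • y‖ ^ 2) * Real.exp (-(1/4) * ‖Real.sqrt 2 • (z - (1/2:ℝ) • y)‖ ^ 2) := by
      rw [← Real.exp_add, ← Real.exp_add]
      congr 1
      rw [norm_smul, norm_smul, mul_pow, mul_pow, Real.norm_eq_abs, Real.norm_eq_abs, sq_abs, sq_abs, inv_pow, h2]
      nlinarith
    linear_combination gc * gc * this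
  simp only [key]
  rw [integral_const_mul]
  have t1 := integral_sub_right_eq_self (fun z => gau (Real.sqrt 2 • z)) ((1/2:ℝ) • y) (μ := (volume : Measure R3))
  rw [t1, Measure.integral_comp_smul]
  simp only [finrank_euclideanSpace, Fintype.card_fin, smul_eq_mul]
  rw [abs_of_pos (by positivity)]
  have : gc * ∫ z, gau z = 1 := by rw [gc, inv_mul_cancel₀ gau_int_pos.ne']
  linear_combination gam ((Real.sqrt 2)⁻¹ • y) * (Real.sqrt 2 ^ 3)⁻¹ * this

lemma gshear_int : Integrable (fun p : R3 × R3 => gam p.1 * gam (p.2 - p.1)) (volume.prod volume) := by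
  have h := gam_int.convolution_integrand (ContinuousLinearMap.mul ℝ ℝ) gam_int (μ := volume) (ν := volume)
  exact h.swap

lemma Pg_semi {a : R3 → ℝ} (ha : BC a) (t : ℝ) (x : R3) : Pg t (Pg t a) x = Pg (Real.sqrt 2 * t) a x := by
  obtain ⟨C, h0, hC⟩ := ha.bdd
  have c1 := gam_cont
  have c2 := ha.cont
  have hs : 0 < Real.sqrt 2 := by positivity
  have e1 : ∀ z, Pg t a (x + t • z) = ∫ y, gam (y - z) * a (x + t • y) := fun z => by
    unfold Pg
    rw [← integral_sub_right_eq_self (fun w => gam w * a (x + t • z + t • w)) z]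
    congr 1; funext y
    congr 2
    rw [smul_sub]; abel
  have hI : Integrable (fun p : R3 × R3 => gam p.1 * (gam (p.2 - p.1) * a (x + t • p.2))) (volume.prod volume) := by
    have := gshear_int.const_mul C
    refine this.mono (by fun_prop) (Eventually.of_forall fun p => ?_)
    simp only [Real.norm_eq_abs, abs_mul]
    rw [abs_of_nonneg h0]
    have e : |gam p.1| * (|gam (p.2 - p.1)| * |a (x + t • p.2)|) = |a (x + t • p.2)| * (|gam p.1| * |gam (p.2 - p.1)|) := by ring
    rw [e]
    gcongr; exact hC _
  have e2 : Pg t (Pg t a) x = ∫ z, ∫ y, gam z * (gam (y - z) * a (x + t • y)) := by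
    conv_lhs => unfold Pg
    congr 1; funext z
    have := e1 z
    rw [integral_const_mul, ← this]; rfl
  rw [e2, integral_integral_swap hI]
  have e3 : ∀ y, ∫ z, gam z * (gam (y - z) * a (x + t • y)) = (Real.sqrt 2 ^ 3)⁻¹ * (gam ((Real.sqrt 2)⁻¹ • y) * a (x + t • y)) := fun y => by
    simp only [← mul_assoc]
    rw [integral_mul_const, gam_conv]
  simp only [e3]
  rw [integral_const_mul]
  have := Measure.integral_comp_smul volume (fun y => gam ((Real.sqrt 2)⁻¹ • y) * a (x + t • y)) (Real.sqrt 2)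
  simp only [finrank_euclideanSpace, Fintype.card_fin, smul_eq_mul, smul_smul, inv_mul_cancel₀ hs.ne', one_smul] at this
  rw [abs_of_pos (by positivity)] at this
  rw [← this]
  unfold Pg
  simp only [mul_comm]

lemma Pg_cr_pd {h g : R3 → ℝ} (hh : Ts h) (hg : Ts g) (i j : Fin 3) {t : ℝ} (ht : |t| ≤ 1) :
    |Pg (Real.sqrt 2 * t) (pd (pd (cr h g) j) i) 0| ≤ Iij g h i j t := by
  have e : pd (pd (cr h g) j) i = fun y => (-1) * cr (pd h j) (pd g i) y := by
    have : pd (cr h g) j = cr (pd h j) g := funext fun y => cr_pd hh.sm hg j y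
    rw [this]; funext y; rw [cr_pd' (hh.pd j).sm hg]; ring
  have ht2 : |t| ≤ 2 := by linarith
  have e2 : Pg (Real.sqrt 2 * t) (pd (pd (cr h g) j) i) 0 = - ∫ x, Pg t (pd h j) x * Pg t (pd g i) x := by
    rw [← Pg_adj (Pg_Dec (hh.pd j).dec ht2) (hg.pd i).dec]
    simp only [Pg_semi (hh.pd j).bc]
    rw [← Pg_cr (hh.pd j).bc (hg.pd i).dec, e]
    unfold Pg
    rw [← integral_neg]; congr 1; funext z; ring
  rw [e2, abs_neg]
  refine abs_integral_le_integral_abs.trans (le_of_eq ?_)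
  unfold Iij
  congr 1; funext x; rw [abs_mul, mul_comm]

end

open MeasureTheory Filter Metric
noncomputable section

/-- admissible multipliers: temperate growth and vanishing near the origin -/
structure Kq (q : R3 → ℝ) : Prop where
  tg : Function.HasTemperateGrowth q
  zr : ∀ y, ‖y‖ < 1/8 → q y = 0

lemma tg_pd {q : R3 → ℝ} (h : Function.HasTemperateGrowth q) (j : Fin 3) : Function.HasTemperateGrowth (pd q j) := by
  have h1 : Function.HasTemperateGrowth (fderiv ℝ q) := by
    refine ⟨h.1.fderiv_right (by simp), fun n => ?_⟩
    obtain ⟨k, C, hC⟩ := h.2 (n+1)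
    exact ⟨k, C, fun x => by rw [norm_iteratedFDeriv_fderiv]; exact hC x⟩
  exact ((ContinuousLinearMap.apply ℝ ℝ (bv j)).hasTemperateGrowth).comp h1

lemma Kq.sm {q : R3 → ℝ} (h : Kq q) : Sm q := h.tg.1

lemma Kq.pd {q : R3 → ℝ} (h : Kq q) (j : Fin 3) : Kq (pd q j) := by
  refine ⟨tg_pd h.tg j, fun y hy => pd_zero_off (fun hm => ?_) j⟩
  have : q =ᶠ[nhds y] 0 := by
    filter_upwards [(isOpen_lt continuous_norm continuous_const).mem_nhds hy] with z hz using h.zr z hz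
  exact (notMem_tsupport_iff_eventuallyEq.2 this) hm

lemma Kq.coord {q : R3 → ℝ} (h : Kq q) (j : Fin 3) : Kq (fun y => y j * q y) :=
  ⟨((EuclideanSpace.proj (𝕜 := ℝ) j : R3 →L[ℝ] ℝ).hasTemperateGrowth).mul h.tg, fun y hy => by rw [h.zr y hy, mul_zero]⟩

/-- scaled gaussian kernels -/
def kb (m : ℕ) (q : R3 → ℝ) (s : ℝ) (y : R3) : ℝ := (s ^ m)⁻¹ * (gam (s⁻¹ • y) * q y)

lemma gam_sc_sm (s : ℝ) : Sm (fun y => gam (s⁻¹ • y)) := gam_sm.comp (contDiff_const_smul s⁻¹)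

lemma kb_sm {q : R3 → ℝ} (h : Sm q) (m : ℕ) (s : ℝ) : Sm (kb m q s) :=
  ((gam_sc_sm s).mul h).cmul _

lemma kb_ts {q : R3 → ℝ} (h : Ts q) (m : ℕ) (s : ℝ) : Ts (kb m q s) :=
  ⟨kb_sm h.sm m s, cs_mul_right (cs_mul_right h.cs)⟩

lemma kb_pd {q : R3 → ℝ} (h : Sm q) (m : ℕ) {s : ℝ} (hs : 0 < s) (j : Fin 3) :
    pd (kb m q s) j = fun y => kb m (pd q j) s y + (-(1/2)) * kb (m+2) (fun y => y j * q y) s y := by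
  funext y
  unfold kb
  rw [pd_cmul ((gam_sc_sm s).mul h).diff, pd_mul (gam_sc_sm s).diff h.diff, pd_comp_smul, pd_gam]
  simp only [PiLp.smul_apply, smul_eq_mul]
  field_simp
  ring

lemma kb_bdd {q : R3 → ℝ} (h : Kq q) (m : ℕ) : ∃ C, 0 ≤ C ∧ ∀ s y, 0 < s → s ≤ 2 → |kb m q s y| ≤ C := by
  obtain ⟨k, C0, hC⟩ := h.tg.2 0
  obtain ⟨C1, h1, hC1⟩ := gau_wt_bd (m + k)
  have hC0 : 0 ≤ C0 := by have := (norm_nonneg _).trans (hC 0); simpa using this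
  have g0 := gc_pos
  refine ⟨8 ^ m * 2 ^ k * C0 * (gc * C1), by positivity, fun s y hs hs2 => ?_⟩
  by_cases hy : ‖y‖ < 1/8
  · rw [kb, h.zr y hy]; simp only [mul_zero, abs_zero]; positivity
  push Not at hy
  set z := s⁻¹ • y with hz
  have nz : ‖z‖ = s⁻¹ * ‖y‖ := by rw [hz, norm_smul, Real.norm_eq_abs, abs_of_pos (inv_pos.2 hs)]
  have yz : ‖y‖ = s * ‖z‖ := by rw [nz]; field_simp
  have b1 : s⁻¹ ≤ 8 * (1 + ‖z‖) := by
    rw [nz]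
    have : 0 < s⁻¹ := inv_pos.2 hs
    nlinarith
  have b2 : 1 + ‖y‖ ≤ 2 * (1 + ‖z‖) := by
    rw [yz]; nlinarith [norm_nonneg z]
  have b3 : |q y| ≤ C0 * (2 * (1 + ‖z‖)) ^ k := by
    have := hC y
    rw [norm_iteratedFDeriv_zero, Real.norm_eq_abs] at this
    refine this.trans ?_
    gcongr
  have b4 : (1 + ‖z‖) ^ (m + k) * gau z ≤ C1 := by
    refine (hC1 z).trans ?_
    have : Real.exp (-(1/8) * ‖z‖ ^ 2) ≤ 1 := Real.exp_le_one_iff.2 (by nlinarith [sq_nonneg ‖z‖])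
    nlinarith
  have e : |kb m q s y| = (s⁻¹) ^ m * (gc * gau z * |q y|) := by
    rw [kb, abs_mul, abs_mul, abs_of_pos (by positivity), inv_pow, abs_of_pos (gam_pos _)]; rfl
  rw [e]
  have gz := gau_pos z
  calc (s⁻¹) ^ m * (gc * gau z * |q y|) ≤ (8 * (1 + ‖z‖)) ^ m * (gc * gau z * (C0 * (2 * (1 + ‖z‖)) ^ k)) := by gcongr
    _ = 8 ^ m * 2 ^ k * C0 * (gc * ((1 + ‖z‖) ^ (m + k) * gau z)) := by rw [mul_pow, mul_pow, pow_add]; ring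
    _ ≤ _ := by gcongr

/-- C2 bounds -/
structure C2b (C : ℝ) (e : R3 → ℝ) : Prop where
  d0 : ∀ y, |e y| ≤ C
  d1 : ∀ j y, |pd e j y| ≤ C
  d2 : ∀ i j y, |pd (pd e j) i y| ≤ C

lemma C2b.mono {C C' : ℝ} {e : R3 → ℝ} (h : C2b C e) (hC : C ≤ C') : C2b C' e :=
  ⟨fun y => (h.d0 y).trans hC, fun j y => (h.d1 j y).trans hC, fun i j y => (h.d2 i j y).trans hC⟩

lemma fin_bd {P : Fin 3 → ℝ → Prop} (hm : ∀ j C C', P j C → C ≤ C' → P j C') (h : ∀ j, ∃ C, 0 ≤ C ∧ P j C) :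
    ∃ C, 0 ≤ C ∧ ∀ j, P j C := by
  choose c h0 hc using h
  exact ⟨∑ j, c j, Finset.sum_nonneg fun j _ => h0 j, fun j => hm j _ _ (hc j)
    (Finset.single_le_sum (fun j _ => h0 j) (Finset.mem_univ j))⟩

lemma kb_bdd1 {q : R3 → ℝ} (h : Kq q) (m : ℕ) :
    ∃ C, 0 ≤ C ∧ ∀ j s y, 0 < s → s ≤ 2 → |pd (kb m q s) j y| ≤ C := by
  refine fin_bd (P := fun j C => ∀ s y, 0 < s → s ≤ 2 → |pd (kb m q s) j y| ≤ C)
    (fun j C C' h hC s y h1 h2 => (h s y h1 h2).trans hC) fun j => ?_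
  obtain ⟨C1, h1, hC1⟩ := kb_bdd (h.pd j) m
  obtain ⟨C2, h2, hC2⟩ := kb_bdd (h.coord j) (m+2)
  refine ⟨C1 + C2, by positivity, fun s y hs hs2 => ?_⟩
  rw [kb_pd h.sm m hs]
  refine (abs_add_le _ _).trans (add_le_add (hC1 s y hs hs2) ?_)
  rw [abs_mul]
  have := hC2 s y hs hs2
  have e : |(-(1/2):ℝ)| = 1/2 := by norm_num
  rw [e]; linarith

lemma kb_C2 {q : R3 → ℝ} (h : Kq q) (m : ℕ) : ∃ C, 0 ≤ C ∧ ∀ s, 0 < s → s ≤ 2 → C2b C (kb m q s) := by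
  obtain ⟨C0, h0, hC0⟩ := kb_bdd h m
  obtain ⟨C1, h1, hC1⟩ := kb_bdd1 h m
  have : ∃ C, 0 ≤ C ∧ ∀ j, ∀ i s y, 0 < s → s ≤ 2 → |pd (pd (kb m q s) j) i y| ≤ C := by
    refine fin_bd (P := fun j C => ∀ i s y, 0 < s → s ≤ 2 → |pd (pd (kb m q s) j) i y| ≤ C)
      (fun j C C' h hC i s y h1 h2 => (h i s y h1 h2).trans hC) fun j => ?_
    obtain ⟨C3, h3, hC3⟩ := kb_bdd1 (h.pd j) m
    obtain ⟨C2, h2, hC2⟩ := kb_bdd1 (h.coord j) (m+2)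
    refine ⟨C3 + C2, by positivity, fun i s y hs hs2 => ?_⟩
    have d2 := (kb_sm (h.coord j).sm (m+2) s)
    rw [kb_pd h.sm m hs, pd_add (kb_sm (h.pd j).sm m s).diff (d2.cmul _).diff, pd_cmul d2.diff]
    refine (abs_add_le _ _).trans (add_le_add (hC3 i s y hs hs2) ?_)
    rw [abs_mul]
    have := hC2 i s y hs hs2
    have e : |(-(1/2):ℝ)| = 1/2 := by norm_num
    rw [e]; linarith
  obtain ⟨C2, h2, hC2⟩ := this
  refine ⟨C0 + C1 + C2, by positivity, fun s hs hs2 => ⟨fun y => ?_, fun j y => ?_, fun i j y => ?_⟩⟩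
  · linarith [hC0 s y hs hs2]
  · linarith [hC1 j s y hs hs2]
  · linarith [hC2 j i s y hs hs2]

lemma Ts.C2 {e : R3 → ℝ} (h : Ts e) : ∃ C, 0 ≤ C ∧ C2b C e := by
  obtain ⟨C0, h0, hC0⟩ := h.bc.bdd
  obtain ⟨C1, h1, hC1⟩ := fin_bd (P := fun j C => ∀ y, |_root_.pd e j y| ≤ C)
    (fun j C C' h hC y => (h y).trans hC) fun j => (h.pd j).bc.bdd
  obtain ⟨C2, h2, hC2⟩ := fin_bd (P := fun j C => ∀ i y, |_root_.pd (_root_.pd e j) i y| ≤ C)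
    (fun j C C' h hC i y => (h i y).trans hC) fun j => fin_bd (P := fun i C => ∀ y, |_root_.pd (_root_.pd e j) i y| ≤ C)
      (fun j C C' h hC y => (h y).trans hC) fun i => ((h.pd j).pd i).bc.bdd
  refine ⟨C0 + C1 + C2, by positivity, ⟨fun y => ?_, fun j y => ?_, fun i j y => ?_⟩⟩
  · linarith [hC0 y]
  · linarith [hC1 j y]
  · linarith [hC2 j i y]

lemma Pg_subst (F : R3 → ℝ) {s : ℝ} (hs : 0 < s) : Pg s F 0 = ∫ y, (s ^ 3)⁻¹ * (gam (s⁻¹ • y) * F y) := by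
  have := Measure.integral_comp_smul volume (fun y => gam (s⁻¹ • y) * F y) s
  simp only [finrank_euclideanSpace, Fintype.card_fin, smul_eq_mul, smul_smul, inv_mul_cancel₀ hs.ne', one_smul] at this
  rw [abs_of_pos (by positivity)] at this
  rw [integral_const_mul, ← this]
  simp [Pg]

/-- bump data -/
def zb : ContDiffBump (0 : R3) := ⟨1/4, 1/2, by norm_num, by norm_num⟩

/-- the bump -/
def zt (y : R3) : ℝ := zb y

lemma zt_ts : Ts zt := ⟨zb.contDiff, zb.hasCompactSupport⟩
lemma zt_one {y : R3} (h : ‖y‖ ≤ 1/4) : zt y = 1 := zb.one_of_mem_closedBall (by rw [mem_closedBall_zero_iff]; exact h)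
lemma zt_supp : tsupport zt ⊆ closedBall 0 (1/2) := zb.tsupport_eq.subset
lemma zt_zero {y : R3} (h : 1/2 < ‖y‖) : zt y = 0 := by
  refine image_eq_zero_of_notMem_tsupport (f := zt) fun hm => ?_
  have := zt_supp hm
  simp at this; linarith

lemma zt_Kq : Kq (fun y => 1 - zt y) :=
  ⟨(Function.HasTemperateGrowth.const 1).sub (zt_ts.cs.hasTemperateGrowth zt_ts.sm), fun y hy => by
    rw [zt_one (by linarith)]; ring⟩

lemma zt_pd_Kq (j : Fin 3) : Kq (pd zt j) := by
  have h := (zt_Kq.pd j)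
  have e : pd zt j = fun y => - pd (fun y => 1 - zt y) j y := by
    funext y
    rw [pd_sub (Sm.const 1).diff zt_ts.sm.diff, pd_const]; ring
  refine ⟨?_, fun y hy => by rw [e]; simp [h.zr y hy]⟩
  exact tg_pd (zt_ts.cs.hasTemperateGrowth zt_ts.sm) j

end

open MeasureTheory Filter Metric
noncomputable section

/-- velocity/pressure system with viscosity, in divergence form -/
structure NSf (ν : ℝ) (U V : Fin 3 → R3 → ℝ) (P : R3 → ℝ) : Prop where
  u : ∀ i, Sm (U i)
  v : ∀ i, Sm (V i)
  p : Sm P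
  eq : ∀ i x, pd P i x = ν * lap (U i) x - ∑ j, pd (fun y => U i y * U j y + V i y * V j y) j x
  dv : ∀ x, ∑ j, pd (U j) j x = 0

/-- stress -/
def HH (U V : Fin 3 → R3 → ℝ) (i j : Fin 3) (x : R3) : ℝ := U i x * U j x + V i x * V j x
/-- its size -/
def kk (U V : Fin 3 → R3 → ℝ) (x : R3) : ℝ := ∑ i, (U i x ^ 2 + V i x ^ 2)

lemma intS {f w : R3 → ℝ} (hf : Sm f) (hw : Ts w) : Integrable (fun x => f x * w x) :=
  int_cs (hf.cont.mul hw.sm.cont) (cs_mul_right hw.cs)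

lemma lap_adj {f w : R3 → ℝ} (hf : Sm f) (hw : Ts w) : ∫ x, f x * lap w x = ∫ x, lap f x * w x := by
  unfold lap
  simp only [Finset.mul_sum, Finset.sum_mul]
  rw [integral_finsetSum _ (fun j _ => intS hf ((hw.pd j).pd j)), integral_finsetSum _ (fun j _ => intS ((hf.pd j).pd j) hw)]
  refine Finset.sum_congr rfl fun j _ => ?_
  rw [ibp hf (hw.pd j).sm (hw.pd j).cs, ibp (hf.pd j) hw.sm hw.cs, neg_neg]

section
variable {ν : ℝ} {U V : Fin 3 → R3 → ℝ} {P : R3 → ℝ}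

lemma NSf.H (h : NSf ν U V P) (i j : Fin 3) : Sm (HH U V i j) := ((h.u i).mul (h.u j)).add ((h.v i).mul (h.v j))

lemma NSf.k (h : NSf ν U V P) : Sm (kk U V) := Sm.sum fun i _ => ((h.u i).pow 2).add ((h.v i).pow 2)

lemma kk_nonneg (x : R3) : 0 ≤ kk U V x := Finset.sum_nonneg fun i _ => by positivity

lemma HH_le (i j : Fin 3) (x : R3) : |HH U V i j x| ≤ kk U V x := by
  have a : ∀ i, 0 ≤ U i x ^ 2 + V i x ^ 2 := fun i => by positivity
  have e1 := Finset.single_le_sum (fun i _ => a i) (Finset.mem_univ i)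
  have e2 := Finset.single_le_sum (fun i _ => a i) (Finset.mem_univ j)
  unfold HH kk
  rw [abs_le]
  constructor <;> nlinarith [sq_nonneg (U i x + U j x), sq_nonneg (U i x - U j x), sq_nonneg (V i x + V j x), sq_nonneg (V i x - V j x)]

lemma NSf.wm (h : NSf ν U V P) {w : R3 → ℝ} (hw : Ts w) (i : Fin 3) :
    ∫ x, pd P i x * w x = ν * (∫ x, U i x * lap w x) + ∑ j, ∫ x, HH U V i j x * pd w j x := by
  have e : ∀ x, pd P i x * w x = ν * (lap (U i) x * w x) + ∑ j, (-1) * (pd (HH U V i j) j x * w x) := fun x => by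
    rw [h.eq, sub_mul, Finset.sum_mul, sub_eq_add_neg, ← Finset.sum_neg_distrib, mul_assoc]
    congr 1
    exact Finset.sum_congr rfl fun j _ => by rw [neg_one_mul]; rfl
  have i2 : ∀ j, Integrable (fun x => (-1) * (pd (HH U V i j) j x * w x)) := fun j => (intS ((h.H i j).pd j) hw).const_mul _
  simp only [e]
  rw [intg_add2 ((intS (h.u i).lap hw).const_mul ν) (integrable_finsetSum _ fun j _ => i2 j), integral_const_mul, ← lap_adj (h.u i) hw,
    integral_finsetSum _ (fun j _ => i2 j)]
  congr 1
  refine Finset.sum_congr rfl fun j _ => ?_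
  rw [integral_const_mul, ibp (h.H i j) hw.sm hw.cs]; ring

lemma lap_pd {f : R3 → ℝ} (hf : Sm f) (i : Fin 3) (x : R3) : lap (pd f i) x = pd (lap f) i x := by
  have e : lap f = fun y => ∑ j, pd (pd f j) j y := rfl
  rw [e, pd_sum (fun j _ => ((hf.pd j).pd j).diff), lap]
  refine Finset.sum_congr rfl fun j _ => ?_
  have : pd (pd f i) j = pd (pd f j) i := funext fun y => pd_comm hf i j y
  rw [this, pd_comm (hf.pd j)]

lemma NSf.poisson (h : NSf ν U V P) {w : R3 → ℝ} (hw : Ts w) :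
    ∫ x, P x * lap w x = - ∑ i, ∑ j, ∫ x, HH U V i j x * pd (pd w i) j x := by
  have e1 : ∫ x, P x * lap w x = - ∑ i, ∫ x, pd P i x * pd w i x := by
    unfold lap
    simp only [Finset.mul_sum]
    rw [integral_finsetSum _ (fun j _ => intS h.p ((hw.pd j).pd j)), ← Finset.sum_neg_distrib]
    exact Finset.sum_congr rfl fun j _ => ibp h.p (hw.pd j).sm (hw.pd j).cs j
  have e2 : ∑ i, ∫ x, U i x * lap (pd w i) x = 0 := by
    have : ∀ i, ∫ x, U i x * lap (pd w i) x = - ∫ x, pd (U i) i x * lap w x := fun i => by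
      rw [← ibp (h.u i) hw.lap.sm hw.lap.cs]
      simp only [lap_pd hw.sm]
    simp only [this, Finset.sum_neg_distrib]
    rw [← integral_finsetSum _ (fun j _ => intS ((h.u j).pd j) hw.lap)]
    simp only [← Finset.sum_mul, h.dv, zero_mul, integral_zero, neg_zero]
  rw [e1]
  simp only [h.wm (hw.pd _), Finset.sum_add_distrib, ← Finset.mul_sum, e2, mul_zero, zero_add]

/-- geometric data -/
structure Geo (χ g : R3 → ℝ) (r1 r2 : ℝ) : Prop where
  c : Ts χ
  c0 : ∀ x, 0 ≤ χ x
  c1 : ∀ x, χ x ≤ 1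
  gt : Ts g
  z : ∫ x, g x = 0
  r0 : 0 < r1
  r12 : r1 ≤ r2
  gs : ∀ x, g x ≠ 0 → r1 ≤ ‖x‖ ∧ ‖x‖ ≤ r2
  cs : ∀ x y, r1 ≤ ‖x‖ → ‖x‖ ≤ r2 → ‖y‖ ≤ 1/2 → χ (x + y) = 1

variable {χ g : R3 → ℝ} {r1 r2 : ℝ}

lemma Geo.gts (G : Geo χ g r1 r2) : ∀ x ∈ tsupport g, r1 ≤ ‖x‖ ∧ ‖x‖ ≤ r2 := by
  have hc : IsClosed {x : R3 | r1 ≤ ‖x‖ ∧ ‖x‖ ≤ r2} :=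
    (isClosed_le continuous_const continuous_norm).inter (isClosed_le continuous_norm continuous_const)
  exact fun x hx => closure_minimal (fun x hx => G.gs x hx) hc hx

/-- localised stress -/
def hij (χ : R3 → ℝ) (U V : Fin 3 → R3 → ℝ) (i j : Fin 3) (x : R3) : ℝ := χ x * HH U V i j x

lemma hij_ts (G : Geo χ g r1 r2) (h : NSf ν U V P) (i j : Fin 3) : Ts (hij χ U V i j) :=
  ⟨G.c.sm.mul (h.H i j), cs_mul_left G.c.cs⟩

lemma lap_cr {f g : R3 → ℝ} (hf : Sm f) (hg : Ts g) (y : R3) : lap (cr f g) y = ∫ z, f z * lap (fun z => g (z + -y)) z := by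
  have e : ∀ j, pd (pd (cr f g) j) j y = cr f (pd (pd g j) j) y := fun j => by
    have : pd (cr f g) j = fun y => (-1) * cr f (pd g j) y := funext fun y => by rw [cr_pd' hf hg]; ring
    rw [this, pd_cmul (cr_sm hf (hg.pd j)).diff, cr_pd' hf (hg.pd j)]; ring
  have e2 : ∀ j, pd (fun z => g (z + -y)) j = fun z => pd g j (z + -y) := fun j => funext fun z => pd_comp_add g (-y) j z
  unfold lap
  simp only [e, e2, pd_comp_add, cr_alt, Finset.mul_sum, sub_eq_add_neg]
  rw [integral_finsetSum]
  intro j _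
  refine int_cs (hf.cont.mul (((hg.pd j).pd j).sm.comp_add _).cont) (cs_mul_right ?_)
  exact ((hg.pd j).pd j).cs.comp_homeomorph (Homeomorph.addRight (-y))

lemma Ts.shift {g : R3 → ℝ} (hg : Ts g) (a : R3) : Ts (fun z => g (z + a)) :=
  ⟨hg.sm.comp_add a, hg.cs.comp_homeomorph (Homeomorph.addRight a)⟩

lemma lapM (G : Geo χ g r1 r2) (h : NSf ν U V P) {y : R3} (hy : ‖y‖ ≤ 1/2) :
    lap (cr P g) y = - ∑ i, ∑ j, pd (pd (cr (hij χ U V i j) g) i) j y := by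
  rw [lap_cr h.p G.gt, h.poisson (G.gt.shift (-y))]
  congr 1
  refine Finset.sum_congr rfl fun i _ => Finset.sum_congr rfl fun j _ => ?_
  have hs := (hij_ts G h i j)
  have e1 : pd (cr (hij χ U V i j) g) i = fun y => (-1) * cr (hij χ U V i j) (pd g i) y := funext fun y => by
    rw [cr_pd' hs.sm G.gt]; ring
  have e2 : pd (fun z => g (z + -y)) i = fun z => pd g i (z + -y) := funext fun z => pd_comp_add g (-y) i z
  rw [e1, pd_cmul (cr_sm hs.sm (G.gt.pd i)).diff, cr_pd' hs.sm (G.gt.pd i), e2, neg_mul_neg, one_mul, cr_alt]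
  congr 1; funext z
  rw [pd_comp_add, ← sub_eq_add_neg]
  by_cases hz : z - y ∈ tsupport g
  · have := G.gts _ hz
    have c := G.cs (z - y) y this.1 this.2 hy
    rw [sub_add_cancel] at c
    rw [hij, c, one_mul]
  · rw [pd_zero_off (fun hm => hz (tsup_pd g i hm)), mul_zero, mul_zero]

/-- the size of lower order data -/
def Dd (ν : ℝ) (U V : Fin 3 → R3 → ℝ) (χ : R3 → ℝ) : ℝ := ν * ∑ i, (∫ x, χ x * |U i x|) + ∫ x, χ x * kk U V x

lemma int_le_chi (G : Geo χ g r1 r2) {a w : R3 → ℝ} {C : ℝ} (ha : Continuous a) (hw : Ts w) (hC : ∀ x, |w x| ≤ C)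
    (hs : ∀ x, w x ≠ 0 → χ x = 1) : |∫ x, a x * w x| ≤ C * ∫ x, χ x * |a x| := by
  have hC0 : 0 ≤ C := (abs_nonneg _).trans (hC 0)
  rw [← integral_const_mul]
  refine abs_integral_le_integral_abs.trans (integral_mono (int_cs (ha.mul hw.sm.cont) (cs_mul_right hw.cs)).abs
    ((int_cs (G.c.sm.cont.mul ha.abs) (cs_mul_left G.c.cs)).const_mul C) fun x => ?_)
  simp only [abs_mul]
  by_cases hx : w x = 0
  · rw [hx, abs_zero, mul_zero]
    have := G.c0 x
    positivity
  · rw [hs x hx, one_mul, mul_comm]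
    exact mul_le_mul_of_nonneg_right (hC x) (abs_nonneg _)

lemma Dd_nonneg (G : Geo χ g r1 r2) (hν : 0 ≤ ν) : 0 ≤ Dd ν U V χ := by
  refine add_nonneg (mul_nonneg hν (Finset.sum_nonneg fun i _ => integral_nonneg fun x => ?_)) (integral_nonneg fun x => ?_)
  · exact mul_nonneg (G.c0 x) (abs_nonneg _)
  · exact mul_nonneg (G.c0 x) (kk_nonneg x)

lemma Q_grad (G : Geo χ g r1 r2) (h : NSf ν U V P) (hν : 0 ≤ ν) {e : R3 → ℝ} (he : Ts e) (hs : tsupport e ⊆ closedBall 0 (1/2)) {C : ℝ}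
    (hC : C2b C e) {x : R3} (h1 : r1 ≤ ‖x‖) (h2 : ‖x‖ ≤ r2) (i : Fin 3) : |pd (cr P e) i x| ≤ 3 * C * Dd ν U V χ := by
  have hC0 : 0 ≤ C := (abs_nonneg _).trans (hC.d0 0)
  have hw := he.shift (-x)
  have sup : ∀ z, z + -x ∈ tsupport e → χ z = 1 := fun z hz => by
    have := hs hz
    rw [mem_closedBall_zero_iff] at this
    have c := G.cs x (z + -x) h1 h2 this
    rwa [add_comm x, neg_add_cancel_right] at c
  have e2 : ∀ j, pd (fun z => e (z + -x)) j = fun z => pd e j (z + -x) := fun j => funext fun z => pd_comp_add e (-x) j z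
  have t1 : |∫ z, U i z * lap (fun z => e (z + -x)) z| ≤ (3 * C) * ∫ z, χ z * |U i z| := by
    refine int_le_chi G (h.u i).cont hw.lap (fun z => ?_) (fun z hz => ?_)
    · unfold lap
      simp only [e2, pd_comp_add]
      refine (Finset.abs_sum_le_sum_abs _ _).trans ((Finset.sum_le_sum fun j _ => hC.d2 j j _).trans ?_)
      simp
    · by_contra hne
      apply hz
      unfold lap
      simp only [e2, pd_comp_add]
      refine Finset.sum_eq_zero fun j _ => pd_zero_off (fun hm => hne (sup z (tsup_pd e j hm))) j
  have t2 : ∀ j, |∫ z, HH U V i j z * pd (fun z => e (z + -x)) j z| ≤ C * ∫ z, χ z * kk U V z := fun j => by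
    refine (int_le_chi G (h.H i j).cont (hw.pd j) (fun z => ?_) (fun z hz => ?_)).trans
      (mul_le_mul_of_nonneg_left (integral_mono ?_ ?_ fun z => mul_le_mul_of_nonneg_left (HH_le i j z) (G.c0 z)) hC0)
    · rw [e2]; exact hC.d1 j _
    · by_contra hne
      apply hz
      rw [e2]
      exact pd_zero_off (fun hm => hne (sup z hm)) j
    · exact int_cs (G.c.sm.cont.mul (h.H i j).cont.abs) (cs_mul_left G.c.cs)
    · exact int_cs (G.c.sm.cont.mul h.k.cont) (cs_mul_left G.c.cs)
  have eq : pd (cr P e) i x = ∫ z, pd P i z * e (z + -x) := by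
    rw [cr_pd h.p he, cr_alt]; simp only [sub_eq_add_neg]
  rw [eq, h.wm hw]
  have t3 : ∫ z, χ z * |U i z| ≤ ∑ i, ∫ z, χ z * |U i z| :=
    Finset.single_le_sum (f := fun i => ∫ z, χ z * |U i z|) (fun i _ => integral_nonneg fun x => mul_nonneg (G.c0 x) (abs_nonneg _)) (Finset.mem_univ i)
  calc _ ≤ ν * ((3 * C) * ∫ z, χ z * |U i z|) + ∑ j : Fin 3, C * ∫ z, χ z * kk U V z := by
        refine (abs_add_le _ _).trans (add_le_add ?_ ((Finset.abs_sum_le_sum_abs _ _).trans (Finset.sum_le_sum fun j _ => t2 j)))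
        rw [abs_mul, abs_of_nonneg hν]
        exact mul_le_mul_of_nonneg_left t1 hν
    _ ≤ ν * ((3 * C) * ∑ i, ∫ z, χ z * |U i z|) + ∑ j : Fin 3, C * ∫ z, χ z * kk U V z := by gcongr
    _ = _ := by simp only [Finset.sum_const, Finset.card_univ, Fintype.card_fin, nsmul_eq_mul, Dd]; push_cast; ring

end

end

open MeasureTheory Filter Metric
noncomputable section

lemma path_osc {Q : R3 → ℝ} (hQ : Sm Q) {B L : ℝ} {S : Set R3} (hB : ∀ z ∈ S, ∀ i, |pd Q i z| ≤ B)
    {γ γ' : ℝ → R3} (hγ : ∀ t, HasDerivAt γ (γ' t) t) (hL : ∀ t, ‖γ' t‖ ≤ L) (hS : ∀ t ∈ Set.Icc (0:ℝ) 1, γ t ∈ S) :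
    |Q (γ 1) - Q (γ 0)| ≤ 3 * B * L := by
  have hd : ∀ t ∈ Set.Icc (0:ℝ) 1, HasDerivWithinAt (fun t => Q (γ t)) (fderiv ℝ Q (γ t) (γ' t)) (Set.Icc 0 1) t := fun t _ =>
    ((hQ.diff (γ t)).hasFDerivAt.comp_hasDerivAt t (hγ t)).hasDerivWithinAt
  refine norm_image_sub_le_of_norm_deriv_le_segment_01' (f := fun t => Q (γ t)) hd fun t ht => ?_
  rw [fderiv_coord, Real.norm_eq_abs]
  have ht' := hS t (Set.Ico_subset_Icc_self ht)
  have hB0 : 0 ≤ B := (abs_nonneg _).trans (hB _ ht' 0)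
  refine (Finset.abs_sum_le_sum_abs _ _).trans ((Finset.sum_le_sum (g := fun _ => L * B) fun j _ => ?_).trans (le_of_eq ?_))
  · rw [abs_mul]
    exact mul_le_mul ((coord_le _ j).trans (hL t)) (hB _ ht' j) (abs_nonneg _) ((norm_nonneg _).trans (hL t))
  · simp; ring

lemma orth3 (x y : R3) : ∃ w : R3, ‖w‖ = 1 ∧ inner ℝ x w = 0 ∧ inner ℝ y w = 0 := by
  let T : R3 →ₗ[ℝ] (ℝ × ℝ) := (innerₛₗ ℝ x).prod (innerₛₗ ℝ y)
  have hk : LinearMap.ker T ≠ ⊥ := LinearMap.ker_ne_bot_of_finrank_lt (by simp)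
  obtain ⟨w, hw, h0⟩ := Submodule.exists_mem_ne_zero_of_ne_bot hk
  have hw' : inner ℝ x w = 0 ∧ inner ℝ y w = 0 := by
    have : T w = 0 := hw
    exact ⟨congrArg Prod.fst this, congrArg Prod.snd this⟩
  refine ⟨‖w‖⁻¹ • w, ?_, ?_, ?_⟩
  · rw [norm_smul, norm_inv, norm_norm, inv_mul_cancel₀ (norm_ne_zero_iff.2 h0)]
  · rw [inner_smul_right, hw'.1, mul_zero]
  · rw [inner_smul_right, hw'.2, mul_zero]

lemma arc_osc {Q : R3 → ℝ} (hQ : Sm Q) {B r : ℝ} {S : Set R3} (hB : ∀ z ∈ S, ∀ i, |pd Q i z| ≤ B) (hr : 0 ≤ r)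
    (hS : ∀ z, ‖z‖ = r → z ∈ S) {x w : R3} (hx : ‖x‖ = r) (hw : ‖w‖ = r) (ho : inner ℝ x w = 0) :
    |Q w - Q x| ≤ 6 * B * r := by
  have hn : ∀ a b : ℝ, ‖a • x + b • w‖ ^ 2 = (a^2 + b^2) * r^2 := fun a b => by
    rw [norm_add_sq_real, inner_smul_left, inner_smul_right, ho, norm_smul, norm_smul, hx, hw, mul_pow, mul_pow]
    simp; ring
  have hB0 : 0 ≤ B := (abs_nonneg _).trans (hB _ (hS x hx) 0)
  have h := path_osc hQ hB (γ := fun t => Real.cos (Real.pi/2 * t) • x + Real.sin (Real.pi/2 * t) • w)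
    (γ' := fun t => (-Real.sin (Real.pi/2 * t) * (Real.pi/2)) • x + (Real.cos (Real.pi/2*t) * (Real.pi/2)) • w) (L := 2 * r) ?_ ?_ ?_
  · simp at h; linarith
  · intro t
    have h1 : HasDerivAt (fun t => Real.pi/2 * t) (Real.pi/2) t := by simpa using (hasDerivAt_id t).const_mul (Real.pi/2)
    exact (h1.cos.smul_const x).add (h1.sin.smul_const w)
  · intro t
    refine abs_le_of_sq_le_sq' ?_ (by positivity) |>.2
    rw [hn]
    have := Real.sin_sq_add_cos_sq (Real.pi/2 * t)
    have e : ((-Real.sin (Real.pi/2 * t) * (Real.pi/2))^2 + (Real.cos (Real.pi/2*t) * (Real.pi/2))^2) = (Real.pi/2)^2 := by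
      linear_combination (Real.pi/2)^2 * this
    rw [e, ← mul_pow]
    have p4 := Real.pi_le_four
    have := Real.pi_pos
    gcongr; linarith
  · intro t _
    refine hS _ ?_
    refine (pow_left_inj₀ (norm_nonneg _) hr two_ne_zero).1 ?_
    rw [hn, Real.cos_sq_add_sin_sq, one_mul]

lemma shell_osc {Q : R3 → ℝ} (hQ : Sm Q) {B r1 r2 : ℝ} (h0 : 0 < r1) 
    (hB : ∀ z : R3, r1 ≤ ‖z‖ → ‖z‖ ≤ r2 → ∀ i, |pd Q i z| ≤ B) {x y : R3} (hx1 : r1 ≤ ‖x‖) (hx2 : ‖x‖ ≤ r2)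
    (hy1 : r1 ≤ ‖y‖) (hy2 : ‖y‖ ≤ r2) : |Q x - Q y| ≤ 18 * B * r2 := by
  set S : Set R3 := {z | r1 ≤ ‖z‖ ∧ ‖z‖ ≤ r2}
  have hB' : ∀ z ∈ S, ∀ i, |pd Q i z| ≤ B := fun z hz => hB z hz.1 hz.2
  have h2 : 0 < r2 := by linarith
  have hB0 : 0 ≤ B := (abs_nonneg _).trans (hB x hx1 hx2 0)
  have nrm : ∀ z : R3, r1 ≤ ‖z‖ → ‖(r2 / ‖z‖) • z‖ = r2 := fun z hz => by
    have : 0 < ‖z‖ := by linarith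
    rw [norm_smul, Real.norm_of_nonneg (by positivity)]; field_simp
  have rad : ∀ z : R3, r1 ≤ ‖z‖ → ‖z‖ ≤ r2 → |Q ((r2 / ‖z‖) • z) - Q z| ≤ 3 * B * r2 := fun z hz1 hz2 => by
    have hz : 0 < ‖z‖ := by linarith
    have hc : 1 ≤ r2 / ‖z‖ := by rw [le_div_iff₀ hz]; linarith
    have h := path_osc hQ hB' (γ := fun t => (1 + t * (r2/‖z‖ - 1)) • z) (γ' := fun t => (r2/‖z‖ - 1) • z) (L := r2) ?_ ?_ ?_
    · simpa using h
    · intro t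
      have h1 : HasDerivAt (fun t => 1 + t * (r2/‖z‖ - 1)) (r2/‖z‖ - 1) t := by
        simpa using ((hasDerivAt_id t).mul_const (r2/‖z‖ - 1)).const_add 1
      exact h1.smul_const z
    · intro t
      rw [norm_smul, Real.norm_of_nonneg (by linarith), sub_mul, div_mul_cancel₀ _ hz.ne']; linarith
    · intro t ht
      have e : ‖(1 + t * (r2/‖z‖ - 1)) • z‖ = ‖z‖ + t * (r2 - ‖z‖) := by
        rw [norm_smul, Real.norm_of_nonneg (by nlinarith [ht.1])]; field_simp
      constructor
      · rw [e]; nlinarith [ht.1]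
      · rw [e]; nlinarith [ht.2]
  obtain ⟨w, w1, wx, wy⟩ := orth3 x y
  have hS : ∀ z : R3, ‖z‖ = r2 → z ∈ S := fun z hz => ⟨by rw [hz]; linarith, hz.le⟩
  have hw : ‖r2 • w‖ = r2 := by rw [norm_smul, w1, mul_one, Real.norm_of_nonneg h2.le]
  have a1 := arc_osc hQ hB' h2.le hS (nrm x hx1) hw (by rw [inner_smul_left, inner_smul_right, wx]; simp)
  have a2 := arc_osc hQ hB' h2.le hS (nrm y hy1) hw (by rw [inner_smul_left, inner_smul_right, wy]; simp)
  have b1 := rad x hx1 hx2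
  have b2 := rad y hy1 hy2
  rw [abs_le] at *
  constructor <;> linarith [a1.1, a1.2, a2.1, a2.2, b1.1, b1.2, b2.1, b2.2]

lemma cr_fub {P e g : R3 → ℝ} (hP : Sm P) (he : Ts e) (hg : Ts g) : ∫ y, e y * cr P g y = ∫ x, g x * cr P e x := by
  have hc : Continuous (fun p : R3 × R3 => e p.1 * (P (p.2 + p.1) * g p.2)) := by
    have := he.sm.cont; have := hP.cont; have := hg.sm.cont
    fun_prop
  have hs : HasCompactSupport (fun p : R3 × R3 => e p.1 * (P (p.2 + p.1) * g p.2)) := by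
    refine HasCompactSupport.intro (he.cs.isCompact.prod hg.cs.isCompact) fun p hp => ?_
    by_cases h1 : p.1 ∈ tsupport e
    · have : p.2 ∉ tsupport g := fun h2 => hp ⟨h1, h2⟩
      rw [image_eq_zero_of_notMem_tsupport this]; ring
    · rw [image_eq_zero_of_notMem_tsupport h1]; ring
  have h := integral_integral_swap (f := fun y x => e y * (P (x + y) * g x)) (hc.integrable_of_hasCompactSupport hs (μ := volume.prod volume))
  unfold cr
  simp only [← integral_const_mul]
  rw [h]
  congr 1; funext x; congr 1; funext y
  rw [add_comm]; ring

section
variable {ν : ℝ} {U V : Fin 3 → R3 → ℝ} {P : R3 → ℝ} {χ g : R3 → ℝ} {r1 r2 : ℝ}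

lemma intSl {f w : R3 → ℝ} (hf : Sm f) (hw : Ts w) : Integrable (fun x => w x * f x) :=
  int_cs (hw.sm.cont.mul hf.cont) (cs_mul_left hw.cs)

lemma Q_est (G : Geo χ g r1 r2) (h : NSf ν U V P) (hν : 0 ≤ ν) {e : R3 → ℝ} (he : Ts e) (hs : tsupport e ⊆ closedBall 0 (1/2)) {C : ℝ}
    (hC : C2b C e) : |∫ y, e y * cr P g y| ≤ 54 * C * r2 * Dd ν U V χ * ∫ x, |g x| := by
  have hQ := cr_sm h.p he
  rw [cr_fub h.p he G.gt]
  set x0 : R3 := r2 • bv 0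
  have r2p : 0 < r2 := G.r0.trans_le G.r12
  have nx0 : ‖x0‖ = r2 := by rw [norm_smul, norm_bv, mul_one, Real.norm_of_nonneg r2p.le]
  have e1 : ∫ x, g x * cr P e x = ∫ x, g x * (cr P e x - cr P e x0) := by
    have : ∫ x, g x * (cr P e x - cr P e x0) = ∫ x, (g x * cr P e x + (-cr P e x0) * g x) := by
      congr 1; funext x; ring
    rw [this, intg_add2 (intSl hQ G.gt) (G.gt.int.const_mul _), integral_const_mul, G.z]; ring
  rw [e1, ← integral_const_mul]
  refine abs_integral_le_integral_abs.trans (integral_mono (int_cs (G.gt.sm.cont.mul (hQ.sub (Sm.const _)).cont) (cs_mul_left G.gt.cs)).abs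
    (G.gt.int.abs.const_mul _) fun x => ?_)
  simp only [abs_mul]
  by_cases hx : g x = 0
  · simp [hx]
  · obtain ⟨a, b⟩ := G.gs x hx
    have := shell_osc hQ G.r0 (fun z h1 h2 i => Q_grad G h hν he hs hC h1 h2 i) a b (y := x0) (by rw [nx0]; exact G.r12) nx0.le
    rw [mul_comm]
    refine mul_le_mul_of_nonneg_right (this.trans (le_of_eq (by ring))) (abs_nonneg _)

end
end

open MeasureTheory Filter Metric
noncomputable section

lemma lap_mul {f w : R3 → ℝ} (hf : Sm f) (hw : Sm w) (x : R3) :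
    lap (fun y => f y * w y) x = f x * lap w x + ∑ j, (2 * pd (fun y => pd f j y * w y) j x - pd (pd f j) j x * w x) := by
  unfold lap
  rw [Finset.mul_sum, ← Finset.sum_add_distrib]
  refine Finset.sum_congr rfl fun j _ => ?_
  have e : pd (fun y => f y * w y) j = fun y => f y * pd w j y + pd f j y * w y := funext fun y => pd_mul hf.diff hw.diff j y
  rw [e, pd_add (hf.mul (hw.pd j)).diff ((hf.pd j).mul hw).diff, pd_mul hf.diff (hw.pd j).diff, pd_mul (hf.pd j).diff hw.diff]
  ring

lemma Ts.mulr {f w : R3 → ℝ} (hf : Ts f) (hw : Sm w) : Ts (fun y => f y * w y) := ⟨hf.sm.mul hw, cs_mul_left hf.cs⟩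
lemma Ts.mull {f w : R3 → ℝ} (hf : Sm f) (hw : Ts w) : Ts (fun y => f y * w y) := ⟨hf.mul hw.sm, cs_mul_right hw.cs⟩

lemma Pg_kb (F : R3 → ℝ) {s : ℝ} (hs : 0 < s) : Pg s F 0 = ∫ y, kb 3 (fun _ => 1) s y * F y := by
  rw [Pg_subst F hs]; congr 1; funext y; unfold kb; ring

lemma kb_tsup (m : ℕ) {q : R3 → ℝ} (hq : tsupport q ⊆ closedBall 0 (1/2)) (s : ℝ) : tsupport (kb m q s) ⊆ closedBall 0 (1/2) := by
  refine subset_trans (closure_mono fun y hy => ?_) hq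
  intro h0
  apply hy
  simp only [kb, h0, mul_zero]

section
variable {ν : ℝ} {U V : Fin 3 → R3 → ℝ} {P : R3 → ℝ} {χ g : R3 → ℝ} {r1 r2 : ℝ}

lemma hij_l1 (G : Geo χ g r1 r2) (h : NSf ν U V P) (hν : 0 ≤ ν) (i j : Fin 3) : ∫ x, |hij χ U V i j x| ≤ Dd ν U V χ := by
  refine (integral_mono (hij_ts G h i j).int.abs (int_cs (G.c.sm.cont.mul h.k.cont) (cs_mul_left G.c.cs)) fun x => ?_).trans
    (le_add_of_nonneg_left (mul_nonneg hν (Finset.sum_nonneg fun i _ => integral_nonneg fun x => mul_nonneg (G.c0 x) (abs_nonneg _))))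
  simp only [hij, abs_mul, abs_of_nonneg (G.c0 x)]
  exact mul_le_mul_of_nonneg_left (HH_le i j x) (G.c0 x)

lemma far_est {m k : R3 → ℝ} {C : ℝ} (hm : Ts m) (hk : Sm k) (hC : C2b C k) (i j : Fin 3) :
    |∫ y, k y * pd (pd m i) j y| ≤ C * ∫ y, |m y| := by
  rw [ibp hk (hm.pd i).sm (hm.pd i).cs, ibp (hk.pd j) hm.sm hm.cs, neg_neg, ← integral_const_mul]
  refine abs_integral_le_integral_abs.trans (integral_mono (intS ((hk.pd j).pd i) hm).abs (hm.int.abs.const_mul _) fun y => ?_)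
  simp only [abs_mul]
  exact mul_le_mul_of_nonneg_right (hC.d2 i j y) (abs_nonneg _)

lemma lapL (G : Geo χ g r1 r2) (h : NSf ν U V P) (y : R3) :
    lap (fun y => zt y * cr P g y) y = (-1) * (∑ i, ∑ j, pd (pd (cr (hij χ U V i j) g) i) j y) 
      + ((∑ i, ∑ j, (1 - zt y) * pd (pd (cr (hij χ U V i j) g) i) j y) + 
      ∑ j, (2 * pd (fun y => pd zt j y * cr P g y) j y - pd (pd zt j) j y * cr P g y)) := by
  rw [lap_mul zt_ts.sm (cr_sm h.p G.gt)]
  simp only [← Finset.mul_sum]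
  by_cases hy : ‖y‖ ≤ 1/2
  · rw [lapM G h hy]; ring
  · push Not at hy
    rw [zt_zero hy]; ring

lemma step_s : ∃ C : ℝ, 0 ≤ C ∧ ∀ {ν : ℝ} {U V : Fin 3 → R3 → ℝ} {P : R3 → ℝ} {χ g : R3 → ℝ} {r1 r2 : ℝ}, Geo χ g r1 r2 → NSf ν U V P → 
    0 ≤ ν → ∀ s, 0 < s → s ≤ 2 → |Pg s (lap (fun y => zt y * cr P g y)) 0| ≤ 
      ∑ i, ∑ j, |Pg s (pd (pd (cr (hij χ U V i j) g) i) j) 0| + C * (1 + r2) * Dd ν U V χ * ∫ x, |g x| := by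
  obtain ⟨C1, p1, h1⟩ := kb_C2 zt_Kq 3
  obtain ⟨C2, p2, h2⟩ := fin_bd (P := fun j C => ∀ s, 0 < s → s ≤ 2 → C2b C (kb 3 (pd (pd zt j) j) s)) 
    (fun j C C' hh hC s a b => (hh s a b).mono hC) (fun j => kb_C2 ((zt_pd_Kq j).pd j) 3)
  obtain ⟨C3, p3, h3⟩ := fin_bd (P := fun j C => ∀ s, 0 < s → s ≤ 2 → C2b C (kb 5 (fun y => y j * pd zt j y) s)) 
    (fun j C C' hh hC s a b => (hh s a b).mono hC) (fun j => kb_C2 ((zt_pd_Kq j).coord j) 5)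
  refine ⟨9 * C1 + 162 * (C2 + C3), by positivity, fun {ν U V P χ g r1 r2} G h hν s s0 s2 => ?_⟩
  set M := cr P g with hM
  have M_sm : Sm M := cr_sm h.p G.gt
  have mt : ∀ i j, Ts (cr (hij χ U V i j) g) := fun i j => cr_ts (hij_ts G h i j) G.gt
  have K_sm : Sm (kb 3 (fun _ => 1) s) := kb_sm (Sm.const 1) 3 s
  set K := kb 3 (fun _ => 1) s with hK
  set L : ℝ := Dd ν U V χ * ∫ x, |g x| with hL
  have L0 : 0 ≤ L := mul_nonneg (Dd_nonneg G hν) (integral_nonneg fun x => abs_nonneg _)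
  have r2p : 0 < r2 := G.r0.trans_le G.r12
  -- integrability
  have iA : ∀ i j, Integrable (fun y => K y * pd (pd (cr (hij χ U V i j) g) i) j y) := fun i j => intS K_sm (((mt i j).pd i).pd j)
  have iB : ∀ i j, Integrable (fun y => kb 3 (fun y => 1 - zt y) s y * pd (pd (cr (hij χ U V i j) g) i) j y) := fun i j => 
    intS (kb_sm ((Sm.const 1).sub zt_ts.sm) 3 s) (((mt i j).pd i).pd j)
  have wt : ∀ j, Ts (fun y => pd zt j y * M y) := fun j => (zt_ts.pd j).mulr M_sm
  have iC : ∀ j, Integrable (fun y => K y * pd (fun y => pd zt j y * M y) j y) := fun j => intS K_sm ((wt j).pd j)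
  have iD : ∀ j, Integrable (fun y => kb 3 (pd (pd zt j) j) s y * M y) := fun j => intSl M_sm (kb_ts ((zt_ts.pd j).pd j) 3 s)
  have eC : ∀ j, ∫ y, K y * pd (fun y => pd zt j y * M y) j y = (1/2) * ∫ y, kb 5 (fun y => y j * pd zt j y) s y * M y := fun j => by
    rw [ibp K_sm (wt j).sm (wt j).cs, hK, kb_pd (Sm.const 1) 3 s0, ← integral_neg, ← integral_const_mul]
    congr 1; funext y
    have : pd (fun _ : R3 => (1:ℝ)) j = fun _ => 0 := funext fun y => pd_const 1 j y
    simp only [kb, this]; ring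
  have bB : ∀ i j, |∫ y, kb 3 (fun y => 1 - zt y) s y * pd (pd (cr (hij χ U V i j) g) i) j y| ≤ C1 * L := fun i j => by
    refine (far_est (mt i j) (kb_sm ((Sm.const 1).sub zt_ts.sm) 3 s) (h1 s s0 s2) i j).trans (mul_le_mul_of_nonneg_left ?_ p1)
    exact (cr_intg_le (hij_ts G h i j) G.gt).trans (mul_le_mul_of_nonneg_right (hij_l1 G h hν i j) (integral_nonneg fun x => abs_nonneg _))
  have bC : ∀ j, |∫ y, K y * pd (fun y => pd zt j y * M y) j y| ≤ (1/2) * (54 * C3 * r2 * L) := fun j => by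
    rw [eC, abs_mul, abs_of_pos (by norm_num : (0:ℝ) < 1/2)]
    refine mul_le_mul_of_nonneg_left ((Q_est G h hν (kb_ts (Ts.mull (Sm.coord j) (zt_ts.pd j)) 5 s) (kb_tsup 5 ?_ s) (h3 j s s0 s2)).trans 
      (le_of_eq (by rw [hL]; ring))) (by norm_num)
    exact (tsupport_mul_subset_right (f := fun y : R3 => y j) (g := pd zt j)).trans ((tsup_pd zt j).trans zt_supp)
  have bD : ∀ j, |∫ y, kb 3 (pd (pd zt j) j) s y * M y| ≤ 54 * C2 * r2 * L := fun j => by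
    refine (Q_est G h hν (kb_ts ((zt_ts.pd j).pd j) 3 s) (kb_tsup 3 ?_ s) (h2 j s s0 s2)).trans (le_of_eq (by rw [hL]; ring))
    exact (tsup_pd _ j).trans ((tsup_pd zt j).trans zt_supp)
  have main : Pg s (lap (fun y => zt y * M y)) 0 = (-1) * (∑ i, ∑ j, Pg s (pd (pd (cr (hij χ U V i j) g) i) j) 0) 
      + ((∑ i, ∑ j, ∫ y, kb 3 (fun y => 1 - zt y) s y * pd (pd (cr (hij χ U V i j) g) i) j y) + 
      ∑ j, (2 * (∫ y, K y * pd (fun y => pd zt j y * M y) j y) - ∫ y, kb 3 (pd (pd zt j) j) s y * M y)) := by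
    simp only [Pg_kb _ s0, ← hK]
    have ee : ∀ y, K y * lap (fun y => zt y * M y) y = (-1) * (∑ i, ∑ j, K y * pd (pd (cr (hij χ U V i j) g) i) j y) 
      + ((∑ i, ∑ j, kb 3 (fun y => 1 - zt y) s y * pd (pd (cr (hij χ U V i j) g) i) j y) + 
      ∑ j, (2 * (K y * pd (fun y => pd zt j y * M y) j y) - kb 3 (pd (pd zt j) j) s y * M y)) := fun y => by
      have k1 : kb 3 (fun y => 1 - zt y) s y = K y * (1 - zt y) := by rw [hK]; unfold kb; ring
      have k2 : ∀ j, kb 3 (pd (pd zt j) j) s y = K y * pd (pd zt j) j y := fun j => by rw [hK]; unfold kb; ring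
      rw [hM, lapL G h]
      simp only [k1, k2, Finset.mul_sum, mul_add]
      congr 1
      · refine Finset.sum_congr rfl fun i _ => Finset.sum_congr rfl fun j _ => by ring
      congr 1
      · refine Finset.sum_congr rfl fun i _ => Finset.sum_congr rfl fun j _ => by ring
      · refine Finset.sum_congr rfl fun j _ => by ring
    simp only [ee]
    have iS : Integrable (fun y => ∑ i, ∑ j, K y * pd (pd (cr (hij χ U V i j) g) i) j y) := 
      integrable_finsetSum _ fun i _ => integrable_finsetSum _ fun j _ => iA i j
    have iS2 : Integrable (fun y => ∑ i, ∑ j, kb 3 (fun y => 1 - zt y) s y * pd (pd (cr (hij χ U V i j) g) i) j y) := 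
      integrable_finsetSum _ fun i _ => integrable_finsetSum _ fun j _ => iB i j
    have iS3 : ∀ j, Integrable (fun y => 2 * (K y * pd (fun y => pd zt j y * M y) j y) - kb 3 (pd (pd zt j) j) s y * M y) := 
      fun j => ((iC j).const_mul 2).sub (iD j)
    have iS4 : Integrable (fun y => ∑ j, (2 * (K y * pd (fun y => pd zt j y * M y) j y) - kb 3 (pd (pd zt j) j) s y * M y)) :=
      integrable_finsetSum _ fun j _ => iS3 j
    have iS5 : Integrable (fun y => (∑ i, ∑ j, kb 3 (fun y => 1 - zt y) s y * pd (pd (cr (hij χ U V i j) g) i) j y)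
      + ∑ j, (2 * (K y * pd (fun y => pd zt j y * M y) j y) - kb 3 (pd (pd zt j) j) s y * M y)) := iS2.add iS4
    rw [intg_add2 (iS.const_mul (-1)) iS5, intg_add2 iS2 iS4, integral_const_mul,
      integral_finsetSum _ (fun i _ => integrable_finsetSum _ fun j _ => iA i j), 
      integral_finsetSum _ (fun i _ => integrable_finsetSum _ fun j _ => iB i j), integral_finsetSum _ (fun j _ => iS3 j)]
    simp only [integral_finsetSum _ (fun j _ => iA _ j), integral_finsetSum _ (fun j _ => iB _ j)]
    congr 1
    congr 1
    refine Finset.sum_congr rfl fun j _ => ?_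
    rw [integral_sub ((iC j).const_mul 2) (iD j), integral_const_mul]
  rw [main]
  have B1 : |(-1) * ∑ i, ∑ j, Pg s (pd (pd (cr (hij χ U V i j) g) i) j) 0| ≤ ∑ i, ∑ j, |Pg s (pd (pd (cr (hij χ U V i j) g) i) j) 0| := by
    rw [abs_mul, abs_neg, abs_one, one_mul]
    exact (Finset.abs_sum_le_sum_abs _ _).trans (Finset.sum_le_sum fun i _ => Finset.abs_sum_le_sum_abs _ _)
  have B2 : |∑ i, ∑ j, ∫ y, kb 3 (fun y => 1 - zt y) s y * pd (pd (cr (hij χ U V i j) g) i) j y| ≤ ∑ i : Fin 3, ∑ j : Fin 3, C1 * L :=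
    (Finset.abs_sum_le_sum_abs _ _).trans (Finset.sum_le_sum fun i _ => (Finset.abs_sum_le_sum_abs _ _).trans (Finset.sum_le_sum fun j _ => bB i j))
  have B3 : |∑ j, (2 * (∫ y, K y * pd (fun y => pd zt j y * M y) j y) - ∫ y, kb 3 (pd (pd zt j) j) s y * M y)| 
      ≤ ∑ j : Fin 3, (54 * (C2 + C3) * r2 * L) :=
    (Finset.abs_sum_le_sum_abs _ _).trans (Finset.sum_le_sum fun j _ => by 
      have := bC j; have := bD j
      rw [abs_le] at *
      constructor <;> linarith)
  refine (abs_add_le _ _).trans (add_le_add B1 ((abs_add_le _ _).trans ((add_le_add B2 B3).trans ?_)))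
  simp only [Finset.sum_const, Finset.card_univ, Fintype.card_fin, nsmul_eq_mul]
  push_cast
  rw [mul_assoc _ (Dd ν U V χ), ← hL]
  have q1 : 0 ≤ C1 * L := by positivity
  have q2 : 0 ≤ r2 * (C1 * L) := by positivity
  have q3 : 0 ≤ C2 * L := by positivity
  have q4 : 0 ≤ C3 * L := by positivity
  nlinarith

lemma sqrt3_add {a b : ℝ} (ha : 0 ≤ a) (hb : 0 ≤ b) : (a + b) * Real.sqrt (a + b) ≤ 2 * (a * Real.sqrt a + b * Real.sqrt b) := by
  obtain ⟨x, x0, rfl⟩ : ∃ x, 0 ≤ x ∧ a = x ^ 2 := ⟨Real.sqrt a, Real.sqrt_nonneg _, (Real.sq_sqrt ha).symm⟩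
  obtain ⟨y, y0, rfl⟩ : ∃ y, 0 ≤ y ∧ b = y ^ 2 := ⟨Real.sqrt b, Real.sqrt_nonneg _, (Real.sq_sqrt hb).symm⟩
  rw [Real.sqrt_sq x0, Real.sqrt_sq y0]
  set z := Real.sqrt (x^2 + y^2) with hz
  have z0 : 0 ≤ z := Real.sqrt_nonneg _
  have z2 : z ^ 2 = x^2 + y^2 := Real.sq_sqrt (by positivity)
  rw [← z2]
  refine abs_le_of_sq_le_sq' ?_ (by positivity) |>.2
  have : (z ^ 2 * z) ^ 2 = (z^2) ^ 3 := by ring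
  rw [this, z2]
  nlinarith [mul_nonneg x0 y0, sq_nonneg (x - y), mul_nonneg (mul_nonneg x0 y0) (sq_nonneg (x-y)), sq_nonneg (x^2 - x*y), sq_nonneg (y^2-x*y), 
    mul_nonneg (sq_nonneg (x-y)) (sq_nonneg (x^2)), mul_nonneg (sq_nonneg (x-y)) (sq_nonneg (y^2)), mul_nonneg (sq_nonneg (x-y)) (sq_nonneg (x*y)),
    sq_nonneg (x^3), sq_nonneg (y^3), sq_nonneg (x^3-y^3), mul_nonneg (mul_nonneg x0 y0) (sq_nonneg (x^2-y^2)), sq_nonneg (x^3-x^2*y), sq_nonneg (y^3-x*y^2)]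

lemma Ts.cm {f : R3 → ℝ} (hf : Ts f) (c : ℝ) : Ts (fun y => c * f y) := Ts.mull (Sm.const c) hf

lemma bell2 (G : Geo χ g r1 r2) (h : NSf ν U V P) (i j : Fin 3) {a b : ℝ} (ha : 0 < a) (hb : 0 < b) (hA : ∫ x, |g x| ^ 3 ≤ a ^ 3)
    (hB : ∫ x, (χ x * kk U V x) * Real.sqrt (χ x * kk U V x) ≤ b ^ 3) :
    ∫ s in (0:ℝ)..1, s * Iij g (hij χ U V i j) j i s ≤ 8 * a * b ^ 2 := by
  set l := b / a with hl
  have l0 : 0 < l := by positivity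
  have kt : Ts (fun x => χ x * kk U V x) := G.c.mulr h.k
  have ck : ∀ x, 0 ≤ χ x * kk U V x := fun x => mul_nonneg (G.c0 x) (kk_nonneg x)
  have g3 : Integrable (fun x => |g x| ^ 3) := int_cs (G.gt.sm.cont.abs.pow 3) 
    (HasCompactSupport.intro G.gt.cs.isCompact fun x hx => by rw [image_eq_zero_of_notMem_tsupport hx]; simp)
  have k3 : Integrable (fun x => (χ x * kk U V x) * Real.sqrt (χ x * kk U V x)) := int_cs (kt.sm.cont.mul kt.sm.cont.sqrt) (cs_mul_left kt.cs)
  have Gt : Ts (fun x => (l * g x) * (l * g x) + χ x * kk U V x) := ⟨((G.gt.cm l).mulr (G.gt.cm l).sm).sm.add kt.sm, ((G.gt.cm l).mulr (G.gt.cm l).sm).cs.add kt.cs⟩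
  have D : BD (fun x => l * g x) (hij χ U V i j) (fun x => (l * g x) * (l * g x) + χ x * kk U V x) := by
    refine ⟨G.gt.cm l, hij_ts G h i j, Gt, fun x => ?_, fun x => ?_⟩
    · have := ck x
      nlinarith
    · rw [hij, abs_mul, abs_of_nonneg (G.c0 x)]
      have := mul_le_mul_of_nonneg_left (HH_le (U := U) (V := V) i j x) (G.c0 x)
      nlinarith [mul_self_nonneg (l * g x)]
  have hb' := bellman D j i
  have eI : ∀ s, Iij (fun x => l * g x) (hij χ U V i j) j i s = l * Iij g (hij χ U V i j) j i s := fun s => by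
    have e1 : pd (fun x => l * g x) j = fun x => l * pd g j x := funext fun x => pd_cmul G.gt.sm.diff l j x
    have e2 : ∀ x, Pg s (fun x => l * pd g j x) x = l * Pg s (pd g j) x := fun x => by
      unfold Pg; rw [← integral_const_mul]; congr 1; funext z; ring
    unfold Iij
    rw [← integral_const_mul]
    simp only [e1, e2, abs_mul, abs_of_pos l0, mul_assoc]
  have eI2 : (fun s => s * Iij (fun x => l * g x) (hij χ U V i j) j i s) = fun s => l * (s * Iij g (hij χ U V i j) j i s) :=
    funext fun s => by rw [eI]; ring
  rw [eI2, intervalIntegral.integral_const_mul] at hb'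
  have est : ∫ x, ((l * g x) * (l * g x) + χ x * kk U V x) * Real.sqrt ((l * g x) * (l * g x) + χ x * kk U V x) ≤ 2 * (l ^ 3 * a ^ 3 + b ^ 3) := by
    calc _ ≤ ∫ x, (2 * l ^ 3 * |g x| ^ 3 + 2 * ((χ x * kk U V x) * Real.sqrt (χ x * kk U V x))) := by
          refine integral_mono (int_cs (Gt.sm.cont.mul Gt.sm.cont.sqrt) (cs_mul_left Gt.cs)) ((g3.const_mul _).add (k3.const_mul 2)) fun x => ?_
          refine (sqrt3_add (mul_self_nonneg _) (ck x)).trans (le_of_eq ?_)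
          have : (l * g x) * (l * g x) = l ^ 2 * |g x| ^ 2 := by rw [sq_abs]; ring
          rw [Real.sqrt_mul_self_eq_abs, abs_mul, abs_of_pos l0, this]; ring
      _ = 2 * l ^ 3 * (∫ x, |g x| ^ 3) + 2 * ∫ x, (χ x * kk U V x) * Real.sqrt (χ x * kk U V x) := by
          rw [intg_add2 (g3.const_mul _) (k3.const_mul 2), integral_const_mul, integral_const_mul]
      _ ≤ 2 * l ^ 3 * a ^ 3 + 2 * b ^ 3 := by gcongr
      _ = _ := by ring
  have fin : l * (∫ s in (0:ℝ)..1, s * Iij g (hij χ U V i j) j i s) ≤ l * (8 * a * b ^ 2) := by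
    refine hb'.trans ((mul_le_mul_of_nonneg_left est zero_le_two).trans (le_of_eq ?_))
    rw [hl]; field_simp; ring
  exact le_of_mul_le_mul_left fin l0

theorem pressure : ∃ C : ℝ, 0 ≤ C ∧ ∀ {ν : ℝ} {U V : Fin 3 → R3 → ℝ} {P : R3 → ℝ} {χ g : R3 → ℝ} {r1 r2 : ℝ}, Geo χ g r1 r2 → NSf ν U V P → 
    0 ≤ ν → ∀ {a b : ℝ}, 0 < a → 0 < b → ∫ x, |g x| ^ 3 ≤ a ^ 3 → ∫ x, (χ x * kk U V x) * Real.sqrt (χ x * kk U V x) ≤ b ^ 3 →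
    |∫ x, P x * g x| ≤ C * (a * b ^ 2 + (1 + r2) * (Dd ν U V χ * ∫ x, |g x|)) := by
  obtain ⟨C1, p1, h1⟩ := step_s
  have et : Ts (kb 3 zt (Real.sqrt 2)) := kb_ts zt_ts 3 _
  obtain ⟨C2, p2, h2⟩ := et.C2
  refine ⟨288 + 2 * C1 + 54 * C2, by positivity, fun {ν U V P χ g r1 r2} G h hν {a b} ha hb hA hB => ?_⟩
  have s2 : 0 < Real.sqrt 2 := by positivity
  have s2' : Real.sqrt 2 ≤ 2 := by rw [Real.sqrt_le_left (by norm_num)]; norm_num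
  have sq2 : Real.sqrt 2 ^ 2 = 2 := Real.sq_sqrt (by norm_num)
  set L : ℝ := Dd ν U V χ * ∫ x, |g x| with hL
  have L0 : 0 ≤ L := mul_nonneg (Dd_nonneg G hν) (integral_nonneg fun x => abs_nonneg _)
  have r2p : 0 < r2 := G.r0.trans_le G.r12
  set Λ : R3 → ℝ := fun y => zt y * cr P g y with hΛ
  have Λt : Ts Λ := zt_ts.mulr (cr_sm h.p G.gt)
  have Λ0 : Λ 0 = ∫ x, P x * g x := by
    simp [hΛ, cr, zt_one (y := 0) (by simp)]
  have dv : ∀ t ∈ Set.uIcc (0:ℝ) 1, HasDerivAt (fun t => Pg (Real.sqrt 2 * t) Λ 0) (4 * (t * Pg (Real.sqrt 2 * t) (lap Λ) 0)) t := fun t _ => by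
    have d1 := Pg_hasDeriv Λt 0 (Real.sqrt 2 * t)
    have d2 : HasDerivAt (fun t => Real.sqrt 2 * t) (Real.sqrt 2) t := by simpa using (hasDerivAt_id t).const_mul (Real.sqrt 2)
    refine (d1.comp t d2).congr_deriv ?_
    linear_combination (2 * t * Pg (Real.sqrt 2 * t) (lap Λ) 0) * sq2
  have cP : Continuous (fun t : ℝ => Pg (Real.sqrt 2 * t) (lap Λ) 0) := 
    (Pg_cont Λt.lap.bc).comp ((continuous_const.mul continuous_id).prodMk continuous_const)
  have ftc := intervalIntegral.integral_eq_sub_of_hasDerivAt dv (Continuous.intervalIntegrable (by fun_prop) _ _)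
  simp only [mul_one, mul_zero, Pg_zero] at ftc
  have e1 : |Pg (Real.sqrt 2) Λ 0| ≤ 54 * C2 * r2 * L := by
    have : Pg (Real.sqrt 2) Λ 0 = ∫ y, kb 3 zt (Real.sqrt 2) y * cr P g y := by
      rw [Pg_subst _ s2]; congr 1; funext y; simp only [hΛ, kb]; ring
    rw [this]
    refine (Q_est G h hν et (kb_tsup 3 zt_supp _) h2).trans (le_of_eq (by rw [hL]; ring))
  have cI : ∀ i j, IntervalIntegrable (fun t => t * Iij g (hij χ U V i j) j i t) volume 0 1 := fun i j => by
    refine ContinuousOn.intervalIntegrable ?_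
    rw [Set.uIcc_of_le zero_le_one]
    exact continuousOn_id.mul (Iij_cont G.gt (hij_ts G h i j) j i)
  have iS' : ∀ i, IntervalIntegrable (fun t => ∑ j, t * Iij g (hij χ U V i j) j i t) volume 0 1 := fun i => 
    (IntervalIntegrable.sum Finset.univ fun j _ => cI i j).congr (by intro t _; simp)
  have iS : IntervalIntegrable (fun t => ∑ i, ∑ j, t * Iij g (hij χ U V i j) j i t) volume 0 1 := 
    (IntervalIntegrable.sum Finset.univ fun i _ => iS' i).congr (by intro t _; simp)
  have e2 : |∫ t in (0:ℝ)..1, 4 * (t * Pg (Real.sqrt 2 * t) (lap Λ) 0)| ≤ 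
      ∫ t in (0:ℝ)..1, 4 * ((∑ i, ∑ j, t * Iij g (hij χ U V i j) j i t) + t * (C1 * (1 + r2) * L)) := by
    refine intervalIntegral.norm_integral_le_of_norm_le (f := fun t => 4 * (t * Pg (Real.sqrt 2 * t) (lap Λ) 0)) zero_le_one (Eventually.of_forall fun t ht => ?_) ?_
    · have t0 := ht.1
      have := h1 G h hν (Real.sqrt 2 * t) (by positivity) (by nlinarith [ht.2])
      rw [Real.norm_eq_abs, abs_mul, abs_mul, abs_of_pos (by norm_num : (0:ℝ) < 4), abs_of_pos t0]
      refine mul_le_mul_of_nonneg_left ?_ (by norm_num)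
      simp only [← Finset.mul_sum]
      rw [← mul_add]
      refine mul_le_mul_of_nonneg_left (this.trans (add_le_add ?_ (le_of_eq (by rw [hL]; ring)))) t0.le
      refine Finset.sum_le_sum fun i _ => Finset.sum_le_sum fun j _ => Pg_cr_pd (hij_ts G h i j) G.gt j i ?_
      rw [abs_of_pos t0]; exact ht.2
    · refine IntervalIntegrable.const_mul ?_ _
      exact iS.add (Continuous.intervalIntegrable (by fun_prop) _ _)
  have e3 : ∫ t in (0:ℝ)..1, 4 * ((∑ i, ∑ j, t * Iij g (hij χ U V i j) j i t) + t * (C1 * (1 + r2) * L)) ≤ 288 * (a * b^2) + 2 * C1 * (1 + r2) * L := by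
    rw [intervalIntegral.integral_const_mul, intervalIntegral.integral_add iS (Continuous.intervalIntegrable (by fun_prop) _ _), 
      intervalIntegral.integral_finsetSum (fun i _ => iS' i), intervalIntegral.integral_mul_const, integral_id]
    have : ∑ i, (∫ t in (0:ℝ)..1, ∑ j, t * Iij g (hij χ U V i j) j i t) ≤ ∑ i : Fin 3, ∑ j : Fin 3, 8 * a * b ^ 2 := 
      Finset.sum_le_sum fun i _ => by
        rw [intervalIntegral.integral_finsetSum (fun j _ => cI i j)]
        exact Finset.sum_le_sum fun j _ => bell2 G h i j ha hb hA hB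
    simp only [Finset.sum_const, Finset.card_univ, Fintype.card_fin, nsmul_eq_mul] at this
    push_cast at this
    linarith
  rw [← Λ0]
  have e4 := e2.trans e3
  rw [ftc] at e4
  have q1 : 0 ≤ C1 * L := by positivity
  have q2 : 0 ≤ C2 * L := by positivity
  have q3 : 0 ≤ a * b ^ 2 := by positivity
  have q4 : 0 ≤ C1 * (a * b ^ 2) := by positivity
  have q5 : 0 ≤ C2 * (a * b ^ 2) := by positivity
  have q6 : 0 ≤ r2 * L := by positivity
  have : |Λ 0| ≤ 54 * C2 * r2 * L + (288 * (a * b^2) + 2 * C1 * (1 + r2) * L) := by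
    rw [abs_le] at *
    constructor <;> linarith [e1.1, e1.2, e4.1, e4.2]
  refine this.trans ?_
  nlinarith

end
end

open MeasureTheory Filter Metric
noncomputable section

lemma pd_comp1 {T : ℝ → ℝ} {f : R3 → ℝ} (hT : Differentiable ℝ T) (hf : Differentiable ℝ f) (j : Fin 3) (x : R3) :
    pd (fun y => T (f y)) j x = deriv T (f x) * pd f j x := by
  have := ((hT (f x)).hasDerivAt.comp_hasFDerivAt x (hf x).hasFDerivAt).fderiv
  unfold pd
  rw [show (fun y => T (f y)) = T ∘ f from rfl, this]; simp

lemma T0_sm : ContDiff ℝ (⊤ : ℕ∞) Real.smoothTransition := Real.smoothTransition.contDiff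
lemma T0_d : Differentiable ℝ Real.smoothTransition := T0_sm.differentiable (by simp)
lemma T1_sm : ContDiff ℝ (⊤ : ℕ∞) (deriv Real.smoothTransition) := ((contDiff_succ_iff_deriv (n := (⊤ : ℕ∞))).1 (by simpa using T0_sm)).2.2
lemma T1_zero {t : ℝ} (h : t ≤ 0 ∨ 1 ≤ t) : deriv Real.smoothTransition t = 0 := by
  rcases h with h | h
  · refine IsLocalMin.deriv_eq_zero (Eventually.of_forall fun s => ?_)
    rw [Real.smoothTransition.zero_of_nonpos h]; exact Real.smoothTransition.nonneg s
  · refine IsLocalMax.deriv_eq_zero (Eventually.of_forall fun s => ?_)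
    rw [Real.smoothTransition.one_of_one_le h]; exact Real.smoothTransition.le_one s
lemma T1_cs : HasCompactSupport (deriv Real.smoothTransition) := by
  refine HasCompactSupport.intro (isCompact_Icc (a := (0:ℝ)) (b := 1)) fun t ht => T1_zero ?_
  by_contra! h
  exact ht ⟨h.1.le, h.2.le⟩
lemma T_bd : ∃ K : ℝ, 0 < K ∧ (∀ t, |deriv Real.smoothTransition t| ≤ K) ∧ ∀ t, |deriv (deriv Real.smoothTransition) t| ≤ K := by
  obtain ⟨C1, h1⟩ := T1_cs.exists_bound_of_continuous T1_sm.continuous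
  obtain ⟨C2, h2⟩ := T1_cs.deriv.exists_bound_of_continuous (T1_sm.continuous_deriv (by simp))
  refine ⟨|C1| + |C2| + 1, by positivity, fun t => (h1 t).trans ?_, fun t => (h2 t).trans ?_⟩
  · linarith [le_abs_self C1, abs_nonneg C2]
  · linarith [le_abs_self C2, abs_nonneg C1]

/-- radial cutoff -/
def cut (a b : ℝ) (x : R3) : ℝ := Real.smoothTransition ((b^2 - a^2)⁻¹ * (b ^ 2 - ‖x‖ ^ 2))

lemma arg_sm (a b : ℝ) : Sm (fun x : R3 => (b^2 - a^2)⁻¹ * (b ^ 2 - ‖x‖ ^ 2)) := ((Sm.const _).sub Sm.normsq).cmul _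

lemma cut_nonneg (a b : ℝ) (x : R3) : 0 ≤ cut a b x := Real.smoothTransition.nonneg _
lemma cut_le (a b : ℝ) (x : R3) : cut a b x ≤ 1 := Real.smoothTransition.le_one _
lemma cut_sm (a b : ℝ) : Sm (cut a b) := T0_sm.comp (arg_sm a b)

section
variable {a b : ℝ} (ha : 0 < a) (hb : a < b)
include ha hb

lemma cut_den : 0 < b^2 - a^2 := by nlinarith

lemma arg_ge {x : R3} (hx : ‖x‖ ≤ a) : 1 ≤ (b^2 - a^2)⁻¹ * (b ^ 2 - ‖x‖ ^ 2) := by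
  have := cut_den ha hb
  rw [inv_mul_eq_div, le_div_iff₀ this]
  nlinarith [norm_nonneg x]

lemma arg_le {x : R3} (hx : b ≤ ‖x‖) : (b^2 - a^2)⁻¹ * (b ^ 2 - ‖x‖ ^ 2) ≤ 0 := by
  have := cut_den ha hb
  exact mul_nonpos_of_nonneg_of_nonpos (by positivity) (by nlinarith)

lemma cut_one {x : R3} (hx : ‖x‖ ≤ a) : cut a b x = 1 := Real.smoothTransition.one_of_one_le (arg_ge ha hb hx)

lemma cut_zero {x : R3} (hx : b ≤ ‖x‖) : cut a b x = 0 := Real.smoothTransition.zero_of_nonpos (arg_le ha hb hx)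

lemma cut_ts : Ts (cut a b) := ⟨cut_sm a b, HasCompactSupport.intro (isCompact_closedBall (0:R3) b) fun x hx => cut_zero ha hb (by
  rw [mem_closedBall_zero_iff, not_le] at hx; exact hx.le)⟩

omit ha hb in
lemma cut_pd (j : Fin 3) : pd (cut a b) j = fun x => (-2 * (b^2 - a^2)⁻¹) * (deriv Real.smoothTransition ((b^2 - a^2)⁻¹ * (b ^ 2 - ‖x‖ ^ 2)) * x j) := by
  funext x
  unfold cut
  rw [pd_comp1 T0_d (arg_sm a b).diff, pd_cmul ((Sm.const _).sub Sm.normsq).diff, pd_sub (Sm.const _).diff Sm.normsq.diff, pd_const, pd_normsq]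
  ring

lemma cut_pd_shell {j : Fin 3} {x : R3} (h : pd (cut a b) j x ≠ 0) : a < ‖x‖ ∧ ‖x‖ < b := by
  by_contra hn
  apply h
  rw [cut_pd]
  have : deriv Real.smoothTransition ((b^2 - a^2)⁻¹ * (b ^ 2 - ‖x‖ ^ 2)) = 0 := by
    refine T1_zero ?_
    rcases not_and_or.1 hn with h1 | h1
    · exact Or.inr (arg_ge ha hb (not_lt.1 h1))
    · exact Or.inl (arg_le ha hb (not_lt.1 h1))
  simp only [this]; ring

lemma cut_pd2_shell {i j : Fin 3} {x : R3} (h : pd (pd (cut a b) j) i x ≠ 0) : a ≤ ‖x‖ ∧ ‖x‖ ≤ b := by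
  have hx : x ∈ tsupport (pd (cut a b) j) := by
    by_contra hx
    exact h (pd_zero_off hx i)
  have hc : IsClosed {x : R3 | a ≤ ‖x‖ ∧ ‖x‖ ≤ b} :=
    (isClosed_le continuous_const continuous_norm).inter (isClosed_le continuous_norm continuous_const)
  have hsub : Function.support (pd (cut a b) j) ⊆ {x : R3 | a ≤ ‖x‖ ∧ ‖x‖ ≤ b} := fun x hx =>
    ⟨(cut_pd_shell ha hb hx).1.le, (cut_pd_shell ha hb hx).2.le⟩
  exact closure_minimal hsub hc hx

end

lemma cut_bd : ∃ C : ℝ, 0 < C ∧ ∀ a b : ℝ, 0 < a → a < b → (∀ j x, |pd (cut a b) j x| ≤ C / (b - a)) ∧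
    ∀ i j x, |pd (pd (cut a b) j) i x| ≤ C / (b - a) ^ 2 := by
  obtain ⟨K, K0, h1, h2⟩ := T_bd
  refine ⟨6 * K, by positivity, fun a b ha hb => ⟨fun j x => ?_, fun i j x => ?_⟩⟩
  · have hba : 0 < b - a := by linarith
    by_cases h : pd (cut a b) j x = 0
    · rw [h, abs_zero]; positivity
    · have hx := cut_pd_shell ha hb h
      have hd := cut_den ha hb
      have xj := (coord_le x j).trans hx.2.le
      rw [cut_pd, abs_mul, abs_mul, abs_mul, abs_neg, abs_two, abs_inv, abs_of_pos hd]
      calc _ ≤ 2 * (b^2-a^2)⁻¹ * (K * b) := by gcongr; exact h1 _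
        _ ≤ _ := by
          have : b ^ 2 - a ^ 2 = (b - a) * (b + a) := by ring
          have b0 : 0 < b := ha.trans hb
          have e : 2 * ((b - a) * (b + a))⁻¹ * (K * b) = (2 * K * b / (b + a)) / (b - a) := by field_simp
          rw [this, e]
          gcongr
          rw [div_le_iff₀ (by positivity)]
          nlinarith [mul_pos K0 ha, mul_pos K0 b0]
  · have hba : 0 < b - a := by linarith
    by_cases h : pd (pd (cut a b) j) i x = 0
    · rw [h, abs_zero]; positivity
    · have hx := cut_pd2_shell ha hb h
      have hd := cut_den ha hb
      have xj := (coord_le x j).trans hx.2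
      have xi := (coord_le x i).trans hx.2
      have T1d : Differentiable ℝ (deriv Real.smoothTransition) := T1_sm.differentiable (by simp)
      have s1 : Sm (fun x : R3 => deriv Real.smoothTransition ((b^2 - a^2)⁻¹ * (b ^ 2 - ‖x‖ ^ 2))) := T1_sm.comp (arg_sm a b)
      have e : pd (pd (cut a b) j) i x = (-2 * (b^2 - a^2)⁻¹) * (deriv Real.smoothTransition ((b^2 - a^2)⁻¹ * (b ^ 2 - ‖x‖ ^ 2)) * (if j = i then 1 else 0) 
          + deriv (deriv Real.smoothTransition) ((b^2 - a^2)⁻¹ * (b ^ 2 - ‖x‖ ^ 2)) * ((-2 * (b^2-a^2)⁻¹) * x i) * x j) := by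
        rw [cut_pd, pd_cmul (s1.mul (Sm.coord j)).diff, pd_mul s1.diff (Sm.coord j).diff, pd_coord, pd_comp1 T1d (arg_sm a b).diff, 
          pd_cmul ((Sm.const _).sub Sm.normsq).diff, pd_sub (Sm.const _).diff Sm.normsq.diff, pd_const, pd_normsq]
        ring
      have i1 : |(if j = i then (1:ℝ) else 0)| ≤ 1 := by split_ifs <;> simp
      have b0 : 0 < b := ha.trans hb
      rw [e, abs_mul, abs_mul, abs_neg, abs_two, abs_inv, abs_of_pos hd]
      calc _ ≤ 2 * (b^2-a^2)⁻¹ * (K * 1 + K * ((2 * (b^2-a^2)⁻¹) * b) * b) := by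
            gcongr
            refine (abs_add_le _ _).trans ?_
            simp only [abs_mul, abs_neg, abs_two, abs_inv, abs_of_pos hd]
            gcongr
            · exact h1 _
            · exact h2 _
        _ ≤ _ := by
          have : b ^ 2 - a ^ 2 = (b - a) * (b + a) := by ring
          rw [this, le_div_iff₀ (by positivity)]
          field_simp
          have : K * (((b-a)*(b+a)) + 2 * b ^2) * 2 ≤ 6 * K * (b+a)^2 := by
            nlinarith [mul_pos K0 ha, mul_pos K0 b0, mul_pos (mul_pos K0 b0) ha, mul_pos (mul_pos K0 ha) ha]
          nlinarith

/-- the cutoff package -/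
structure Cuts (C R s s' : ℝ) (f c w : R3 → ℝ) : Prop where
  ft : Ts f
  f0 : ∀ x, 0 ≤ f x
  f1 : ∀ x, ‖x‖ ≤ s * R → f x = 1
  fd : ∀ j x, |pd f j x| ≤ C / ((s' - s) * R)
  fdd : ∀ i j x, |pd (pd f j) i x| ≤ C / ((s' - s) * R) ^ 2
  fs : ∀ j x, pd f j x ≠ 0 → (s + (s' - s)/3) * R ≤ ‖x‖ ∧ ‖x‖ ≤ (s + (s' - s)/2) * R
  fss : ∀ i j x, pd (pd f j) i x ≠ 0 → (s + (s' - s)/3) * R ≤ ‖x‖ ∧ ‖x‖ ≤ (s + (s' - s)/2) * R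
  ct : Ts c
  c0 : ∀ x, 0 ≤ c x
  c1 : ∀ x, c x ≤ 1
  cA : ∀ x, c x ≠ 0 → x ∈ annulus R ∧ w x = 1
  cs : ∀ x y, (s + (s' - s)/3) * R ≤ ‖x‖ → ‖x‖ ≤ (s + (s' - s)/2) * R → ‖y‖ ≤ (s' - s) * R / 12 → c (x + y) = 1
  wt : Ts w
  w0 : ∀ x, 0 ≤ w x
  w1 : ∀ x, w x ≤ 1
  ws : ∀ x, w x ≠ 0 → ‖x‖ < s' * R
  wd : ∀ j x, |pd w j x| ≤ C / ((s' - s) * R)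
  wA : ∀ j x, pd w j x ≠ 0 → x ∈ annulus R
  wb : ∀ x, ‖x‖ ≤ s * R → w x = 1

lemma mem_ann {R : ℝ} {x : R3} : x ∈ annulus R ↔ R ≤ ‖x‖ ∧ ‖x‖ < 2 * R := by
  unfold annulus; simp only [Set.mem_sdiff, mem_ball_zero_iff, not_lt]; tauto

lemma cuts : ∃ C : ℝ, 0 < C ∧ ∀ R s s', 0 < R → 1 ≤ s → s < s' → s' ≤ 2 → ∃ f c w, Cuts C R s s' f c w := by
  obtain ⟨C, C0, hC⟩ := cut_bd
  refine ⟨36 * C, by positivity, fun R s s' R0 s1 ss s2 => ?_⟩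
  obtain ⟨d, d0, rfl⟩ : ∃ d, 0 < d ∧ s' = s + 6 * d := ⟨(s' - s)/6, by linarith, by ring⟩
  have dR : 0 < d * R := by positivity
  have sR : R ≤ s * R := by nlinarith
  have sR2 : s * R + 6 * (d * R) ≤ 2 * R := by nlinarith
  have e0 : s + 6 * d - s = 6 * d := by ring
  have e1 : (s + (6 * d)/3) * R = s * R + 2 * (d * R) := by ring
  have e2 : (s + (6 * d)/2) * R = s * R + 3 * (d * R) := by ring
  have e3 : 6 * d * R / 12 = (d * R) / 2 := by ring
  have e4 : (s + 6 * d) * R = s * R + 6 * (d * R) := by ring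
  set D := d * R
  set S := s * R
  have S0 : 0 < S := by linarith
  have D1 : 36 * C / (6 * d * R) = 6 * C / D := by
    rw [show 6 * d * R = 6 * D by simp only [D]; ring]; field_simp; ring
  have D2 : 36 * C / (6 * d * R) ^ 2 = C / D ^ 2 := by
    rw [show 6 * d * R = 6 * D by simp only [D]; ring]; field_simp; ring
  have kf := hC (S + 2 * D) (S + 3 * D) (by linarith) (by linarith)
  have kw := hC (S + 5 * D) (S + 6 * D) (by linarith) (by linarith)
  rw [show S + 3 * D - (S + 2 * D) = D by ring] at kf
  rw [show S + 6 * D - (S + 5 * D) = D by ring] at kw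
  have le6 : C / D ≤ 6 * C / D := by gcongr; linarith
  refine ⟨cut (S + 2 * D) (S + 3 * D), fun x => cut (S + 4 * D) (S + 5 * D) x * (1 - cut S (S + D) x), cut (S + 5 * D) (S + 6 * D), ?_⟩
  constructor
  · exact cut_ts (by linarith) (by linarith)
  · exact cut_nonneg _ _
  · exact fun x hx => cut_one (by linarith) (by linarith) (by linarith)
  · intro j x; rw [e0, D1]; exact (kf.1 j x).trans le6
  · intro i j x; rw [e0, D2]; exact kf.2 i j x
  · intro j x h
    rw [e0, e1, e2]
    have := cut_pd_shell (by linarith) (by linarith) h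
    exact ⟨this.1.le, this.2.le⟩
  · intro i j x h
    rw [e0, e1, e2]
    exact cut_pd2_shell (by linarith) (by linarith) h
  · exact (cut_ts (by linarith) (by linarith)).mulr ((Sm.const 1).sub (cut_sm _ _))
  · exact fun x => mul_nonneg (cut_nonneg _ _ _) (by linarith [cut_le S (S + D) x])
  · intro x
    have := cut_le S (S + D) x
    have := cut_nonneg S (S + D) x
    have := cut_le (S + 4 * D) (S + 5 * D) x
    have := cut_nonneg (S + 4 * D) (S + 5 * D) x
    nlinarith
  · intro x hx
    have h1 : S < ‖x‖ := by
      by_contra! h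
      rw [cut_one S0 (by linarith) h] at hx
      simp at hx
    have h2 : ‖x‖ < S + 5 * D := by
      by_contra! h
      rw [cut_zero (by linarith) (by linarith) h] at hx
      simp at hx
    refine ⟨mem_ann.2 ⟨by linarith, by linarith⟩, cut_one (by linarith) (by linarith) h2.le⟩
  · intro x y h1 h2 h3
    rw [e0, e1] at h1
    rw [e0, e2] at h2
    rw [e0, e3] at h3
    have t1 := norm_add_le x y
    have t2 : ‖x‖ - ‖y‖ ≤ ‖x + y‖ := by simpa using norm_sub_norm_le x (-y)
    rw [cut_one (a := S + 4 * D) (by linarith) (by linarith) (by linarith), cut_zero (a := S) S0 (by linarith) (by linarith)]; ring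
  · exact cut_ts (by linarith) (by linarith)
  · exact cut_nonneg _ _
  · exact cut_le _ _
  · intro x hx
    rw [e4]
    by_contra! h
    exact hx (cut_zero (by linarith) (by linarith) h)
  · intro j x; rw [e0, D1]; exact (kw.1 j x).trans le6
  · intro j x h
    have := cut_pd_shell (by linarith) (by linarith) h
    exact mem_ann.2 ⟨by linarith, by linarith⟩
  · exact fun x hx => cut_one (by linarith) (by linarith) (by linarith)

end

open MeasureTheory Filter Metric
noncomputable section

lemma Sm.sc {f : R3 → ℝ} (hf : Sm f) (c : ℝ) : Sm (fun y : R3 => f (c • y)) := hf.comp (contDiff_const_smul c)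

lemma Ts.sc {f : R3 → ℝ} (hf : Ts f) {c : ℝ} (hc : c ≠ 0) : Ts (fun y : R3 => f (c • y)) :=
  ⟨hf.sm.sc c, hf.cs.comp_homeomorph (Homeomorph.smulOfNeZero c hc)⟩

lemma int_sc (f : R3 → ℝ) {c : ℝ} (hc : 0 < c) : ∫ y : R3, f (c • y) = (c ^ 3)⁻¹ * ∫ y, f y := by
  rw [Measure.integral_comp_smul]
  have : Module.finrank ℝ R3 = 3 := by simp [R3]
  rw [this, abs_of_pos (by positivity), smul_eq_mul]

lemma NSf.sc {u v : Fin 3 → R3 → ℝ} {π : R3 → ℝ} (h : NSf 1 u v π) {l : ℝ} (hl : 0 < l) :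
    NSf l⁻¹ (fun i x => u i (l • x)) (fun i x => v i (l • x)) (fun x => π (l • x)) where
  u i := (h.u i).sc l
  v i := (h.v i).sc l
  p := h.p.sc l
  eq i x := by
    have e1 : lap (fun x => u i (l • x)) x = l ^ 2 * lap (u i) (l • x) := by
      unfold lap
      rw [Finset.mul_sum]
      refine Finset.sum_congr rfl fun j _ => ?_
      rw [show pd (fun x => u i (l • x)) j = fun x => l * pd (u i) j (l • x) from funext fun x => pd_comp_smul _ _ _ _]
      rw [pd_cmul (((h.u i).pd j).sc l).diff, pd_comp_smul (pd (u i) j)]; ring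
    have e2 : ∀ j, pd (fun y => u i (l • y) * u j (l • y) + v i (l • y) * v j (l • y)) j x
        = l * pd (fun y => u i y * u j y + v i y * v j y) j (l • x) := fun j =>
      pd_comp_smul (fun y => u i y * u j y + v i y * v j y) _ _ _
    rw [pd_comp_smul, h.eq i, e1]
    simp only [e2]
    rw [← Finset.mul_sum]; field_simp
  dv x := by
    simp only [pd_comp_smul]
    rw [← Finset.mul_sum, h.dv]; simp

theorem pressure_sc : ∃ C : ℝ, 0 ≤ C ∧ ∀ {l : ℝ} {u v : Fin 3 → R3 → ℝ} {π χ g : R3 → ℝ} {r1 r2 a b : ℝ}, 0 < l →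
    NSf 1 u v π → Ts χ → (∀ x, 0 ≤ χ x) → (∀ x, χ x ≤ 1) → Ts g → ∫ x, g x = 0 → 0 < r1 → r1 ≤ r2 →
    (∀ x, g x ≠ 0 → r1 ≤ ‖x‖ ∧ ‖x‖ ≤ r2) → 
    (∀ x y, r1 ≤ ‖x‖ → ‖x‖ ≤ r2 → ‖y‖ ≤ l / 2 → χ (x + y) = 1) → 0 < a → 0 < b → ∫ x, |g x| ^ 3 ≤ a ^ 3 →
    ∫ x, (χ x * kk u v x) * √(χ x * kk u v x) ≤ b ^ 3 → 
    |∫ x, π x * g x| ≤ C * (a * b ^ 2 + (1 + r2 / l) * ((l ^ 3)⁻¹ * (l⁻¹ * ∑ i, (∫ x, χ x * |u i x|) + ∫ x, χ x * kk u v x) * ∫ x, |g x|)) := by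
  obtain ⟨C, C0, hC⟩ := pressure
  refine ⟨C, C0, ?_⟩
  intro l u v π χ g r1 r2 a b hl h χt χ0 χ1 gt gz r0 r12 gs cs a0 b0 ha hb
  have G : Geo (fun x => χ (l • x)) (fun x => l * g (l • x)) (r1 / l) (r2 / l) := by
    have n : ∀ x : R3, ‖l • x‖ = l * ‖x‖ := fun x => by rw [norm_smul, Real.norm_of_nonneg hl.le]
    constructor
    · exact χt.sc hl.ne'
    · exact fun x => χ0 _
    · exact fun x => χ1 _
    · exact Ts.mull (Sm.const l) (gt.sc hl.ne')
    · rw [integral_const_mul, int_sc g hl, gz]; simp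
    · positivity
    · gcongr
    · intro x hx
      have := gs (l • x) (right_ne_zero_of_mul hx)
      rw [n] at this
      rw [div_le_iff₀ hl, le_div_iff₀ hl, mul_comm]; exact this
    · intro x y h1 h2 h3
      rw [div_le_iff₀ hl, mul_comm] at h1
      rw [le_div_iff₀ hl, mul_comm] at h2
      rw [smul_add]
      refine cs _ _ (by rwa [n]) (by rwa [n]) ?_
      rw [n]; nlinarith
  have K := hC G (h.sc hl) (by positivity) (a := a) (b := b / l) a0 (by positivity) ?_ ?_
  · have e1 : ∫ x, π (l • x) * (l * g (l • x)) = l * ((l^3)⁻¹ * ∫ x, π x * g x) := by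
      rw [← int_sc (fun x => π x * g x) hl, ← integral_const_mul]; congr 1; ext x; ring
    have e2 : ∫ x, |l * g (l • x)| = l * ((l^3)⁻¹ * ∫ x, |g x|) := by
      rw [← int_sc (fun x => |g x|) hl, ← integral_const_mul]; simp only [abs_mul, abs_of_pos hl]
    have e3 : Dd l⁻¹ (fun i x => u i (l • x)) (fun i x => v i (l • x)) (fun x => χ (l • x)) =
        (l^3)⁻¹ * (l⁻¹ * ∑ i, (∫ x, χ x * |u i x|) + ∫ x, χ x * kk u v x) := by
      unfold Dd
      rw [show (∫ x, χ (l • x) * kk (fun i x => u i (l • x)) (fun i x => v i (l • x)) x) = (l^3)⁻¹ * ∫ x, χ x * kk u v x from 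
        int_sc (fun x => χ x * kk u v x) hl]
      simp only [fun i => int_sc (fun x => χ x * |u i x|) hl]
      rw [← Finset.mul_sum]; ring
    rw [e1, e2, e3, abs_mul, abs_mul, abs_of_pos hl, abs_of_pos (by positivity : 0 < (l^3)⁻¹)] at K
    have : |∫ x, π x * g x| = l ^ 2 * (l * ((l^3)⁻¹ * |∫ x, π x * g x|)) := by field_simp
    rw [this]
    refine (mul_le_mul_of_nonneg_left K (by positivity)).trans (le_of_eq ?_)
    field_simp
  · have : ∫ x, |l * g (l • x)| ^ 3 = ∫ x, |g x| ^ 3 := by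
      simp only [abs_mul, mul_pow, abs_of_pos hl]
      rw [integral_const_mul, int_sc (fun x => |g x| ^ 3) hl]; field_simp
    exact this.trans_le ha
  · have := int_sc (fun x => (χ x * kk u v x) * √(χ x * kk u v x)) hl
    refine (le_of_eq this).trans ?_
    rw [div_pow, inv_mul_eq_div]; gcongr

end

open MeasureTheory Filter Metric
noncomputable section

structure Sol (U V : Fin 3 → R3 → ℝ) (π θ : R3 → ℝ) : Prop where
  u : ∀ i, Sm (U i)
  v : ∀ i, Sm (V i)
  p : Sm π
  t : Sm θ
  e1 : ∀ i x, -lap (U i) x + (∑ j, U j x * pd (U i) j x) + pd π i x + (∑ j, pd (fun y => V j y * V i y) j x) = 0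
  e2 : ∀ i x, -lap (V i) x + (∑ j, U j x * pd (V i) j x) + pd θ i x + (∑ j, V j x * pd (U i) j x) = 0
  e3 : ∀ x, -lap θ x + (∑ j, U j x * pd θ j x) + (∑ j, pd (V j) j x) = 0
  dv : ∀ x, ∑ j, pd (U j) j x = 0

def Dens (u v : Fin 3 → R3 → ℝ) (θ : R3 → ℝ) (x : R3) : ℝ :=
  ∑ j, ((∑ i, pd (u i) j x ^ 2) + (∑ i, pd (v i) j x ^ 2) + pd θ j x ^ 2)
def En (u v : Fin 3 → R3 → ℝ) (θ : R3 → ℝ) (x : R3) : ℝ := (∑ i, u i x * u i x) + (∑ i, v i x * v i x) + θ x * θ x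
/-- energy flux without pressure -/
def Fl (u v : Fin 3 → R3 → ℝ) (θ : R3 → ℝ) (j : Fin 3) (x : R3) : ℝ :=
  1 / 2 * En u v θ x * u j x + (∑ i, u i x * v i x) * v j x + θ x * v j x

section
variable {u v : Fin 3 → R3 → ℝ} {π θ : R3 → ℝ}

lemma Sol.en (h : Sol u v π θ) : Sm (En u v θ) := by
  unfold En
  exact ((Sm.sum fun i _ => (h.u i).mul (h.u i)).add (Sm.sum fun i _ => (h.v i).mul (h.v i))).add (h.t.mul h.t)
lemma Sol.uv (h : Sol u v π θ) : Sm (fun x => ∑ i, u i x * v i x) := Sm.sum fun i _ => (h.u i).mul (h.v i)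
lemma Sol.fl (h : Sol u v π θ) (j : Fin 3) : Sm (Fl u v θ j) := by
  unfold Fl
  exact (((h.en.cmul _).mul (h.u j)).add (h.uv.mul (h.v j))).add (h.t.mul (h.v j))
lemma Sol.dens (h : Sol u v π θ) : Sm (Dens u v θ) := by
  unfold Dens
  exact Sm.sum fun j _ => ((Sm.sum fun i _ => ((h.u i).pd j).pow 2).add (Sm.sum fun i _ => ((h.v i).pd j).pow 2)).add ((h.t.pd j).pow 2)

lemma pd_En (h : Sol u v π θ) (j : Fin 3) (x : R3) :
    pd (En u v θ) j x = 2 * ((∑ i, u i x * pd (u i) j x) + (∑ i, v i x * pd (v i) j x) + θ x * pd θ j x) := by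
  unfold En
  rw [pd_add ((Sm.sum fun i _ => (h.u i).mul (h.u i)).add (Sm.sum fun i _ => (h.v i).mul (h.v i))).diff (h.t.mul h.t).diff,
    pd_add (Sm.sum fun i _ => (h.u i).mul (h.u i)).diff (Sm.sum fun i _ => (h.v i).mul (h.v i)).diff,
    pd_sum fun i _ => ((h.u i).mul (h.u i)).diff, pd_sum fun i _ => ((h.v i).mul (h.v i)).diff, pd_mul h.t.diff h.t.diff]
  simp only [fun i => pd_mul (h.u i).diff (h.u i).diff j x, fun i => pd_mul (h.v i).diff (h.v i).diff j x, Fin.sum_univ_three]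
  ring

lemma lap_En (h : Sol u v π θ) (x : R3) :
    lap (En u v θ) x = 2 * ((∑ i, u i x * lap (u i) x) + (∑ i, v i x * lap (v i) x) + θ x * lap θ x + Dens u v θ x) := by
  have e : ∀ j, pd (En u v θ) j = fun x => 2 * ((∑ i, u i x * pd (u i) j x) + (∑ i, v i x * pd (v i) j x) + θ x * pd θ j x) :=
    fun j => funext fun x => pd_En h j x
  have su : ∀ j, Sm (fun x => ∑ i, u i x * pd (u i) j x) := fun j => Sm.sum fun i _ => (h.u i).mul ((h.u i).pd j)
  have sv : ∀ j, Sm (fun x => ∑ i, v i x * pd (v i) j x) := fun j => Sm.sum fun i _ => (h.v i).mul ((h.v i).pd j)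
  have st : ∀ j, Sm (fun x => θ x * pd θ j x) := fun j => h.t.mul (h.t.pd j)
  have e2 : ∀ j, pd (pd (En u v θ) j) j x = 2 * ((∑ i, (u i x * pd (pd (u i) j) j x + pd (u i) j x ^ 2)) + 
      (∑ i, (v i x * pd (pd (v i) j) j x + pd (v i) j x ^ 2)) + (θ x * pd (pd θ j) j x + pd θ j x ^ 2)) := by
    intro j
    rw [e, pd_cmul (((su j).add (sv j)).add (st j)).diff, pd_add ((su j).add (sv j)).diff (st j).diff, pd_add (su j).diff (sv j).diff,
      pd_sum fun i _ => ((h.u i).mul ((h.u i).pd j)).diff, pd_sum fun i _ => ((h.v i).mul ((h.v i).pd j)).diff,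
      pd_mul h.t.diff (h.t.pd j).diff]
    simp only [fun i => pd_mul (h.u i).diff ((h.u i).pd j).diff j x, fun i => pd_mul (h.v i).diff ((h.v i).pd j).diff j x, pow_two]
  unfold Dens
  simp only [lap, e2, Fin.sum_univ_three]
  ring

lemma pd_Fl (h : Sol u v π θ) (j : Fin 3) (x : R3) :
    pd (Fl u v θ j) j x = 1 / 2 * En u v θ x * pd (u j) j x + 
      ((∑ i, u i x * pd (u i) j x) + (∑ i, v i x * pd (v i) j x) + θ x * pd θ j x) * u j x
      + (∑ i, u i x * v i x) * pd (v j) j x + (∑ i, (u i x * pd (v i) j x + pd (u i) j x * v i x)) * v j x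
      + θ x * pd (v j) j x + pd θ j x * v j x := by
  unfold Fl
  rw [pd_add (((h.en.cmul _).mul (h.u j)).add (h.uv.mul (h.v j))).diff (h.t.mul (h.v j)).diff,
    pd_add ((h.en.cmul _).mul (h.u j)).diff (h.uv.mul (h.v j)).diff, pd_mul (h.en.cmul _).diff (h.u j).diff, pd_cmul h.en.diff, pd_En h,
    pd_mul h.uv.diff (h.v j).diff, pd_mul h.t.diff (h.v j).diff, pd_sum fun i _ => ((h.u i).mul (h.v i)).diff]
  simp only [fun i => pd_mul (h.u i).diff (h.v i).diff j x]
  ring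

lemma Sol.loc (h : Sol u v π θ) (x : R3) :
    Dens u v θ x = 1 / 2 * lap (En u v θ) x - ∑ j, (pd (Fl u v θ j) j x + pd π j x * u j x) := by
  rw [lap_En h]
  simp only [pd_Fl h]
  have a := fun i => h.e1 i x
  have b := fun i => h.e2 i x
  have c := h.e3 x
  have d := h.dv x
  simp only [fun i j => pd_mul (h.v j).diff (h.v i).diff j x, Fin.sum_univ_three] at a b c d ⊢
  linear_combination u 0 x * a 0 + u 1 x * a 1 + u 2 x * a 2 + v 0 x * b 0 + v 1 x * b 1 + v 2 x * b 2 + θ x * c + (1/2) * En u v θ x * d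

theorem Sol.energy (h : Sol u v π θ) {f : R3 → ℝ} (hf : Ts f) :
    ∫ x, Dens u v θ x * f x = (∫ x, (1 / 2 * (En u v θ x * lap f x) + ∑ j, Fl u v θ j x * pd f j x)) + ∫ x, π x * ∑ j, u j x * pd f j x := by
  have iL := intS h.en.lap hf
  have iL' := intS h.en hf.lap
  have iF := fun j => intS ((h.fl j).pd j) hf
  have iF' := fun j => intS (h.fl j) (hf.pd j)
  have iP := fun j => intS ((h.p.pd j).mul (h.u j)) hf
  have iP' := fun j => intS (h.p.mul (h.u j)) (hf.pd j)
  have iD := fun j => intS (h.p.mul ((h.u j).pd j)) hf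
  have ef : ∀ j, ∫ x, Fl u v θ j x * pd f j x = -∫ x, pd (Fl u v θ j) j x * f x := fun j => ibp (h.fl j) hf.sm hf.cs j
  have ep : ∀ j, ∫ x, π x * u j x * pd f j x = -(∫ x, pd π j x * u j x * f x) - ∫ x, π x * pd (u j) j x * f x := fun j => by
    rw [ibp (h.p.mul (h.u j)) hf.sm hf.cs j, sub_eq_add_neg, ← neg_add, ← intg_add2 (iP j) (iD j)]
    congr 2; funext x; rw [pd_mul h.p.diff (h.u j).diff]; ring
  have e0 : ∑ j, ∫ x, π x * pd (u j) j x * f x = 0 := by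
    rw [← integral_finsetSum _ (fun j _ => iD j), ← integral_zero R3 ℝ]
    congr 1; funext x
    rw [← Finset.sum_mul, ← Finset.mul_sum, h.dv]; ring
  have l : ∫ x, Dens u v θ x * f x = 1/2 * (∫ x, lap (En u v θ) x * f x) + ∑ j, (-(∫ x, pd (Fl u v θ j) j x * f x) + -(∫ x, pd π j x * u j x * f x)) := by
    have t : ∀ j, -(∫ x, pd (Fl u v θ j) j x * f x) + -(∫ x, pd π j x * u j x * f x) = ∫ x, (-1) * (pd (Fl u v θ j) j x * f x + pd π j x * u j x * f x) :=
      fun j => by rw [integral_const_mul, intg_add2 (iF j) (iP j)]; ring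
    have it : ∀ j, Integrable (fun x => (-1) * (pd (Fl u v θ j) j x * f x + pd π j x * u j x * f x)) := fun j => ((iF j).add (iP j)).const_mul _
    simp only [t]
    rw [← integral_finsetSum _ (fun j _ => it j), ← integral_const_mul, 
      ← intg_add2 (iL.const_mul _) (integrable_finsetSum _ fun j _ => it j)]
    congr 1; funext x
    rw [h.loc]
    simp only [Fin.sum_univ_three]; ring
  have r1 : (∫ x, (1 / 2 * (En u v θ x * lap f x) + ∑ j, Fl u v θ j x * pd f j x)) = 1/2 * (∫ x, En u v θ x * lap f x) + ∑ j, ∫ x, Fl u v θ j x * pd f j x := by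
    rw [intg_add2 (iL'.const_mul _) (integrable_finsetSum _ fun j _ => iF' j), integral_const_mul, integral_finsetSum _ (fun j _ => iF' j)]
  have r2 : ∫ x, π x * ∑ j, u j x * pd f j x = ∑ j, ∫ x, π x * u j x * pd f j x := by
    rw [← integral_finsetSum _ (fun j _ => iP' j)]
    congr 1; funext x; rw [Finset.mul_sum]; simp only [mul_assoc]
  rw [l, r1, r2, lap_adj h.en hf]
  simp only [Fin.sum_univ_three] at e0 ⊢
  simp only [ef, ep]; linarith

lemma Sol.ns (h : Sol u v π θ) : NSf 1 u v π where
  u := h.u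
  v := h.v
  p := h.p
  eq i x := by
    have a := h.e1 i x
    have d := h.dv x
    simp only [fun j => pd_add ((h.u i).mul (h.u j)).diff ((h.v i).mul (h.v j)).diff j x, 
      fun j => pd_mul (h.u i).diff (h.u j).diff j x, fun j => pd_mul (h.v i).diff (h.v j).diff j x,
      fun j => pd_mul (h.v j).diff (h.v i).diff j x, Fin.sum_univ_three] at a d ⊢
    linear_combination a + u i x * d
  dv := h.dv

end
end

open MeasureTheory Filter Metric
noncomputable section

def nn (U : Fin 3 → R3 → ℝ) (x : R3) : ℝ := √(∑ i, U i x ^ 2)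

section
variable {u v : Fin 3 → R3 → ℝ} {x : R3}
lemma nn_nonneg : 0 ≤ nn u x := Real.sqrt_nonneg _
lemma nn_sq : nn u x ^ 2 = ∑ i, u i x ^ 2 := Real.sq_sqrt (Finset.sum_nonneg fun i _ => sq_nonneg _)
lemma nn_cont (h : ∀ i, Sm (u i)) : Continuous (nn u) := (continuous_finsetSum _ fun i _ => ((h i).pow 2).cont).sqrt
lemma le_nn (i : Fin 3) : |u i x| ≤ nn u x := by
  refine Real.abs_le_sqrt ?_
  exact Finset.single_le_sum (f := fun i => u i x ^ 2) (fun i _ => sq_nonneg _) (Finset.mem_univ i)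
lemma dot_le : |∑ i, u i x * v i x| ≤ nn u x * nn v x := by
  refine abs_le_of_sq_le_sq ?_ (mul_nonneg nn_nonneg nn_nonneg)
  rw [mul_pow, nn_sq, nn_sq]; exact Finset.sum_mul_sq_le_sq_mul_sq _ _ _
lemma kk_eq : kk u v x = nn u x ^ 2 + nn v x ^ 2 := by
  unfold kk; rw [nn_sq, nn_sq, Finset.sum_add_distrib]
end

lemma ann_meas (R : ℝ) : MeasurableSet (annulus R) := measurableSet_ball.diff measurableSet_ball
lemma ann_sub (R : ℝ) : annulus R ⊆ closedBall 0 (2 * R) := fun _ hx => ball_subset_closedBall hx.1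
lemma ion {G : R3 → ℝ} (hG : Continuous G) (R : ℝ) : IntegrableOn G (annulus R) :=
  (hG.continuousOn.integrableOn_compact (isCompact_closedBall _ _)).mono_set (ann_sub R)

lemma bnd_ann {F G : R3 → ℝ} {R : ℝ} (h0 : ∀ x, x ∉ annulus R → F x = 0) (hG : Continuous G) (h : ∀ x ∈ annulus R, |F x| ≤ G x) :
    |∫ x, F x| ≤ ∫ x in annulus R, G x := by
  rw [← setIntegral_eq_integral_of_forall_compl_eq_zero h0]
  have := norm_integral_le_of_norm_le (f := F) (ion hG R) ((ae_restrict_iff' (ann_meas R)).2 (Eventually.of_forall h))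
  exact this

lemma ia {a b : R3 → ℝ} {R : ℝ} (ha : Continuous a) (hb : Continuous b) :
    ∫ x in annulus R, (a x + b x) = (∫ x in annulus R, a x) + ∫ x in annulus R, b x := intg_add2 (ion ha R) (ion hb R)

lemma vol_ann : ∃ C : ℝ, 0 ≤ C ∧ ∀ R : ℝ, 0 < R → ∀ c : ℝ, 0 ≤ c → ∫ _ in annulus R, c ≤ C * R ^ 3 * c := by
  refine ⟨volume.real (closedBall (0:R3) 2), measureReal_nonneg, fun R R0 c c0 => ?_⟩
  rw [setIntegral_const, smul_eq_mul]
  gcongr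
  have e : volume.real (closedBall (0:R3) (R * 2)) = R ^ 3 * volume.real (closedBall (0:R3) 2) := by
    unfold Measure.real
    rw [Measure.addHaar_closedBall_mul _ _ R0.le (by norm_num), ENNReal.toReal_mul, ENNReal.toReal_ofReal (by positivity)]
    simp [R3]
  calc _ ≤ volume.real (closedBall (0:R3) (R * 2)) := measureReal_mono (by rw [mul_comm R]; exact ann_sub R) (measure_closedBall_lt_top.ne)
    _ = _ := by rw [e]; ring

lemma yg : ∃ K : ℝ, 1 ≤ K ∧ ∀ {h : R3 → ℝ} {U R : ℝ}, (∀ x, 0 ≤ h x) → Continuous h → 0 < U → 0 < R → ∫ x in annulus R, h x ^ 3 ≤ U ^ 3 →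
    ∫ x in annulus R, h x ≤ K * (U * R ^ 2) ∧ ∫ x in annulus R, h x ^ 2 ≤ K * (U ^ 2 * R) := by
  obtain ⟨C, C0, hC⟩ := vol_ann
  refine ⟨1 + C, by linarith, fun {h U R} h0 hc U0 R0 hU => ⟨?_, ?_⟩⟩
  · calc ∫ x in annulus R, h x ≤ ∫ x in annulus R, ((R^2/U^2) * h x ^ 3 + U / R) := by
          refine integral_mono (ion hc R) (ion (((hc.pow 3).const_mul _).add_const _) R) fun x => ?_
          have hx := h0 x
          have : 0 ≤ (R * h x + 2 * U) * (R * h x - U) ^ 2 := by positivity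
          have e : (R^2/U^2) * h x ^ 3 + U / R - h x = (R ^ 3 * h x ^ 3 + U ^ 3 - h x * U ^ 2 * R) / (U ^ 2 * R) := by field_simp
          have : 0 ≤ (R^2/U^2) * h x ^ 3 + U / R - h x := by
            rw [e]; apply div_nonneg _ (by positivity)
            nlinarith [mul_nonneg (mul_nonneg hx R0.le) (sq_nonneg U), pow_pos U0 3, pow_nonneg (mul_nonneg hx R0.le) 3]
          linarith
      _ = (R^2/U^2) * (∫ x in annulus R, h x ^ 3) + ∫ x in annulus R, U / R := by
          rw [ia (by fun_prop) (by fun_prop), integral_const_mul]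
      _ ≤ (R^2/U^2) * U ^ 3 + C * R ^ 3 * (U / R) := by gcongr; exact hC R R0 _ (by positivity)
      _ = _ := by field_simp
  · calc ∫ x in annulus R, h x ^ 2 ≤ ∫ x in annulus R, ((R/U) * h x ^ 3 + (U / R) ^ 2) := by
          refine integral_mono (ion (hc.pow 2) R) (ion (((hc.pow 3).const_mul _).add_const _) R) fun x => ?_
          have hx := h0 x
          have : 0 ≤ (R * h x + 2 * U) * (R * h x - U) ^ 2 := by positivity
          have e : (R/U) * h x ^ 3 + (U / R)^2 - h x ^ 2 = (R ^ 3 * h x ^ 3 + U ^ 3 - h x ^ 2 * U * R ^ 2) / (U * R ^ 2) := by field_simp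
          have : 0 ≤ (R/U) * h x ^ 3 + (U / R)^2 - h x ^ 2 := by
            rw [e]; apply div_nonneg _ (by positivity)
            have a : 0 ≤ (R * h x + U) * (R * h x - U) ^ 2 := by positivity
            nlinarith [mul_nonneg (mul_nonneg hx R0.le) (sq_nonneg U), mul_nonneg (sq_nonneg (R * h x)) U0.le]
          linarith
      _ = (R/U) * (∫ x in annulus R, h x ^ 3) + ∫ x in annulus R, (U / R) ^ 2 := by
          rw [ia (by fun_prop) (by fun_prop), integral_const_mul]
      _ ≤ (R/U) * U ^ 3 + C * R ^ 3 * (U / R) ^ 2 := by gcongr; exact hC R R0 _ (by positivity)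
      _ = _ := by field_simp

/-- `a b^2` by Young -/
lemma yab {a b m : ℝ} (ha : 0 ≤ a) (hb : 0 ≤ b) (hm : 0 < m) : a * b ^ 2 ≤ a ^ 3 / m ^ 2 + m * b ^ 3 := by
  have e : a ^ 3 / m ^ 2 + m * b ^ 3 - a * b ^ 2 = (a ^ 3 + (m * b) ^ 3 - a * (m * b) ^ 2) / m ^ 2 := by field_simp
  have : 0 ≤ a ^ 3 / m ^ 2 + m * b ^ 3 - a * b ^ 2 := by
    rw [e]; apply div_nonneg _ (by positivity)
    have c0 : 0 ≤ m * b := by positivity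
    have : 0 ≤ (a + m * b) * (a - m * b) ^ 2 := by positivity
    nlinarith [mul_nonneg (sq_nonneg a) c0]
  linarith

/-- the data of annulus norms -/
structure Dat (u v : Fin 3 → R3 → ℝ) (θ w : R3 → ℝ) (R U V : ℝ) : Prop where
  U0 : 0 < U
  V0 : 0 < V
  u3 : ∫ x in annulus R, nn u x ^ 3 ≤ U ^ 3
  v3 : ∫ x in annulus R, (w x ^ 3 * nn v x) ^ 3 ≤ V ^ 3

def Wf (v : Fin 3 → R3 → ℝ) (w : R3 → ℝ) (R : ℝ) : ℝ := ∫ x in annulus R, w x ^ 4 * nn v x ^ 2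
def Nf (v : Fin 3 → R3 → ℝ) (θ w : R3 → ℝ) (R : ℝ) : ℝ := ∫ x in annulus R, |θ x| * (w x ^ 2 * nn v x)
def Tf (θ : R3 → ℝ) (R : ℝ) : ℝ := ∫ x in annulus R, θ x ^ 2
def Sf (u : Fin 3 → R3 → ℝ) (θ : R3 → ℝ) (R : ℝ) : ℝ := ∫ x in annulus R, nn u x * θ x ^ 2

/-- main part of the flux estimate, pointwise on the shell -/
lemma flux_pt {u v : Fin 3 → R3 → ℝ} {θ f : R3 → ℝ} {x : R3} {D : ℝ} (h1 : ∀ j, |pd f j x| ≤ D) (h2 : ∀ i j, |pd (pd f j) i x| ≤ D ^ 2) :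
    |1 / 2 * (En u v θ x * lap f x) + ∑ j, Fl u v θ j x * pd f j x| ≤ 
      3 * D ^ 2 * (nn u x ^ 2 + nn v x ^ 2 + θ x ^ 2) + 3 * D * (nn u x ^ 3 + 2 * (nn u x * nn v x ^ 2) + nn u x * θ x ^ 2 + |θ x| * nn v x) := by
  have a0 := nn_nonneg (u := u) (x := x)
  have b0 := nn_nonneg (u := v) (x := x)
  have eE : En u v θ x = nn u x ^ 2 + nn v x ^ 2 + θ x ^ 2 := by unfold En; rw [nn_sq, nn_sq]; simp only [pow_two]
  have E0 : 0 ≤ En u v θ x := by rw [eE]; positivity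
  have hl : |lap f x| ≤ 3 * D ^ 2 := by
    unfold lap; simp only [Fin.sum_univ_three]
    refine (abs_add_three _ _ _).trans ?_
    linarith [h2 0 0, h2 1 1, h2 2 2]
  have hF : ∀ j, |Fl u v θ j x| ≤ nn u x ^ 3 + 2 * (nn u x * nn v x ^ 2) + nn u x * θ x ^ 2 + |θ x| * nn v x := by
    intro j
    unfold Fl
    refine (abs_add_three _ _ _).trans ?_
    rw [abs_mul, abs_mul, abs_mul, abs_mul, abs_of_nonneg E0, abs_of_pos (by norm_num : (0:ℝ) < 1/2)]
    have k1 : 1 / 2 * En u v θ x * |u j x| ≤ 1 / 2 * En u v θ x * nn u x := by gcongr; exact le_nn j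
    have k2 : |∑ i, u i x * v i x| * |v j x| ≤ (nn u x * nn v x) * nn v x := by gcongr; exact dot_le; exact le_nn j
    have k3 : |θ x| * |v j x| ≤ |θ x| * nn v x := by gcongr; exact le_nn j
    rw [eE] at k1 ⊢
    have p1 : 0 ≤ nn u x ^ 3 := by positivity
    have p2 : 0 ≤ nn u x * nn v x ^ 2 := by positivity
    have p3 : 0 ≤ nn u x * θ x ^ 2 := by positivity
    nlinarith
  set Q := nn u x ^ 3 + 2 * (nn u x * nn v x ^ 2) + nn u x * θ x ^ 2 + |θ x| * nn v x
  have hj : ∀ j, |Fl u v θ j x * pd f j x| ≤ Q * D := fun j => by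
    rw [abs_mul]; exact mul_le_mul (hF j) (h1 j) (abs_nonneg _) ((abs_nonneg _).trans (hF j))
  refine (abs_add_le _ _).trans ?_
  have s := (Finset.abs_sum_le_sum_abs (fun j => Fl u v θ j x * pd f j x) Finset.univ).trans (Finset.sum_le_sum fun j _ => hj j)
  have l : |1 / 2 * (En u v θ x * lap f x)| ≤ En u v θ x * (3 * D ^ 2) := by
    rw [abs_mul, abs_mul, abs_of_nonneg E0, abs_of_pos (by norm_num : (0:ℝ) < 1/2)]
    have : En u v θ x * |lap f x| ≤ En u v θ x * (3 * D ^ 2) := by gcongr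
    have := mul_nonneg E0 (abs_nonneg (lap f x))
    linarith
  rw [eE] at l
  simp only [Finset.sum_const, Finset.card_univ, Fintype.card_fin, nsmul_eq_mul] at s
  rw [eE]
  refine (add_le_add l s).trans (le_of_eq ?_)
  push_cast; ring

end

open MeasureTheory Filter Metric
noncomputable section

def Br (u v : Fin 3 → R3 → ℝ) (θ w : R3 → ℝ) (R U V : ℝ) : ℝ :=
  R⁻¹ * (U ^ 3 + U ^ 2 + U * V ^ 2) + R⁻¹ ^ 2 * (Wf v w R + Tf θ R) + R⁻¹ * (Nf v θ w R + Sf u θ R)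

lemma ann_nonneg {g : R3 → ℝ} (h : ∀ x, 0 ≤ g x) (R : ℝ) : 0 ≤ ∫ x in annulus R, g x := integral_nonneg h

section
variable {u v : Fin 3 → R3 → ℝ} {π θ f c w : R3 → ℝ} {C0 R s s' U V D : ℝ}

lemma shell_w (R0 : 0 < R) (ss : s < s') (hc : Cuts C0 R s s' f c w) {x : R3} (h1 : (s + (s' - s)/3) * R ≤ ‖x‖) (h2 : ‖x‖ ≤ (s + (s' - s)/2) * R) :
    x ∈ annulus R ∧ w x = 1 := by
  have d0 : 0 < s' - s := by linarith
  have := hc.cs x 0 h1 h2 (by rw [norm_zero]; positivity)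
  rw [add_zero] at this
  exact hc.cA x (by rw [this]; norm_num)

lemma flux_est (h : Sol u v π θ) (R0 : 0 < R) (ss : s < s') (hc : Cuts C0 R s s' f c w) (dd : Dat u v θ w R U V)
    (D0 : 0 ≤ D) (h1 : ∀ j x, |pd f j x| ≤ D) (h2 : ∀ i j x, |pd (pd f j) i x| ≤ D ^ 2) :
    ∫ x, (1 / 2 * (En u v θ x * lap f x) + ∑ j, Fl u v θ j x * pd f j x) ≤
    3 * D ^ 2 * ((∫ x in annulus R, nn u x ^ 2) + Wf v w R + Tf θ R) + 3 * D * (U ^ 3 + 4 * (U * V ^ 2) + Sf u θ R + Nf v θ w R) := by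
  have cu := nn_cont h.u
  have cv := nn_cont h.v
  have ct := h.t.cont
  have cw := hc.wt.sm.cont
  have U0 := dd.U0
  have V0 := dd.V0
  have m0 : 0 < U / V := by positivity
  have z : ∀ x, (¬ (x ∈ annulus R ∧ w x = 1)) → 1 / 2 * (En u v θ x * lap f x) + ∑ j, Fl u v θ j x * pd f j x = 0 := by
    intro x hx
    have z1 : ∀ j, pd f j x = 0 := fun j => by
      by_contra hh
      exact hx (shell_w R0 ss hc (hc.fs j x hh).1 (hc.fs j x hh).2)
    have z2 : ∀ j, pd (pd f j) j x = 0 := fun j => by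
      by_contra hh
      exact hx (shell_w R0 ss hc (hc.fss j j x hh).1 (hc.fss j j x hh).2)
    simp [lap, z1, z2]
  have key := bnd_ann (R := R) (F := fun x => 1 / 2 * (En u v θ x * lap f x) + ∑ j, Fl u v θ j x * pd f j x)
    (G := fun x => 3 * D ^ 2 * (nn u x ^ 2 + w x ^ 4 * nn v x ^ 2 + θ x ^ 2) + 3 * D * ((nn u x ^ 3 + 2 * (nn u x ^ 3 / (U/V) ^ 2 + (U/V) * (w x ^ 3 * nn v x) ^ 3)) + 
      nn u x * θ x ^ 2 + |θ x| * (w x ^ 2 * nn v x)))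
    (fun x hx => z x fun hh => hx hh.1) (by fun_prop) (fun x _ => by
      have a0 := nn_nonneg (u := u) (x := x)
      have b0 := nn_nonneg (u := v) (x := x)
      have w0 := hc.w0 x
      by_cases hx : x ∈ annulus R ∧ w x = 1
      · refine (flux_pt (h1 · x) (h2 · · x)).trans ?_
        have := yab a0 b0 m0
        rw [hx.2]; simp only [one_pow, one_mul]
        gcongr
      · simp only [z x hx, abs_zero]; positivity)
  refine (le_abs_self _).trans (key.trans ?_)
  have e : ∫ x in annulus R, (3 * D ^ 2 * (nn u x ^ 2 + w x ^ 4 * nn v x ^ 2 + θ x ^ 2) + 3 * D * ((nn u x ^ 3 + 2 * (nn u x ^ 3 / (U/V) ^ 2 + (U/V) * (w x ^ 3 * nn v x) ^ 3)) + 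
      nn u x * θ x ^ 2 + |θ x| * (w x ^ 2 * nn v x))) = 3 * D ^ 2 * ((∫ x in annulus R, nn u x ^ 2) + Wf v w R + Tf θ R) +
      3 * D * (((∫ x in annulus R, nn u x ^ 3) + 2 * ((∫ x in annulus R, nn u x ^ 3) / (U/V) ^ 2 + (U/V) * (∫ x in annulus R, (w x ^ 3 * nn v x) ^ 3))) + Sf u θ R + Nf v θ w R) := by
    unfold Wf Tf Sf Nf
    rw [ia (by fun_prop) (by fun_prop), integral_const_mul, integral_const_mul, ia (by fun_prop) (by fun_prop), ia (by fun_prop) (by fun_prop),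
      ia (by fun_prop) (by fun_prop), ia (by fun_prop) (by fun_prop), ia (by fun_prop) (by fun_prop), integral_const_mul, ia (by fun_prop) (by fun_prop), integral_const_mul,
      integral_div]
  rw [e]
  have e1 : U ^ 3 + 2 * (U ^ 3 / (U/V) ^ 2 + (U/V) * V ^ 3) = U ^ 3 + 4 * (U * V ^ 2) := by field_simp; ring
  rw [← e1]
  have := dd.u3
  have := dd.v3
  gcongr

set_option maxHeartbeats 1000000 in
lemma press_est : ∃ C : ℝ, 0 ≤ C ∧ ∀ {u v : Fin 3 → R3 → ℝ} {π θ f c w : R3 → ℝ} {C0 R s s' U V D : ℝ},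
    Sol u v π θ → 0 < R → 1 ≤ s → s < s' → s' ≤ 2 → Cuts C0 R s s' f c w → Dat u v θ w R U V → 0 < D → (∀ j x, |pd f j x| ≤ D) → 
    ∫ x, π x * ∑ j, u j x * pd f j x ≤ C * (D * (U ^ 3 + U * V ^ 2) + (s' - s)⁻¹ ^ 4 * (D * ((s' - s)⁻¹ * U ^ 2 + U ^ 3 + U * V ^ 2))) := by
  obtain ⟨Cp, Cp0, hp⟩ := pressure_sc
  obtain ⟨K, K1, yK⟩ := yg
  refine ⟨Cp * (24 + 13 * 216 * 54 * K ^ 2), by positivity, ?_⟩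
  intro u v π θ f c w C0 R s s' U V D h R0 s1 ss s2 hc dd D0 h1
  have U0 := dd.U0
  have V0 := dd.V0
  have cu := nn_cont h.u
  have cv := nn_cont h.v
  have cw := hc.wt.sm.cont
  set d := s' - s with hd
  have d0 : 0 < d := by linarith
  have l0 : 0 < d * R / 6 := by positivity
  have gT : Ts (fun x => ∑ j, u j x * pd f j x) := by
    simp only [Fin.sum_univ_three]
    have t := fun j => Ts.mull (h.u j) (hc.ft.pd j)
    exact ⟨((t 0).sm.add (t 1).sm).add (t 2).sm, ((t 0).cs.add (t 1).cs).add (t 2).cs⟩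
  have gz : ∀ x, x ∉ annulus R → ∑ j, u j x * pd f j x = 0 := by
    intro x hx
    refine Finset.sum_eq_zero fun j _ => ?_
    by_contra hh
    have := hc.fs j x (right_ne_zero_of_mul hh)
    exact hx (shell_w R0 ss hc this.1 this.2).1
  have gb : ∀ x, |∑ j, u j x * pd f j x| ≤ 3 * D * nn u x := by
    intro x
    have := (Finset.abs_sum_le_sum_abs (fun j => u j x * pd f j x) Finset.univ).trans (Finset.sum_le_sum fun j _ => 
      show |u j x * pd f j x| ≤ nn u x * D by rw [abs_mul]; exact mul_le_mul (le_nn j) (h1 j x) (abs_nonneg _) nn_nonneg)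
    simp only [Finset.sum_const, Finset.card_univ, Fintype.card_fin, nsmul_eq_mul] at this
    push_cast at this; linarith
  have yu := yK (fun x => nn_nonneg (u := u) (x := x)) cu U0 R0 dd.u3
  have yv := (yK (h := fun x => w x ^ 3 * nn v x) (fun x => mul_nonneg (pow_nonneg (hc.w0 x) 3) nn_nonneg) (by fun_prop) V0 R0 dd.v3).2
  have g1 : ∫ x, |∑ j, u j x * pd f j x| ≤ 3 * D * (K * (U * R ^ 2)) := by
    refine (le_abs_self _).trans ((bnd_ann (R := R) (G := fun x => 3 * D * nn u x) (fun x hx => by rw [gz x hx, abs_zero]) (by fun_prop) 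
      (fun x _ => by rw [abs_abs]; exact gb x)).trans ?_)
    rw [integral_const_mul]; gcongr; exact yu.1
  have g3 : ∫ x, |∑ j, u j x * pd f j x| ^ 3 ≤ (3 * D * U) ^ 3 := by
    refine (le_abs_self _).trans ((bnd_ann (R := R) (G := fun x => (3 * D) ^ 3 * nn u x ^ 3) (fun x hx => by rw [gz x hx, abs_zero]; norm_num) (by fun_prop) 
      (fun x _ => by rw [abs_pow, abs_abs, ← mul_pow]; exact pow_le_pow_left₀ (abs_nonneg _) (gb x) 3)).trans ?_)
    rw [integral_const_mul, mul_pow (3 * D)]; exact mul_le_mul_of_nonneg_left dd.u3 (by positivity)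
  have cz : ∀ x, x ∉ annulus R → c x = 0 := fun x hx => by
    by_contra hh
    exact hx (hc.cA x hh).1
  have c1 : ∑ i, (∫ x, c x * |u i x|) ≤ 3 * (K * (U * R ^ 2)) := by
    have : ∀ i, ∫ x, c x * |u i x| ≤ K * (U * R ^ 2) := fun i => 
      (le_abs_self _).trans ((bnd_ann (R := R) (G := nn u) (fun x hx => by rw [cz x hx, zero_mul]) (by fun_prop) 
      (fun x _ => by
        rw [abs_mul, abs_abs, abs_of_nonneg (hc.c0 x)]
        exact (mul_le_mul (hc.c1 x) (le_nn i) (abs_nonneg _) zero_le_one).trans (by rw [one_mul]))).trans yu.1)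
    simp only [Fin.sum_univ_three]; linarith [this 0, this 1, this 2]
  have c2 : ∫ x, c x * kk u v x ≤ K * ((U ^ 2 + V ^ 2) * R) := by
    refine (le_abs_self _).trans ((bnd_ann (R := R) (G := fun x => nn u x ^ 2 + (w x ^ 3 * nn v x) ^ 2) (fun x hx => by rw [cz x hx, zero_mul]) (by fun_prop) 
      (fun x _ => ?_)).trans ?_)
    · by_cases hx : c x = 0
      · rw [hx, zero_mul, abs_zero]; positivity
      · rw [abs_mul, abs_of_nonneg (hc.c0 x), abs_of_nonneg (kk_nonneg x), (hc.cA x hx).2, kk_eq, one_pow, one_mul]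
        exact mul_le_of_le_one_left (by positivity) (hc.c1 x)
    · rw [ia (by fun_prop) (by fun_prop)]; linarith [yu.2]
  have c3 : ∫ x, (c x * kk u v x) * √(c x * kk u v x) ≤ (2 * (U + V)) ^ 3 := by
    refine (le_abs_self _).trans ((bnd_ann (R := R) (G := fun x => 2 * (nn u x ^ 3 + (w x ^ 3 * nn v x) ^ 3)) (fun x hx => by rw [cz x hx, zero_mul, zero_mul]) (by fun_prop) 
      (fun x _ => ?_)).trans ?_)
    · have a0 := nn_nonneg (u := u) (x := x)
      have b0 := nn_nonneg (u := v) (x := x)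
      have w0 := hc.w0 x
      by_cases hx : c x = 0
      · rw [hx, zero_mul, zero_mul, abs_zero]; positivity
      · have k0 := kk_nonneg (U := u) (V := v) x
        rw [abs_of_nonneg (mul_nonneg (mul_nonneg (hc.c0 x) k0) (Real.sqrt_nonneg _)), (hc.cA x hx).2, one_pow, one_mul]
        have le : c x * kk u v x ≤ kk u v x := mul_le_of_le_one_left k0 (hc.c1 x)
        calc _ ≤ kk u v x * √(kk u v x) := by gcongr
          _ ≤ 2 * (nn u x ^ 2 * √(nn u x ^ 2) + nn v x ^ 2 * √(nn v x ^ 2)) := by rw [kk_eq]; exact sqrt3_add (by positivity) (by positivity)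
          _ = _ := by rw [Real.sqrt_sq a0, Real.sqrt_sq b0]; ring
    · rw [integral_const_mul, ia (by fun_prop) (by fun_prop)]
      have := dd.u3
      have := dd.v3
      have : 0 < U ^ 2 * V := by positivity
      have : 0 < V ^ 2 * U := by positivity
      nlinarith [pow_pos U0 3, pow_pos V0 3]
  have sR : 0 < (s + d / 3) * R := by positivity
  have P := hp (r1 := (s + d/3) * R) (r2 := (s + d/2)*R) (a := 3 * D * U) (b := 2 * (U + V)) l0 h.ns hc.ct hc.c0 hc.c1 gT ?_ sR (by gcongr; linarith) ?_ ?_ 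
    (by positivity) (by positivity) g3 c3
  · have r2 : 1 + (s + d/2)*R / (d * R / 6) ≤ 13 * d⁻¹ := by
      have : 1 + (s + d/2)*R / (d * R / 6) = (6 * s + 4 * d) * d⁻¹ := by field_simp; ring
      rw [this]; gcongr; linarith
    have gg : 0 ≤ ∫ x, |∑ j, u j x * pd f j x| := integral_nonneg fun x => abs_nonneg _
    have q0 : 0 ≤ ∑ i, (∫ x, c x * |u i x|) := Finset.sum_nonneg fun i _ => integral_nonneg fun x => mul_nonneg (hc.c0 x) (abs_nonneg _)
    have q1 : 0 ≤ ∫ x, c x * kk u v x := integral_nonneg fun x => mul_nonneg (hc.c0 x) (kk_nonneg x)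
    refine (le_abs_self _).trans (P.trans ?_)
    rw [mul_assoc Cp]
    refine mul_le_mul_of_nonneg_left ?_ Cp0
    have A1 : 3 * D * U * (2 * (U + V)) ^ 2 ≤ 24 * (D * (U ^ 3 + U * V ^ 2)) := by
      have : 0 ≤ D * U * (U - V) ^ 2 := by positivity
      nlinarith
    have A2 : (1 + (s + d/2)*R / (d * R / 6)) * (((d * R / 6) ^ 3)⁻¹ * ((d * R / 6)⁻¹ * ∑ i, (∫ x, c x * |u i x|) + ∫ x, c x * kk u v x) * ∫ x, |∑ j, u j x * pd f j x|)
        ≤ (13 * d⁻¹) * (((d * R / 6) ^ 3)⁻¹ * ((d * R / 6)⁻¹ * (3 * (K * (U * R ^ 2))) + K * ((U ^ 2 + V ^ 2) * R)) * (3 * D * (K * (U * R ^ 2)))) := by gcongr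
    have A3 : (13 * d⁻¹) * (((d * R / 6) ^ 3)⁻¹ * ((d * R / 6)⁻¹ * (3 * (K * (U * R ^ 2))) + K * ((U ^ 2 + V ^ 2) * R)) * (3 * D * (K * (U * R ^ 2))))
        = 13 * 216 * 3 * K ^ 2 * (d⁻¹ ^ 4 * (D * (18 * (d⁻¹ * U ^ 2) + U ^ 3 + U * V ^ 2))) := by field_simp; ring
    have A4 : 13 * 216 * 3 * K ^ 2 * (d⁻¹ ^ 4 * (D * (18 * (d⁻¹ * U ^ 2) + U ^ 3 + U * V ^ 2))) ≤ 
        13 * 216 * 3 * K ^ 2 * (d⁻¹ ^ 4 * (D * (18 * (d⁻¹ * U ^ 2 + U ^ 3 + U * V ^ 2)))) := by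
      gcongr
      have : 0 ≤ U ^ 3 + U * V ^ 2 := by positivity
      linarith
    have X0 : 0 ≤ D * (U ^ 3 + U * V ^ 2) := by positivity
    have X1 : 0 ≤ d⁻¹ ^ 4 * (D * (d⁻¹ * U ^ 2 + U ^ 3 + U * V ^ 2)) := by positivity
    have := A2.trans (A3.trans_le A4)
    have fin : ∀ M X Y : ℝ, 0 ≤ M → 0 ≤ X → 0 ≤ Y → 24 * X + M * Y ≤ (24 + M) * (X + Y) := fun M X Y m x y => by
      have := mul_nonneg m x
      linarith
    refine (add_le_add A1 this).trans (le_trans (le_of_eq ?_) (fin (13 * 216 * 54 * K ^ 2) _ _ (by positivity) X0 X1))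
    ring
  · rw [integral_finsetSum _ (fun j _ => intS (h.u j) (hc.ft.pd j))]
    simp only [fun j => ibp (h.u j) hc.ft.sm hc.ft.cs j]
    rw [Finset.sum_neg_distrib, ← integral_finsetSum _ (fun j _ => intS ((h.u j).pd j) hc.ft)]
    simp only [← Finset.sum_mul, h.dv, zero_mul, integral_zero, neg_zero]
  · intro x hx
    by_contra hh
    refine hx (Finset.sum_eq_zero fun j _ => ?_)
    by_contra h3
    exact hh (hc.fs j x (right_ne_zero_of_mul h3))
  · intro x y h1 h2 h3
    exact hc.cs x y h1 h2 (by rw [← hd]; linarith)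
end

theorem EE {C0 : ℝ} (hC0 : 0 < C0) : ∃ C : ℝ, 0 ≤ C ∧ ∀ {u v : Fin 3 → R3 → ℝ} {π θ f c w : R3 → ℝ} {R s s' U V : ℝ},
    Sol u v π θ → 0 < R → 1 ≤ s → s < s' → s' ≤ 2 → Cuts C0 R s s' f c w → Dat u v θ w R U V → 
    ∫ x, Dens u v θ x * f x ≤ C * (s' - s)⁻¹ ^ 6 * Br u v θ w R U V := by
  obtain ⟨C, Cn, hC⟩ := press_est
  obtain ⟨K, K1, yK⟩ := yg
  refine ⟨3 * (C0 + 1) ^ 2 * K + 12 * (C0 + 1) + 2 * C * (C0 + 1), by positivity, ?_⟩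
  intro u v π θ f c w R s s' U V h R0 s1 ss s2 hc dd
  have d0 : 0 < s' - s := by linarith
  have U0 := dd.U0
  have V0 := dd.V0
  set d := s' - s
  set D := (C0 + 1) / (d * R)
  have D0 : 0 < D := by positivity
  have h1 : ∀ j x, |pd f j x| ≤ D := fun j x => (hc.fd j x).trans (by simp only [D]; gcongr; linarith)
  have h2 : ∀ i j x, |pd (pd f j) i x| ≤ D ^ 2 := fun i j x => (hc.fdd i j x).trans (by
    simp only [D]; rw [div_pow]; gcongr; nlinarith)
  have k1 := flux_est h R0 ss hc dd D0.le h1 h2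
  have k2 := hC h R0 s1 ss s2 hc dd D0 h1
  rw [h.energy hc.ft]
  have W0 : 0 ≤ Wf v w R := ann_nonneg (fun x => by have := hc.w0 x; positivity) R
  have T0 : 0 ≤ Tf θ R := ann_nonneg (fun x => by positivity) R
  have N0 : 0 ≤ Nf v θ w R := ann_nonneg (fun x => by have := hc.w0 x; have := nn_nonneg (u := v) (x := x); positivity) R
  have S0 : 0 ≤ Sf u θ R := ann_nonneg (fun x => by have := nn_nonneg (u := u) (x := x); positivity) R
  have u2 := (yK (fun x => nn_nonneg (u := u) (x := x)) (nn_cont h.u) U0 R0 dd.u3).2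
  have e1 : 1 ≤ d⁻¹ := (one_le_inv₀ d0).2 (by linarith)
  have eD : D = (C0 + 1) * d⁻¹ * R⁻¹ := by simp only [D]; field_simp
  have E2 : d⁻¹ ^ 2 ≤ d⁻¹ ^ 6 := pow_le_pow_right₀ e1 (by norm_num)
  have E1 : d⁻¹ ≤ d⁻¹ ^ 6 := by simpa using pow_le_pow_right₀ e1 (show 1 ≤ 6 by norm_num)
  have B1 : R⁻¹ * U ^ 2 + R⁻¹ ^ 2 * (Wf v w R + Tf θ R) ≤ Br u v θ w R U V := by
    unfold Br
    have : 0 ≤ R⁻¹ * (U ^ 3 + U * V ^ 2) + R⁻¹ * (Nf v θ w R + Sf u θ R) := by positivity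
    linarith
  have B2 : R⁻¹ * (U ^ 3 + U * V ^ 2 + Sf u θ R + Nf v θ w R) ≤ Br u v θ w R U V := by
    unfold Br
    have : 0 ≤ R⁻¹ * U ^ 2 + R⁻¹ ^ 2 * (Wf v w R + Tf θ R) := by positivity
    linarith
  have B3 : R⁻¹ * (U ^ 2 + U ^ 3 + U * V ^ 2) ≤ Br u v θ w R U V := by
    unfold Br
    have : 0 ≤ R⁻¹ ^ 2 * (Wf v w R + Tf θ R) + R⁻¹ * (Nf v θ w R + Sf u θ R) := by positivity
    linarith
  have B0 : 0 ≤ Br u v θ w R U V := le_trans (by positivity) B3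
  set B := Br u v θ w R U V
  have P1 : 3 * D ^ 2 * ((∫ x in annulus R, nn u x ^ 2) + Wf v w R + Tf θ R) ≤ 3 * (C0 + 1) ^ 2 * K * (d⁻¹ ^ 6 * B) := by
    calc _ ≤ 3 * D ^ 2 * (K * (U ^ 2 * R) + K * Wf v w R + K * Tf θ R) := by
          gcongr
          · exact le_mul_of_one_le_left W0 K1
          · exact le_mul_of_one_le_left T0 K1
      _ = 3 * (C0 + 1) ^ 2 * K * (d⁻¹ ^ 2 * (R⁻¹ * U ^ 2 + R⁻¹ ^ 2 * (Wf v w R + Tf θ R))) := by rw [eD]; field_simp; ring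
      _ ≤ _ := by gcongr
  have P2 : 3 * D * (U ^ 3 + 4 * (U * V ^ 2) + Sf u θ R + Nf v θ w R) ≤ 12 * (C0 + 1) * (d⁻¹ ^ 6 * B) := by
    calc _ ≤ 3 * D * (4 * (U ^ 3 + U * V ^ 2 + Sf u θ R + Nf v θ w R)) := by
          gcongr
          have : 0 < U ^ 3 := by positivity
          linarith
      _ = 12 * (C0 + 1) * (d⁻¹ * (R⁻¹ * (U ^ 3 + U * V ^ 2 + Sf u θ R + Nf v θ w R))) := by rw [eD]; ring
      _ ≤ _ := by gcongr
  have P3 : C * (D * (U ^ 3 + U * V ^ 2) + d⁻¹ ^ 4 * (D * (d⁻¹ * U ^ 2 + U ^ 3 + U * V ^ 2))) ≤ 2 * C * (C0 + 1) * (d⁻¹ ^ 6 * B) := by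
    have Q1 : D * (U ^ 3 + U * V ^ 2) ≤ (C0 + 1) * (d⁻¹ ^ 6 * B) := by
      calc _ = (C0 + 1) * (d⁻¹ * (R⁻¹ * (U ^ 3 + U * V ^ 2))) := by rw [eD]; ring
        _ ≤ (C0 + 1) * (d⁻¹ * (R⁻¹ * (U ^ 2 + U ^ 3 + U * V ^ 2))) := by gcongr; nlinarith
        _ ≤ _ := by gcongr
    have Q2 : d⁻¹ ^ 4 * (D * (d⁻¹ * U ^ 2 + U ^ 3 + U * V ^ 2)) ≤ (C0 + 1) * (d⁻¹ ^ 6 * B) := by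
      calc _ ≤ d⁻¹ ^ 4 * (D * (d⁻¹ * U ^ 2 + d⁻¹ * U ^ 3 + d⁻¹ * (U * V ^ 2))) := by
            refine mul_le_mul_of_nonneg_left (mul_le_mul_of_nonneg_left ?_ D0.le) (by positivity)
            exact add_le_add (add_le_add le_rfl (le_mul_of_one_le_left (by positivity) e1)) (le_mul_of_one_le_left (by positivity) e1)
        _ = (C0 + 1) * (d⁻¹ ^ 6 * (R⁻¹ * (U ^ 2 + U ^ 3 + U * V ^ 2))) := by rw [eD]; ring
        _ ≤ _ := by gcongr
    calc _ ≤ C * ((C0 + 1) * (d⁻¹ ^ 6 * B) + (C0 + 1) * (d⁻¹ ^ 6 * B)) := by gcongr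
      _ = _ := by ring
  linarith

end

open MeasureTheory Filter Metric
noncomputable section

def gr (f : R3 → ℝ) (x : R3) : ℝ := ∑ j, pd f j x ^ 2
lemma gr_nonneg {f : R3 → ℝ} (x : R3) : 0 ≤ gr f x := Finset.sum_nonneg fun _ _ => sq_nonneg _
lemma gr_sm {f : R3 → ℝ} (h : Sm f) : Sm (gr f) := Sm.sum fun j _ => (h.pd j).pow 2

lemma fd_le (f : R3 → ℝ) (x : R3) : ‖fderiv ℝ f x‖ ≤ √(gr f x) := by
  refine ContinuousLinearMap.opNorm_le_bound _ (Real.sqrt_nonneg _) fun z => ?_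
  rw [fderiv_coord, Real.norm_eq_abs, mul_comm]
  refine abs_le_of_sq_le_sq ?_ (by positivity)
  rw [mul_pow, Real.sq_sqrt (gr_nonneg x), norm_sq_R3]
  exact Finset.sum_mul_sq_le_sq_mul_sq _ _ _

theorem sobolev : ∃ C : ℝ, 0 ≤ C ∧ ∀ {f : R3 → ℝ}, Ts f → ∫ x, f x ^ 6 ≤ C * (∫ x, gr f x) ^ 3 := by
  set S : NNReal := SNormLESNormFDerivOfEqConst ℝ (volume : Measure R3) 2
  refine ⟨(S : ℝ) ^ 6, by positivity, fun {f} hf => ?_⟩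
  have hfr : Module.finrank ℝ R3 = 3 := by simp [R3]
  have h1 := eLpNorm_le_eLpNorm_fderiv_of_eq (μ := (volume : Measure R3)) (u := f) (F := ℝ) (p := 2) (p' := 6) (hf.sm.of_le (by exact_mod_cast le_top)) hf.cs (by norm_num) (by rw [hfr]; norm_num)
    (by rw [hfr]; norm_num)
  have h2 : eLpNorm (fderiv ℝ f) 2 (volume : Measure R3) ≤ eLpNorm (fun x => √(gr f x)) 2 volume :=
    eLpNorm_mono fun x => (fd_le f x).trans (le_abs_self _)
  have gc : HasCompactSupport (gr f) := by
    refine hf.cs.fderiv (𝕜 := ℝ) |>.mono fun x hx => ?_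
    contrapose! hx
    simp only [Function.mem_support, not_not] at hx ⊢
    simp [gr, pd, hx]
  have m6 : MemLp f 6 volume := hf.sm.cont.memLp_of_hasCompactSupport hf.cs
  have m2 : MemLp (fun x => √(gr f x)) 2 volume := (gr_sm hf.sm).cont.sqrt.memLp_of_hasCompactSupport 
    (gc.comp_left (g := Real.sqrt) Real.sqrt_zero)
  rw [MemLp.eLpNorm_eq_integral_rpow_norm (by norm_num) (by norm_num) m2] at h2
  have h3 := h1.trans (mul_le_mul_right h2 _)
  rw [show ((6 : NNReal) : ENNReal) = (6 : ENNReal) by norm_num, MemLp.eLpNorm_eq_integral_rpow_norm (by norm_num) (by norm_num) m6] at h3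
  have i6 : 0 ≤ ∫ x, f x ^ 6 := integral_nonneg fun x => by positivity
  have ig : 0 ≤ ∫ x, gr f x := integral_nonneg fun x => gr_nonneg x
  have e6 : ∫ x, ‖f x‖ ^ (6 : ENNReal).toReal = ∫ x, f x ^ 6 := by
    congr 1; funext x
    rw [show (6 : ENNReal).toReal = ((6 : ℕ) : ℝ) by norm_num, Real.rpow_natCast, Real.norm_eq_abs, Even.pow_abs (by decide)]
  have e2 : ∫ x, ‖√(gr f x)‖ ^ (2 : ENNReal).toReal = ∫ x, gr f x := by
    congr 1; funext x
    rw [show (2 : ENNReal).toReal = ((2 : ℕ) : ℝ) by norm_num, Real.rpow_natCast, Real.norm_eq_abs, sq_abs, Real.sq_sqrt (gr_nonneg x)]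
  rw [e6, e2, ← ENNReal.ofReal_coe_nnreal, ← ENNReal.ofReal_mul (by positivity), ENNReal.ofReal_le_ofReal_iff (by positivity)] at h3
  have h4 := pow_le_pow_left₀ (by positivity) h3 6
  rw [mul_pow, ← Real.rpow_natCast, ← Real.rpow_natCast (_ ^ _) 6, ← Real.rpow_mul i6, ← Real.rpow_mul ig] at h4
  rw [show ((6 : ENNReal).toReal⁻¹ * (6:ℕ) : ℝ) = 1 by norm_num, show ((2 : ENNReal).toReal⁻¹ * (6:ℕ) : ℝ) = (3 : ℕ) by norm_num, Real.rpow_one, Real.rpow_natCast] at h4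
  exact h4

lemma hol {f g h : R3 → ℝ} {a b F G R : ℝ} (ha : 0 ≤ a) (hb : 0 ≤ b) (hab : a + b = 1) (cf : Continuous f) (cg : Continuous g) (ch : Continuous h)
    (f0 : ∀ x, 0 ≤ f x) (g0 : ∀ x, 0 ≤ g x) (F0 : 0 < F) (G0 : 0 < G) (hF : ∫ x in annulus R, f x ≤ F) (hG : ∫ x in annulus R, g x ≤ G)
    (hh : ∀ x ∈ annulus R, h x ≤ f x ^ a * g x ^ b) : ∫ x in annulus R, h x ≤ F ^ a * G ^ b := by
  calc ∫ x in annulus R, h x ≤ ∫ x in annulus R, (F ^ a * G ^ b) * ((a / F) * f x + (b / G) * g x) := by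
        refine setIntegral_mono_on (ion ch R) (ion (by fun_prop) R) (ann_meas R) fun x hx => (hh x hx).trans ?_
        have := Real.geom_mean_le_arith_mean2_weighted ha hb (div_nonneg (f0 x) F0.le) (div_nonneg (g0 x) G0.le) hab
        rw [Real.div_rpow (f0 x) F0.le, Real.div_rpow (g0 x) G0.le] at this
        have pF := Real.rpow_pos_of_pos F0 a
        have pG := Real.rpow_pos_of_pos G0 b
        calc f x ^ a * g x ^ b = (F ^ a * G ^ b) * (f x ^ a / F ^ a * (g x ^ b / G ^ b)) := by field_simp
          _ ≤ (F ^ a * G ^ b) * (a * (f x / F) + b * (g x / G)) := by gcongr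
          _ = _ := by ring
    _ = (F ^ a * G ^ b) * ((a / F) * (∫ x in annulus R, f x) + (b / G) * ∫ x in annulus R, g x) := by
        rw [integral_const_mul, ia (by fun_prop) (by fun_prop), integral_const_mul, integral_const_mul]
    _ ≤ (F ^ a * G ^ b) * ((a / F) * F + (b / G) * G) := by gcongr
    _ = _ := by rw [div_mul_cancel₀ _ F0.ne', div_mul_cancel₀ _ G0.ne', hab, mul_one]

end

open MeasureTheory Filter Metric
noncomputable section

section
variable {n w θ : R3 → ℝ} {q Q Y W T R : ℝ}

lemma W_hol (cn : Continuous n) (cw : Continuous w) (n0 : ∀ x, 0 ≤ n x) (w0 : ∀ x, 0 ≤ w x) (w1 : ∀ x, w x ≤ 1) (q1 : 1 ≤ q) (q2 : q < 2) 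
    (Q0 : 0 < Q) (Y0 : 0 < Y) (hQ : ∫ x in annulus R, n x ^ q ≤ Q) (hY : ∫ x in annulus R, (w x ^ 3 * n x) ^ 6 ≤ Y) :
    ∫ x in annulus R, w x ^ 4 * n x ^ 2 ≤ Q ^ (4 / (6 - q)) * Y ^ ((2 - q) / (6 - q)) := by
  have h6 : 0 < 6 - q := by linarith
  have ha : 0 ≤ 4 / (6 - q) := by positivity
  have hb : 0 ≤ (2 - q) / (6 - q) := div_nonneg (by linarith) h6.le
  refine hol ha hb (by field_simp; ring) (cn.rpow_const fun x => Or.inr (by linarith)) (by fun_prop) (by fun_prop) (fun x => Real.rpow_nonneg (n0 x) _)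
    (fun x => by have := n0 x; have := w0 x; positivity) Q0 Y0 hQ hY fun x _ => ?_
  have nx := n0 x
  have wx := w0 x
  have e : (n x ^ q) ^ (4 / (6 - q)) * ((w x ^ 3 * n x) ^ 6) ^ ((2 - q) / (6 - q)) = w x ^ (18 * ((2 - q) / (6 - q))) * n x ^ 2 := by
    rw [mul_pow, ← pow_mul, Real.mul_rpow (by positivity) (by positivity), ← Real.rpow_natCast (w x), ← Real.rpow_natCast (n x) 6, ← Real.rpow_mul wx, 
      ← Real.rpow_mul nx, ← Real.rpow_mul nx, mul_left_comm, ← Real.rpow_add_of_nonneg nx (by positivity) (by positivity), ← Real.rpow_natCast (n x) 2]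
    congr 2
    push_cast; field_simp; ring
  rw [e]
  gcongr
  rw [← Real.rpow_natCast (w x) 4]
  refine Real.rpow_le_rpow_of_exponent_ge' wx (w1 x) (by positivity) ?_
  rw [mul_div_assoc', div_le_iff₀ h6]; push_cast; nlinarith

lemma V_hol (cn : Continuous n) (cw : Continuous w) (n0 : ∀ x, 0 ≤ n x) (w0 : ∀ x, 0 ≤ w x) (w1 : ∀ x, w x ≤ 1) 
    (W0 : 0 < W) (Y0 : 0 < Y) (hW : ∫ x in annulus R, w x ^ 4 * n x ^ 2 ≤ W) (hY : ∫ x in annulus R, (w x ^ 3 * n x) ^ 6 ≤ Y) :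
    ∫ x in annulus R, (w x ^ 3 * n x) ^ 3 ≤ W ^ (3 / 4 : ℝ) * Y ^ (1 / 4 : ℝ) := by
  refine hol (by norm_num) (by norm_num) (by norm_num) (by fun_prop) (by fun_prop) (by fun_prop) (fun x => by have := n0 x; have := w0 x; positivity)
    (fun x => by have := n0 x; have := w0 x; positivity) W0 Y0 hW hY fun x _ => ?_
  have nx := n0 x
  have wx := w0 x
  have e : (w x ^ 4 * n x ^ 2) ^ (3 / 4 : ℝ) * ((w x ^ 3 * n x) ^ 6) ^ (1 / 4 : ℝ) = w x ^ (15 / 2 : ℝ) * n x ^ 3 := by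
    rw [mul_pow, ← pow_mul, Real.mul_rpow (by positivity) (by positivity), Real.mul_rpow (by positivity) (by positivity), ← Real.rpow_natCast (w x), 
      ← Real.rpow_natCast (n x) 6, ← Real.rpow_natCast (n x) 2, ← Real.rpow_natCast (w x) (3 * 6), ← Real.rpow_mul wx, ← Real.rpow_mul wx,
      ← Real.rpow_mul nx, ← Real.rpow_mul nx, mul_mul_mul_comm, ← Real.rpow_add_of_nonneg nx (by positivity) (by positivity), 
      ← Real.rpow_add_of_nonneg wx (by positivity) (by positivity), ← Real.rpow_natCast (n x) 3]
    norm_num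
  rw [e, mul_pow, ← pow_mul]
  gcongr
  rw [← Real.rpow_natCast (w x)]
  exact Real.rpow_le_rpow_of_exponent_ge' wx (w1 x) (by positivity) (by norm_num)

lemma N_hol (cn : Continuous n) (cw : Continuous w) (ct : Continuous θ) (n0 : ∀ x, 0 ≤ n x) (w0 : ∀ x, 0 ≤ w x)
    (W0 : 0 < W) (T0 : 0 < T) (hW : ∫ x in annulus R, w x ^ 4 * n x ^ 2 ≤ W) (hT : ∫ x in annulus R, θ x ^ 2 ≤ T) :
    ∫ x in annulus R, |θ x| * (w x ^ 2 * n x) ≤ √T * √W := by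
  rw [Real.sqrt_eq_rpow, Real.sqrt_eq_rpow]
  refine hol (by norm_num) (by norm_num) (by norm_num) (by fun_prop) (by fun_prop) (by fun_prop) (fun x => by positivity)
    (fun x => by have := n0 x; have := w0 x; positivity) T0 W0 hT hW fun x _ => ?_
  have nx := n0 x
  have wx := w0 x
  rw [← Real.sqrt_eq_rpow, ← Real.sqrt_eq_rpow, Real.sqrt_sq_eq_abs, show w x ^ 4 * n x ^ 2 = (w x ^ 2 * n x) ^ 2 by ring, Real.sqrt_sq (by positivity)]
end

lemma W_Y {v : Fin 3 → R3 → ℝ} {w : R3 → ℝ} {q e R K Y : ℝ} (hv : ∀ i, Sm (v i)) (cw : Continuous w) (w0 : ∀ x, 0 ≤ w x) (w1 : ∀ x, w x ≤ 1)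
    (q1 : 1 ≤ q) (q2 : q < 2) (R0 : 0 < R) (K1 : 1 ≤ K) (h2 : (∫ x in annulus R, nn v x ^ q) ^ (4 / (6 - q)) ≤ K * R ^ (2 * e))
    (Y0 : 0 < Y) (hY : ∫ x in annulus R, (w x ^ 3 * nn v x) ^ 6 ≤ Y) : Wf v w R ≤ 2 * K * R ^ (2 * e) * Y ^ ((2 - q) / (6 - q)) := by
  have cn := nn_cont hv
  have n0 : ∀ x, 0 ≤ nn v x := fun x => nn_nonneg
  have h6 : 0 < 6 - q := by linarith
  have ha : 0 < 4 / (6 - q) := by positivity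
  have Q0 : 0 ≤ ∫ x in annulus R, nn v x ^ q := ann_nonneg (fun x => Real.rpow_nonneg (n0 x) _) R
  have RE : 0 < R ^ (2 * e) := Real.rpow_pos_of_pos R0 _
  set Q := (2 * K * R ^ (2 * e)) ^ (4 / (6 - q))⁻¹ with hQ
  have Qp : 0 < Q := by positivity
  have QQ : Q ^ (4 / (6 - q)) = 2 * K * R ^ (2 * e) := by
    rw [hQ, ← Real.rpow_mul (by positivity), inv_mul_cancel₀ ha.ne', Real.rpow_one]
  have le : ∫ x in annulus R, nn v x ^ q ≤ Q := by
    rw [← Real.rpow_le_rpow_iff Q0 Qp.le ha, QQ]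
    refine h2.trans ?_
    nlinarith [mul_pos (lt_of_lt_of_le one_pos K1) RE]
  have := W_hol cn cw n0 w0 w1 q1 q2 Qp Y0 le hY
  rwa [QQ] at this

/-- the assembled bracket bound, `R = ρ^3` -/
lemma brk {u v : Fin 3 → R3 → ℝ} {θ w : R3 → ℝ} {q e K o z R : ℝ} (hv : ∀ i, Sm (v i)) (cw : Continuous w) (w0 : ∀ x, 0 ≤ w x) (w1 : ∀ x, w x ≤ 1)
    (q1 : 1 ≤ q) (q2 : q < 2) (e1 : e ≤ 2 / 3) (R1 : 1 ≤ R) (K1 : 1 ≤ K) (o0 : 0 < o) (z1 : 1 ≤ z)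
    (h1 : ∫ x in annulus R, nn u x ^ 3 ≤ o ^ 3 * R) (h2 : (∫ x in annulus R, nn v x ^ q) ^ (4 / (6 - q)) ≤ K * R ^ (2 * e))
    (hz : ∫ x in annulus R, (w x ^ 3 * nn v x) ^ 6 ≤ z ^ 15) :
    Wf v w R ≤ 2 * K * R ^ (2 * e) * z ^ 3 ∧ ∃ U V, Dat u v θ w R U V ∧ 
    Br u v θ w R U V ≤ o ^ 3 + o ^ 2 + 4 * K ^ 2 * o * z ^ 4 + 2 * K * R ^ (-(2 / 3) : ℝ) * z ^ 3 + R⁻¹ ^ 2 * Tf θ R + R⁻¹ * (Nf v θ w R + Sf u θ R) := by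
  have R0 : 0 < R := by linarith
  have z0 : 0 < z := by linarith
  have cn := nn_cont hv
  have n0 : ∀ x, 0 ≤ nn v x := fun x => nn_nonneg
  have h6 : 0 < 6 - q := by linarith
  have ha : 0 < 4 / (6 - q) := by positivity
  have Q0 : 0 ≤ ∫ x in annulus R, nn v x ^ q := ann_nonneg (fun x => Real.rpow_nonneg (n0 x) _) R
  have RE : 0 < R ^ (2 * e) := Real.rpow_pos_of_pos R0 _
  -- a positive upper bound for the q-integral
  have hb : (z ^ 15) ^ ((2 - q) / (6 - q)) ≤ z ^ 3 := by
    rw [← Real.rpow_natCast, ← Real.rpow_mul z0.le, ← Real.rpow_natCast z 3]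
    refine Real.rpow_le_rpow_of_exponent_le z1 ?_
    rw [mul_div_assoc', div_le_iff₀ h6]; push_cast; nlinarith
  have hW : Wf v w R ≤ 2 * K * R ^ (2 * e) * z ^ 3 :=
    (W_Y hv cw w0 w1 q1 q2 R0 K1 h2 (by positivity) hz).trans (mul_le_mul_of_nonneg_left hb (by positivity))
  refine ⟨hW, ?_⟩
  set ρ := R ^ (1 / 3 : ℝ) with hρ
  have ρ1 : 1 ≤ ρ := Real.one_le_rpow R1 (by norm_num)
  have ρ0 : 0 < ρ := by linarith
  have ρ3 : R = ρ ^ 3 := by rw [hρ, ← Real.rpow_natCast, ← Real.rpow_mul R0.le]; norm_num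
  have ρ4 : R ^ (2 * e) ≤ ρ ^ 4 := by
    rw [hρ, ← Real.rpow_natCast, ← Real.rpow_mul R0.le]
    refine Real.rpow_le_rpow_of_exponent_le R1 ?_
    push_cast; linarith
  have ρm : R ^ (-(2/3) : ℝ) = (ρ ^ 2)⁻¹ := by
    rw [Real.rpow_neg R0.le, hρ, ← Real.rpow_natCast, ← Real.rpow_mul R0.le]; norm_num
  have hW4 : Wf v w R ≤ 2 * K * ρ ^ 4 * z ^ 3 := hW.trans (by gcongr)
  have hV : ∫ x in annulus R, (w x ^ 3 * nn v x) ^ 3 ≤ (2 * K * ρ * z ^ 2) ^ 3 := by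
    have K4 : 2 * K ≤ (2 * K) ^ 4 := by
      have : 1 ≤ 2 * K := by linarith
      simpa using pow_le_pow_right₀ this (show 1 ≤ 4 by norm_num)
    have := V_hol (R := R) cn cw n0 w0 w1 (W := (2 * K) ^ 4 * ρ ^ 4 * z ^ 3) (Y := z ^ 15) (by positivity) (by positivity) (hW4.trans (by gcongr)) hz
    refine this.trans (le_of_eq ?_)
    rw [show (2 * K) ^ 4 * ρ ^ 4 * z ^ 3 = (2 * K * ρ) ^ (4:ℝ) * z ^ (3:ℝ) by norm_cast; ring, Real.mul_rpow (by positivity) (by positivity), ← Real.rpow_natCast z 15,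
      ← Real.rpow_mul (by positivity), ← Real.rpow_mul z0.le, ← Real.rpow_mul z0.le, mul_assoc, ← Real.rpow_add z0,
      mul_pow (2 * K * ρ), ← pow_mul, ← Real.rpow_natCast, ← Real.rpow_natCast z]
    norm_num
  refine ⟨o * ρ, 2 * K * ρ * z ^ 2, ⟨by positivity, by positivity, by rw [mul_pow, ← ρ3]; exact h1, hV⟩, ?_⟩
  unfold Br
  have A1 : R⁻¹ * ((o * ρ) ^ 3 + (o * ρ) ^ 2 + o * ρ * (2 * K * ρ * z ^ 2) ^ 2) ≤ o ^ 3 + o ^ 2 + 4 * K ^ 2 * o * z ^ 4 := by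
    have : R⁻¹ * ((o * ρ) ^ 3 + (o * ρ) ^ 2 + o * ρ * (2 * K * ρ * z ^ 2) ^ 2) = o ^ 3 + o ^ 2 * ρ⁻¹ + 4 * K ^ 2 * o * z ^ 4 := by
      rw [ρ3]; field_simp; ring
    rw [this]
    have : o ^ 2 * ρ⁻¹ ≤ o ^ 2 * 1 := by gcongr; exact inv_le_one_of_one_le₀ ρ1
    linarith
  have A2 : R⁻¹ ^ 2 * Wf v w R ≤ 2 * K * R ^ (-(2 / 3) : ℝ) * z ^ 3 := by
    calc _ ≤ R⁻¹ ^ 2 * (2 * K * ρ ^ 4 * z ^ 3) := by gcongr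
      _ = _ := by rw [ρm, ρ3]; field_simp
  rw [mul_add (R⁻¹ ^ 2)]
  linarith

end

open MeasureTheory Filter Metric
noncomputable section

lemma pd_cub {w g : R3 → ℝ} (hw : Sm w) (hg : Sm g) (j : Fin 3) (x : R3) :
    pd (fun y => w y ^ 3 * g y) j x = w x ^ 3 * pd g j x + 3 * w x ^ 2 * pd w j x * g x := by
  have e : (fun y => w y ^ 3) = fun y => w y * (w y * w y) := by funext y; ring
  rw [pd_mul (hw.pow 3).diff hg.diff, e, pd_mul hw.diff (hw.mul hw).diff, pd_mul hw.diff hw.diff]; ring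

lemma sobC : ∃ C : ℝ, 0 ≤ C ∧ ∀ {C0 R s s' : ℝ} {f c w g : R3 → ℝ}, Sm g → Cuts C0 R s s' f c w →
    ∫ x, (w x ^ 3 * g x) ^ 6 ≤ C * ((∫ x in ball 0 (s' * R), gr g x) + (C0 / ((s' - s) * R)) ^ 2 * ∫ x in annulus R, w x ^ 4 * g x ^ 2) ^ 3 := by
  obtain ⟨S, S0, hS⟩ := sobolev
  refine ⟨S * 54 ^ 3, by positivity, fun {C0 R s s' f c w g} hg h => ?_⟩
  set D := C0 / ((s' - s) * R)
  have ht : Ts (fun x => w x ^ 3 * g x) := by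
    have : Ts (fun x => w x * (w x ^ 2 * g x)) := h.wt.mulr ((h.wt.sm.pow 2).mul hg)
    convert this using 2; ring
  refine (hS ht).trans ?_
  rw [mul_assoc, ← mul_pow]
  refine mul_le_mul_of_nonneg_left (pow_le_pow_left₀ (integral_nonneg fun x => gr_nonneg x) ?_ 3) S0
  have i1 : IntegrableOn (gr g) (ball 0 (s' * R)) :=
    ((gr_sm hg).cont.continuousOn.integrableOn_compact (isCompact_closedBall 0 (s' * R))).mono_set ball_subset_closedBall
  have cw := h.wt.sm.cont
  have cg := hg.cont
  have i2 : IntegrableOn (fun x => w x ^ 4 * g x ^ 2) (annulus R) := ion (by fun_prop) R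
  have j1 := (integrable_indicator_iff measurableSet_ball).2 i1
  have j2 := (integrable_indicator_iff (ann_meas R)).2 i2
  have P : ∀ x, gr (fun y => w y ^ 3 * g y) x ≤ 54 * ((ball 0 (s' * R)).indicator (gr g) x + D ^ 2 * (annulus R).indicator (fun x => w x ^ 4 * g x ^ 2) x) := by
    intro x
    have a1 : w x ^ 6 * gr g x ≤ (ball 0 (s' * R)).indicator (gr g) x := by
      by_cases hx : x ∈ ball (0 : R3) (s' * R)
      · rw [Set.indicator_of_mem hx]
        exact mul_le_of_le_one_left (gr_nonneg x) (pow_le_one₀ (h.w0 x) (h.w1 x))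
      · have : w x = 0 := by
          by_contra hn; exact hx (by simpa using h.ws x hn)
        rw [Set.indicator_of_notMem hx, this]; simp
    have a2 : ∀ j, pd w j x ^ 2 * (w x ^ 4 * g x ^ 2) ≤ D ^ 2 * (annulus R).indicator (fun x => w x ^ 4 * g x ^ 2) x := by
      intro j
      by_cases hx : x ∈ annulus R
      · rw [Set.indicator_of_mem hx]
        have : pd w j x ^ 2 ≤ D ^ 2 := by rw [← sq_abs]; exact pow_le_pow_left₀ (abs_nonneg _) (h.wd j x) 2
        have := h.w0 x
        gcongr
      · have : pd w j x = 0 := by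
          by_contra hn; exact hx (h.wA j x hn)
        rw [Set.indicator_of_notMem hx, this]; simp
    have a3 : gr (fun y => w y ^ 3 * g y) x ≤ 2 * (w x ^ 6 * gr g x) + 18 * ∑ j, pd w j x ^ 2 * (w x ^ 4 * g x ^ 2) := by
      unfold gr
      rw [Finset.mul_sum, Finset.mul_sum, Finset.mul_sum, ← Finset.sum_add_distrib]
      refine Finset.sum_le_sum fun j _ => ?_
      rw [pd_cub h.wt.sm hg]
      nlinarith [sq_nonneg (w x ^ 3 * pd g j x - 3 * w x ^ 2 * pd w j x * g x)]
    have a4 := Finset.sum_le_sum fun (j : Fin 3) (_ : j ∈ Finset.univ) => a2 j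
    simp only [Finset.sum_const, Finset.card_univ, Fintype.card_fin, nsmul_eq_mul, Nat.cast_ofNat] at a4
    have : 0 ≤ (ball (0 : R3) (s' * R)).indicator (gr g) x := Set.indicator_nonneg (fun x _ => gr_nonneg x) _
    linarith
  calc ∫ x, gr (fun y => w y ^ 3 * g y) x ≤ ∫ x, 54 * ((ball 0 (s' * R)).indicator (gr g) x + D ^ 2 * (annulus R).indicator (fun x => w x ^ 4 * g x ^ 2) x) :=
        integral_mono_of_nonneg (Eventually.of_forall fun x => gr_nonneg x) ((j1.add (j2.const_mul _)).const_mul _) (Eventually.of_forall P)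
    _ = _ := by
        rw [integral_const_mul, integral_add j1 (j2.const_mul _), integral_const_mul, integral_indicator measurableSet_ball, integral_indicator (ann_meas R)]

lemma dens_nonneg {u v : Fin 3 → R3 → ℝ} {θ : R3 → ℝ} (x : R3) : 0 ≤ Dens u v θ x := Finset.sum_nonneg fun j _ => by positivity

lemma gr_v_le {u v : Fin 3 → R3 → ℝ} {θ : R3 → ℝ} (x : R3) : ∑ i, gr (v i) x ≤ Dens u v θ x := by
  unfold gr Dens
  rw [Finset.sum_comm]
  refine Finset.sum_le_sum fun j _ => ?_
  have : 0 ≤ ∑ i, pd (u i) j x ^ 2 := by positivity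
  nlinarith [sq_nonneg (pd θ j x)]

lemma gr_t_le {u v : Fin 3 → R3 → ℝ} {θ : R3 → ℝ} (x : R3) : gr θ x ≤ Dens u v θ x :=
  Finset.sum_le_sum fun j _ => le_add_of_nonneg_left (by positivity)

lemma ion_ball {G : R3 → ℝ} (hG : Continuous G) (R : ℝ) : IntegrableOn G (ball 0 R) :=
  (hG.continuousOn.integrableOn_compact (isCompact_closedBall 0 R)).mono_set ball_subset_closedBall

lemma sobV : ∃ C : ℝ, 0 ≤ C ∧ ∀ {C0 R s s' : ℝ} {u v : Fin 3 → R3 → ℝ} {π θ f c w : R3 → ℝ}, Sol u v π θ → Cuts C0 R s s' f c w →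
    ∫ x, (w x ^ 3 * nn v x) ^ 6 ≤ C * ((∫ x in ball 0 (s' * R), Dens u v θ x) + (C0 / ((s' - s) * R)) ^ 2 * Wf v w R) ^ 3 ∧
    ∫ x, (w x ^ 3 * θ x) ^ 6 ≤ C * ((∫ x in ball 0 (s' * R), Dens u v θ x) + (C0 / ((s' - s) * R)) ^ 2 * Tf θ R) ^ 3 := by
  obtain ⟨C, C0', hC⟩ := sobC
  refine ⟨27 * C, by positivity, fun {C0 R s s' u v π θ f c w} hs h => ⟨?_, ?_⟩⟩
  · set M := (∫ x in ball 0 (s' * R), Dens u v θ x) + (C0 / ((s' - s) * R)) ^ 2 * Wf v w R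
    have cw := h.wt.sm.cont
    have cv := fun i => (hs.v i).cont
    have hi : ∀ i, ∫ x, (w x ^ 3 * v i x) ^ 6 ≤ C * M ^ 3 := by
      intro i
      have p1 : ∀ x, gr (v i) x ≤ Dens u v θ x := fun x => (Finset.single_le_sum (fun i _ => gr_nonneg (f := v i) x) (Finset.mem_univ i)).trans (gr_v_le x)
      refine (hC (hs.v i) h).trans (mul_le_mul_of_nonneg_left (pow_le_pow_left₀ ?_ (add_le_add ?_ (mul_le_mul_of_nonneg_left ?_ (sq_nonneg _))) 3) C0')
      · exact add_nonneg (integral_nonneg fun x => gr_nonneg x) (mul_nonneg (sq_nonneg _) (ann_nonneg (fun x => by positivity) R))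
      · exact setIntegral_mono (ion_ball (gr_sm (hs.v i)).cont _) (ion_ball hs.dens.cont _) p1
      · have cn := nn_cont hs.v
        refine setIntegral_mono (ion (by fun_prop) _) (ion (by fun_prop) _) fun x => ?_
        have := pow_le_pow_left₀ (abs_nonneg _) (le_nn (u := v) (x := x) i) 2
        rw [sq_abs] at this
        exact mul_le_mul_of_nonneg_left this (by positivity)
    have ht : ∀ i, Integrable fun x => (w x ^ 3 * v i x) ^ 6 := fun i => by
      have : Ts (fun x => w x * (w x ^ 17 * v i x ^ 6)) := h.wt.mulr ((h.wt.sm.pow 17).mul ((hs.v i).pow 6))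
      exact this.int.congr (Eventually.of_forall fun x => by simp only; ring)
    calc ∫ x, (w x ^ 3 * nn v x) ^ 6 ≤ ∫ x, 9 * ∑ i, (w x ^ 3 * v i x) ^ 6 := by
          refine integral_mono_of_nonneg (Eventually.of_forall fun x => by positivity) ((integrable_finsetSum _ fun i _ => ht i).const_mul _) (Eventually.of_forall fun x => ?_)
          simp only
          have e : (w x ^ 3 * nn v x) ^ 6 = (w x ^ 6) ^ 3 * (nn v x ^ 2) ^ 3 := by ring
          rw [e, nn_sq, Fin.sum_univ_three, Fin.sum_univ_three]
          have k : ∀ a b c : ℝ, 0 ≤ a → 0 ≤ b → 0 ≤ c → (a + b + c) ^ 3 ≤ 9 * (a ^ 3 + b ^ 3 + c ^ 3) := fun a b c ha hb hc => by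
            nlinarith [mul_nonneg (add_nonneg ha hb) (sq_nonneg (a - b)), mul_nonneg (add_nonneg hc hb) (sq_nonneg (c - b)), mul_nonneg (add_nonneg ha hc) (sq_nonneg (a - c)),
              mul_nonneg ha (sq_nonneg (b - c)), mul_nonneg hb (sq_nonneg (a - c)), mul_nonneg hc (sq_nonneg (a - b))]
          have := mul_le_mul_of_nonneg_left (k _ _ _ (sq_nonneg (v 0 x)) (sq_nonneg (v 1 x)) (sq_nonneg (v 2 x))) (show 0 ≤ (w x ^ 6) ^ 3 by positivity)
          linarith
      _ = 9 * ∑ i, ∫ x, (w x ^ 3 * v i x) ^ 6 := by rw [integral_const_mul, integral_finsetSum _ fun i _ => ht i]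
      _ ≤ 9 * ∑ i : Fin 3, C * M ^ 3 := by gcongr with i; exact hi i
      _ = _ := by simp; ring
  · refine (hC hs.t h).trans ?_
    have ct := hs.t.cont
    have cw := h.wt.sm.cont
    have : 0 ≤ (∫ x in ball 0 (s' * R), gr θ x) + (C0 / ((s' - s) * R)) ^ 2 * ∫ x in annulus R, w x ^ 4 * θ x ^ 2 :=
      add_nonneg (integral_nonneg fun x => gr_nonneg x) (mul_nonneg (sq_nonneg _) (ann_nonneg (fun x => by positivity) R))
    refine mul_le_mul (by linarith) (pow_le_pow_left₀ this (add_le_add ?_ (mul_le_mul_of_nonneg_left ?_ (sq_nonneg _))) 3) (by positivity) (by positivity)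
    · exact setIntegral_mono (ion_ball (gr_sm hs.t).cont _) (ion_ball hs.dens.cont _) gr_t_le
    · refine setIntegral_mono (ion (by fun_prop) _) (ion (by fun_prop) _) fun x => ?_
      exact mul_le_of_le_one_left (sq_nonneg _) (pow_le_one₀ (h.w0 x) (h.w1 x))
end

open MeasureTheory Filter Metric
noncomputable section

lemma y5 {a z ε : ℝ} (ha : 0 ≤ a) (hz : 0 ≤ z) (he : 0 < ε) : a * z ^ 4 ≤ ε * z ^ 5 + a ^ 5 / ε ^ 4 := by
  rcases le_total a (ε * z) with h | h
  · have : a * z ^ 4 ≤ ε * z * z ^ 4 := by gcongr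
    have : 0 ≤ a ^ 5 / ε ^ 4 := by positivity
    nlinarith
  · have : z ≤ a / ε := by rw [le_div_iff₀ he]; linarith
    have : a * z ^ 4 ≤ a * (a / ε) ^ 4 := by gcongr
    have e : a * (a / ε) ^ 4 = a ^ 5 / ε ^ 4 := by field_simp
    have : 0 ≤ ε * z ^ 5 := by positivity
    linarith

lemma absorb {A B M d z F F' : ℝ} (hA : 0 ≤ A) (hB : 0 ≤ B) (hM : 1 ≤ M) (hd : 1 ≤ d) (hz : 0 ≤ z) 
    (h1 : F ≤ A * d ^ 6 * z ^ 4) (h2 : z ^ 5 ≤ M * (1 + F' + B * d ^ 2 * z ^ 4)) :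
    F ≤ F' / 2 + (1 + 8 * (M * B) ^ 5 + 256 * M ^ 4 * A ^ 5) * d ^ 30 := by
  have M0 : 0 < M := by linarith
  have y1 := y5 (a := A * d ^ 6) (z := z) (ε := 1 / (4 * M)) (by positivity) hz (by positivity)
  have y2 := y5 (a := M * B * d ^ 2) (z := z) (ε := 1 / 2) (by positivity) hz (by positivity)
  have e1 : (A * d ^ 6) ^ 5 / (1 / (4 * M)) ^ 4 = 256 * M ^ 4 * A ^ 5 * d ^ 30 := by field_simp; ring
  have e2 : (M * B * d ^ 2) ^ 5 / (1 / 2) ^ 4 = 16 * ((M * B) ^ 5 * d ^ 10) := by field_simp; ring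
  rw [e1] at y1
  rw [e2] at y2
  have h3 : z ^ 5 ≤ 2 * M * (1 + F') + 32 * ((M * B) ^ 5 * d ^ 10) := by nlinarith
  have h4 : 1 / (4 * M) * z ^ 5 ≤ 1 / (4 * M) * (2 * M * (1 + F') + 32 * ((M * B) ^ 5 * d ^ 10)) := by gcongr
  have e3 : 1 / (4 * M) * (2 * M * (1 + F') + 32 * ((M * B) ^ 5 * d ^ 10)) = (1 + F') / 2 + M⁻¹ * (8 * ((M * B) ^ 5 * d ^ 10)) := by field_simp; ring
  have h5 : M⁻¹ * (8 * ((M * B) ^ 5 * d ^ 10)) ≤ 8 * ((M * B) ^ 5 * d ^ 10) := mul_le_of_le_one_left (by positivity) (inv_le_one_of_one_le₀ hM)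
  have h6 : (M * B) ^ 5 * d ^ 10 ≤ (M * B) ^ 5 * d ^ 30 := by
    have := pow_le_pow_right₀ hd (show 10 ≤ 30 by norm_num)
    gcongr
  have h7 : 1 ≤ d ^ 30 := one_le_pow₀ hd
  nlinarith

lemma iter {F : ℝ → ℝ} {A B : ℝ} (hA : 0 ≤ A) (hB : ∀ s, s ≤ 2 → F s ≤ B) (B0 : 0 ≤ B)
    (h : ∀ s s', 1 ≤ s → s < s' → s' ≤ 2 → F s ≤ F s' / 2 + A * (s' - s)⁻¹ ^ 30) : F 1 ≤ 4 * (A * 100 ^ 30) := by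
  set A' := A * 100 ^ 30 with hA'
  have A0 : 0 ≤ A' := by positivity
  set S : ℕ → ℝ := fun k => 2 - (99 / 100) ^ k with hS
  have st : ∀ k, F (S k) ≤ F (S (k + 1)) / 2 + A' * (3 / 2) ^ k := by
    intro k
    have t0 : (0:ℝ) < (99 / 100) ^ k := by positivity
    have t1 : ((99:ℝ) / 100) ^ k ≤ 1 := pow_le_one₀ (by norm_num) (by norm_num)
    have e : S (k + 1) - S k = (99 / 100) ^ k / 100 := by simp only [hS, pow_succ]; ring
    have := h (S k) (S (k + 1)) (by simp only [hS]; linarith) (by linarith) (by simp only [hS, pow_succ]; linarith)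
    refine this.trans (add_le_add le_rfl ?_)
    rw [e, hA', mul_assoc]
    refine mul_le_mul_of_nonneg_left ?_ hA
    rw [inv_div, div_pow, div_eq_mul_inv]
    refine mul_le_mul_of_nonneg_left ?_ (by positivity)
    rw [← pow_mul, mul_comm, pow_mul, ← inv_pow]
    exact pow_le_pow_left₀ (by positivity) (by norm_num) k
  have g : ∀ k, F (S 0) ≤ 4 * A' + (F (S k) - 4 * A' * (3 / 2) ^ k) / 2 ^ k := by
    intro k
    induction k with
    | zero => simp
    | succ k ih =>
      refine ih.trans ?_
      rw [pow_succ 2 k, mul_comm (2 ^ k) (2:ℝ), ← div_div]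
      have := st k
      gcongr
      rw [pow_succ]; linarith
  have e : S 0 = 1 := by simp [hS]; norm_num
  rw [e] at g
  have g2 : ∀ k : ℕ, F 1 ≤ 4 * A' + B * (1 / 2) ^ k := fun k => by
    refine (g k).trans ?_
    rw [div_eq_mul_inv, one_div, inv_pow]
    have : F (S k) ≤ B := hB _ (by simp only [hS]; linarith [show (0:ℝ) < (99 / 100) ^ k by positivity])
    have : 0 ≤ A' * (3 / 2) ^ k := by positivity
    gcongr
    linarith
  have lim : Tendsto (fun k : ℕ => 4 * A' + B * (1 / 2 : ℝ) ^ k) atTop (nhds (4 * A' + B * 0)) :=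
    ((tendsto_pow_atTop_nhds_zero_of_lt_one (by norm_num) (by norm_num)).const_mul B).const_add _
  simpa using ge_of_tendsto' lim g2

structure Hy (u v : Fin 3 → R3 → ℝ) (θ : R3 → ℝ) (q e K R : ℝ) : Prop where
  q1 : 1 ≤ q
  q2 : q < 2
  e0 : 0 ≤ e
  e1 : e ≤ 2 / 3
  K1 : 1 ≤ K
  R1 : 1 ≤ R
  h1 : ∫ x in annulus R, nn u x ^ 3 ≤ K * R
  h2 : (∫ x in annulus R, nn v x ^ q) ^ (4 / (6 - q)) ≤ K * R ^ (2 * e)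
  h3 : Tf θ R ≤ K * R ^ (2 - 2 * e)
  h4 : Sf u θ R ≤ K * R

lemma Hy.W {u v : Fin 3 → R3 → ℝ} {θ : R3 → ℝ} {q e K R z W : ℝ} (H : Hy u v θ q e K R) (z1 : 1 ≤ z) (h : W ≤ 2 * K * R ^ (2 * e) * z ^ 3) :
    R⁻¹ ^ 2 * W ≤ 2 * K * z ^ 3 := by
  have R0 : 0 < R := by linarith [H.R1]
  have K0 : 0 < K := by linarith [H.K1]
  have z0 : 0 < z := by linarith
  have : R ^ (2 * e) ≤ R ^ 2 := by
    rw [← Real.rpow_natCast]; exact Real.rpow_le_rpow_of_exponent_le H.R1 (by push_cast; linarith [H.e1])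
  calc _ ≤ R⁻¹ ^ 2 * (2 * K * R ^ 2 * z ^ 3) := by
        have : 2 * K * R ^ (2 * e) * z ^ 3 ≤ 2 * K * R ^ 2 * z ^ 3 := by gcongr
        exact mul_le_mul_of_nonneg_left (h.trans this) (by positivity)
    _ = _ := by field_simp

lemma Hy.T {u v : Fin 3 → R3 → ℝ} {θ : R3 → ℝ} {q e K R : ℝ} (H : Hy u v θ q e K R) : R⁻¹ ^ 2 * Tf θ R ≤ K := by
  have R0 : 0 < R := by linarith [H.R1]
  have K0 : 0 < K := by linarith [H.K1]
  have : R ^ (2 - 2 * e) ≤ R ^ 2 := by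
    rw [← Real.rpow_natCast]; exact Real.rpow_le_rpow_of_exponent_le H.R1 (by push_cast; linarith [H.e0])
  calc _ ≤ R⁻¹ ^ 2 * (K * R ^ 2) := by
        have : K * R ^ (2 - 2 * e) ≤ K * R ^ 2 := by gcongr
        exact mul_le_mul_of_nonneg_left (H.h3.trans this) (by positivity)
    _ = _ := by field_simp

lemma Hy.N {u v : Fin 3 → R3 → ℝ} {π θ w : R3 → ℝ} {q e K R z : ℝ} (H : Hy u v θ q e K R) (hs : Sol u v π θ) (cw : Continuous w) (w0 : ∀ x, 0 ≤ w x)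
    (z0 : 0 < z) (hW : Wf v w R ≤ 2 * K * R ^ (2 * e) * z) : R⁻¹ * Nf v θ w R ≤ 2 * K * √z := by
  have R0 : 0 < R := by linarith [H.R1]
  have K0 : 0 < K := by linarith [H.K1]
  have := N_hol (nn_cont hs.v) cw hs.t.cont (fun x => nn_nonneg) w0 (by positivity) (by positivity) hW H.h3
  rw [← Real.sqrt_mul (by positivity)] at this
  have e1 : R ^ (2 - 2 * e) * R ^ (2 * e) = R ^ 2 := by
    rw [← Real.rpow_add R0, ← Real.rpow_natCast]; norm_num
  have e2 : K * R ^ (2 - 2 * e) * (2 * K * R ^ (2 * e) * z) = (K * R) ^ 2 * (2 * z) := by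
    rw [mul_pow, ← e1]; ring
  rw [e2, Real.sqrt_mul (by positivity), Real.sqrt_sq (by positivity), Real.sqrt_mul (by norm_num)] at this
  have s2 : √2 ≤ 2 := by rw [Real.sqrt_le_left (by norm_num)]; norm_num
  calc _ ≤ R⁻¹ * (K * R * (√2 * √z)) := mul_le_mul_of_nonneg_left this (by positivity)
    _ = √2 * K * √z := by field_simp
    _ ≤ _ := by gcongr

lemma zz {v : Fin 3 → R3 → ℝ} {w : R3 → ℝ} {Y : ℝ} (hv : ∀ i, Sm (v i)) (hw : Ts w) (hY : ∫ x, (w x ^ 3 * nn v x) ^ 6 ≤ Y) (R : ℝ) :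
    ∃ z : ℝ, 1 ≤ z ∧ z ^ 15 = 1 + Y ∧ ∫ x in annulus R, (w x ^ 3 * nn v x) ^ 6 ≤ z ^ 15 := by
  have Y0 : 0 ≤ Y := (integral_nonneg fun x => by positivity).trans hY
  have e : ((1 + Y) ^ (1 / 15 : ℝ)) ^ 15 = 1 + Y := by rw [← Real.rpow_natCast, ← Real.rpow_mul (by positivity)]; norm_num
  refine ⟨(1 + Y) ^ (1 / 15 : ℝ), Real.one_le_rpow (by linarith) (by norm_num), e, ?_⟩
  rw [e]
  have I : Integrable fun x => (w x ^ 3 * nn v x) ^ 6 := by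
    refine Continuous.integrable_of_hasCompactSupport ?_ ?_
    · have := nn_cont hv
      have := hw.sm.cont
      fun_prop
    · refine hw.cs.mono fun x hx => ?_
      contrapose! hx
      simp only [Function.mem_support, not_not] at hx ⊢
      simp [hx]
  have := setIntegral_le_integral (s := annulus R) I (Eventually.of_forall fun x => by positivity)
  linarith

theorem step {K : ℝ} (K1 : 1 ≤ K) : ∃ C : ℝ, 0 ≤ C ∧ ∀ {u v : Fin 3 → R3 → ℝ} {π θ : R3 → ℝ} {q e R : ℝ}, Sol u v π θ → Hy u v θ q e K R →
    ∀ s s', 1 ≤ s → s < s' → s' ≤ 2 → ∫ x in ball 0 (s * R), Dens u v θ x ≤ (∫ x in ball 0 (s' * R), Dens u v θ x) / 2 + C * (s' - s)⁻¹ ^ 30 := by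
  obtain ⟨C0, C0p, hcut⟩ := cuts
  obtain ⟨C1, C1p, hE⟩ := EE C0p
  obtain ⟨S, S0, hS⟩ := sobV
  have K0 : 0 < K := by linarith
  refine ⟨1 + 8 * ((1 + S) * (2 * K * C0 ^ 2)) ^ 5 + 256 * (1 + S) ^ 4 * (12 * C1 * K ^ 3) ^ 5, by positivity, fun {u v π θ q e R} hs H s s' s1 ss s2 => ?_⟩
  have R0 : 0 < R := by linarith [H.R1]
  obtain ⟨f, c, w, hc⟩ := hcut R s s' R0 s1 ss s2
  have dp : 0 < s' - s := by linarith
  have d1 : 1 ≤ (s' - s)⁻¹ := (one_le_inv₀ dp).2 (by linarith)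
  set d := (s' - s)⁻¹ with hd
  obtain ⟨z, z1, ze, hz⟩ := zz hs.v hc.wt le_rfl R
  have z0 : 0 < z := by linarith
  obtain ⟨hW, U, V, hD, hB⟩ := brk (u := u) (θ := θ) (o := K) hs.v hc.wt.sm.cont hc.w0 hc.w1 H.q1 H.q2 H.e1 H.R1 H.K1 K0 z1
    (H.h1.trans (mul_le_mul_of_nonneg_right (by simpa using pow_le_pow_right₀ K1 (show 1 ≤ 3 by norm_num)) R0.le)) H.h2 hz
  set F' := ∫ x in ball 0 (s' * R), Dens u v θ x
  have F'0 : 0 ≤ F' := integral_nonneg fun x => dens_nonneg x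
  have zp : ∀ k, k ≤ 4 → z ^ k ≤ z ^ 4 := fun k hk => pow_le_pow_right₀ z1 hk
  have z4 : 1 ≤ z ^ 4 := one_le_pow₀ z1
  refine absorb (by positivity) (by positivity) (by linarith) d1 z0.le ?_ ?_
  · have hN := H.N hs hc.wt.sm.cont hc.w0 (by positivity) hW
    have hsq : √(z ^ 3) ≤ z ^ 4 := by
      rw [Real.sqrt_le_left (by positivity), ← pow_mul]; exact pow_le_pow_right₀ z1 (by norm_num)
    have hT := H.T
    have hSf : R⁻¹ * Sf u θ R ≤ K := by
      rw [inv_mul_le_iff₀ R0, mul_comm]; exact H.h4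
    have hR : R ^ (-(2 / 3) : ℝ) ≤ 1 := Real.rpow_le_one_of_one_le_of_nonpos H.R1 (by norm_num)
    have b1 : 2 * K * R ^ (-(2 / 3) : ℝ) * z ^ 3 ≤ 2 * K * z ^ 4 := by
      have := Real.rpow_nonneg R0.le (-(2 / 3) : ℝ)
      calc _ ≤ 2 * K * 1 * z ^ 3 := by gcongr
        _ ≤ _ := by rw [mul_one]; gcongr 2 * K * ?_; exact zp 3 (by norm_num)
    have b2 : 2 * K * √(z ^ 3) ≤ 2 * K * z ^ 4 := by gcongr
    have k1 : K ≤ K ^ 3 := by simpa using pow_le_pow_right₀ K1 (show 1 ≤ 3 by norm_num)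
    have k2 : K ^ 2 ≤ K ^ 3 := pow_le_pow_right₀ K1 (by norm_num)
    have b3 : Br u v θ w R U V ≤ 12 * K ^ 3 * z ^ 4 := by
      have c1 : K ^ 3 * 1 ≤ K ^ 3 * z ^ 4 := by gcongr
      have c2 : K * z ^ 4 ≤ K ^ 3 * z ^ 4 := by gcongr
      have : 4 * K ^ 2 * K * z ^ 4 = 4 * (K ^ 3 * z ^ 4) := by ring
      rw [mul_add R⁻¹] at hB
      linarith
    have b4 := hE hs R0 s1 ss s2 hc hD
    have b5 : ∫ x in ball 0 (s * R), Dens u v θ x ≤ ∫ x, Dens u v θ x * f x := by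
      rw [← integral_indicator measurableSet_ball]
      refine integral_mono_of_nonneg (Eventually.of_forall fun x => Set.indicator_nonneg (fun x _ => dens_nonneg x) x) (intS hs.dens hc.ft) (Eventually.of_forall fun x => ?_)
      by_cases hx : x ∈ ball (0 : R3) (s * R)
      · simp only [Set.indicator_of_mem hx]
        rw [hc.f1 x (by simpa using (mem_ball_zero_iff.1 hx).le), mul_one]
      · simp only [Set.indicator_of_notMem hx]
        exact mul_nonneg (dens_nonneg x) (hc.f0 x)
    calc _ ≤ _ := b5.trans b4
      _ ≤ C1 * d ^ 6 * (12 * K ^ 3 * z ^ 4) := by gcongr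
      _ = _ := by ring
  · have hY := (hS hs hc).1
    have a1 : (C0 / ((s' - s) * R)) ^ 2 * Wf v w R ≤ 2 * K * C0 ^ 2 * d ^ 2 * z ^ 4 := by
      have e : (C0 / ((s' - s) * R)) ^ 2 * Wf v w R = C0 ^ 2 * d ^ 2 * (R⁻¹ ^ 2 * Wf v w R) := by rw [hd]; field_simp
      rw [e]
      calc _ ≤ C0 ^ 2 * d ^ 2 * (2 * K * z ^ 4) := by
            refine mul_le_mul_of_nonneg_left ((H.W z1 hW).trans ?_) (by positivity)
            exact mul_le_mul_of_nonneg_left (zp 3 (by norm_num)) (by positivity)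
        _ = _ := by ring
    set G := 2 * K * C0 ^ 2 * d ^ 2 * z ^ 4
    have G0 : 0 ≤ G := by positivity
    have W0 : 0 ≤ Wf v w R := ann_nonneg (fun x => by positivity) R
    have a2 : z ^ 15 ≤ 1 + S * (F' + G) ^ 3 := by
      rw [ze]
      have : S * (F' + (C0 / ((s' - s) * R)) ^ 2 * Wf v w R) ^ 3 ≤ S * (F' + G) ^ 3 := by gcongr
      linarith
    rw [← pow_le_pow_iff_left₀ (by positivity) (by positivity) (show 3 ≠ 0 by norm_num), ← pow_mul, mul_pow]
    refine a2.trans ?_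
    set X := F' + G with hX
    have X0 : 0 ≤ X := by positivity
    have e : 1 + F' + G = 1 + X := by ring
    rw [e]
    have p1 : 1 + X ^ 3 ≤ (1 + X) ^ 3 := by nlinarith [mul_nonneg X0 X0]
    have p2 : 1 + S ≤ (1 + S) ^ 3 := by simpa using pow_le_pow_right₀ (show 1 ≤ 1 + S by linarith) (show 1 ≤ 3 by norm_num)
    calc 1 + S * X ^ 3 ≤ (1 + S) * (1 + X ^ 3) := by nlinarith [pow_nonneg X0 3]
      _ ≤ _ := by gcongr

/-- uniform local energy bound -/
theorem ubound {K : ℝ} (K1 : 1 ≤ K) : ∃ C : ℝ, 0 ≤ C ∧ ∀ {u v : Fin 3 → R3 → ℝ} {π θ : R3 → ℝ} {q e R : ℝ}, Sol u v π θ → Hy u v θ q e K R →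
    ∫ x in ball 0 R, Dens u v θ x ≤ C := by
  obtain ⟨C, C0, h⟩ := step K1
  refine ⟨4 * (C * 100 ^ 30), by positivity, fun {u v π θ q e R} hs H => ?_⟩
  have := iter (F := fun s => ∫ x in ball 0 (s * R), Dens u v θ x) (B := ∫ x in ball 0 (2 * R), Dens u v θ x) C0 (fun s hs2 => ?_) 
    (integral_nonneg fun x => dens_nonneg x) (h hs H)
  · simpa using this
  · exact setIntegral_mono_set (ion_ball hs.dens.cont _) (Eventually.of_forall fun x => dens_nonneg x)
      (ball_subset_ball (mul_le_mul_of_nonneg_right hs2 (by linarith [H.R1]))).eventuallyLE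
end

open MeasureTheory Filter Metric
noncomputable section

lemma tail {g : R3 → ℝ} (hg : Integrable g) {Rs : ℕ → ℝ} (hR : Tendsto Rs atTop atTop) : Tendsto (fun j => ∫ x in annulus (Rs j), g x) atTop (nhds 0) := by
  have t1 := (aecover_ball (μ := (volume : Measure R3)) (x := 0) hR).integral_tendsto_of_countably_generated hg
  have t2 := (aecover_ball (μ := (volume : Measure R3)) (x := 0) (hR.const_mul_atTop (show (0:ℝ) < 2 by norm_num))).integral_tendsto_of_countably_generated hg
  have := t2.sub t1
  rw [sub_self] at this
  refine this.congr' ?_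
  filter_upwards [hR.eventually_ge_atTop 0] with j hj
  exact (setIntegral_sdiff measurableSet_ball hg.integrableOn (ball_subset_ball (by linarith))).symm

lemma vol_low : ∃ c : ℝ, 0 < c ∧ ∀ R : ℝ, 1 ≤ R → ∀ a : ℝ, 0 ≤ a → c * a * R ≤ ∫ _ in annulus R, a := by
  have hfr : Module.finrank ℝ R3 = 3 := by simp [R3]
  have hb : ∀ r : ℝ, 0 ≤ r → (volume : Measure R3).real (ball 0 r) = r ^ 3 * (volume : Measure R3).real (ball 0 1) := fun r hr => by
    rw [Measure.real, Measure.addHaar_ball _ _ hr, hfr, ENNReal.toReal_mul, ENNReal.toReal_ofReal (by positivity)]; rfl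
  have c0 : 0 < (volume : Measure R3).real (ball 0 1) := ENNReal.toReal_pos (measure_ball_pos _ _ one_pos).ne' measure_ball_lt_top.ne
  refine ⟨(volume : Measure R3).real (ball 0 1), c0, fun R hR a ha => ?_⟩
  rw [setIntegral_const, smul_eq_mul, annulus, measureReal_sdiff (ball_subset_ball (by linarith)) measurableSet_ball (by exact measure_ball_lt_top.ne), hb (2 * R) (by positivity), hb R (by positivity)]
  have : R ≤ 7 * R ^ 3 := by nlinarith [pow_le_pow_right₀ hR (show 1 ≤ 3 by norm_num)]
  nlinarith [mul_le_mul_of_nonneg_left this (mul_nonneg c0.le ha)]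

lemma locB {u v : Fin 3 → R3 → ℝ} {π θ : R3 → ℝ} {K : ℝ} (K1 : 1 ≤ K) (hs : Sol u v π θ) (hI : Integrable (Dens u v θ)) :
    ∃ C0 : ℝ, 0 < C0 ∧ ∃ Z : ℝ, 1 ≤ Z ∧ ∃ P : ℝ, ∀ {q e R : ℝ}, Hy u v θ q e K R → ∃ f c w, Cuts C0 R 1 2 f c w ∧
      ∫ x, (w x ^ 3 * nn v x) ^ 6 ≤ Z ^ 15 ∧ ∫ x, (w x ^ 3 * θ x) ^ 6 ≤ P := by
  obtain ⟨C0, C0p, hcut⟩ := cuts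
  obtain ⟨S, S0, hS⟩ := sobV
  have K0 : 0 < K := by linarith
  set I := ∫ x, Dens u v θ x
  have I0 : 0 ≤ I := integral_nonneg fun x => dens_nonneg x
  set Z := (1 + S) * (1 + I + C0 ^ 2 * (2 * K)) with hZ
  have Z1 : 1 ≤ Z := one_le_mul_of_one_le_of_one_le (by linarith) (by nlinarith [mul_pos (pow_pos C0p 2) K0])
  clear_value Z
  refine ⟨C0, C0p, Z, Z1, S * (I + C0 ^ 2 * K) ^ 3, fun {q e R} H => ?_⟩
  have R0 : 0 < R := by linarith [H.R1]
  obtain ⟨f, c, w, hc⟩ := hcut R 1 2 R0 le_rfl (by norm_num) le_rfl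
  have hF : ∫ x in ball 0 (2 * R), Dens u v θ x ≤ I := setIntegral_le_integral hI (Eventually.of_forall fun x => dens_nonneg x)
  have hF0 : 0 ≤ ∫ x in ball 0 (2 * R), Dens u v θ x := integral_nonneg fun x => dens_nonneg x
  have e : ∀ t, (C0 / ((2 - 1) * R)) ^ 2 * t = C0 ^ 2 * (R⁻¹ ^ 2 * t) := fun t => by field_simp; norm_num
  obtain ⟨h1, h2⟩ := hS hs hc
  rw [e] at h1 h2
  refine ⟨f, c, w, hc, ?_, ?_⟩
  · obtain ⟨z, z1, ze, hz⟩ := zz hs.v hc.wt le_rfl R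
    have z0 : 0 < z := by linarith
    have hW := (brk (u := u) (θ := θ) (o := K) hs.v hc.wt.sm.cont hc.w0 hc.w1 H.q1 H.q2 H.e1 H.R1 H.K1 K0 z1
      (H.h1.trans (mul_le_mul_of_nonneg_right (by simpa using pow_le_pow_right₀ K1 (show 1 ≤ 3 by norm_num)) R0.le)) H.h2 hz).1
    have a1 := H.W z1 hW
    have W0 : 0 ≤ R⁻¹ ^ 2 * Wf v w R := mul_nonneg (by positivity) (ann_nonneg (fun x => by positivity) R)
    set X := I + C0 ^ 2 * (2 * K * z ^ 3) with hX
    have X0 : 0 ≤ X := by positivity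
    have a2 : z ^ 15 ≤ 1 + S * X ^ 3 := by
      rw [ze]
      have : S * ((∫ x in ball 0 (2 * R), Dens u v θ x) + C0 ^ 2 * (R⁻¹ ^ 2 * Wf v w R)) ^ 3 ≤ S * X ^ 3 := by rw [hX]; gcongr
      linarith
    have p1 : 1 + X ^ 3 ≤ (1 + X) ^ 3 := by nlinarith [mul_nonneg X0 X0]
    have p2 : 1 + S ≤ (1 + S) ^ 3 := by simpa using pow_le_pow_right₀ (show 1 ≤ 1 + S by linarith) (show 1 ≤ 3 by norm_num)
    have a3 : (z ^ 5) ^ 3 ≤ ((1 + S) * (1 + X)) ^ 3 := by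
      rw [← pow_mul, mul_pow]
      calc z ^ (5 * 3) ≤ 1 + S * X ^ 3 := a2
        _ ≤ (1 + S) * (1 + X ^ 3) := by nlinarith [pow_nonneg X0 3]
        _ ≤ _ := by gcongr
    have a4 := le_of_pow_le_pow_left₀ (by norm_num) (by positivity) a3
    have z4 : 1 ≤ z ^ 4 := one_le_pow₀ z1
    have z34 : z ^ 3 ≤ z ^ 4 := pow_le_pow_right₀ z1 (by norm_num)
    have a5 : z ^ 4 * z ≤ z ^ 4 * Z := by
      calc z ^ 4 * z = z ^ 5 := by ring
        _ ≤ (1 + S) * (1 * z ^ 4 + (I * z ^ 4 + C0 ^ 2 * (2 * K * z ^ 4))) := by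
            refine a4.trans (mul_le_mul_of_nonneg_left (add_le_add (by linarith) (add_le_add (le_mul_of_one_le_right I0 z4) ?_)) (by linarith))
            gcongr
        _ = _ := by rw [hZ]; ring
    have a6 : z ≤ Z := le_of_mul_le_mul_left a5 (by positivity)
    refine le_trans ?_ (pow_le_pow_left₀ z0.le a6 15)
    rw [ze]
    exact le_add_of_nonneg_left one_pos.le
  · refine h2.trans ?_
    have T0 : 0 ≤ R⁻¹ ^ 2 * Tf θ R := mul_nonneg (by positivity) (ann_nonneg (fun x => by positivity) R)
    have := H.T
    gcongr

lemma int_of {g : R3 → ℝ} (hg : Continuous g) (g0 : ∀ x, 0 ≤ g x) {Rs : ℕ → ℝ} (hR : Tendsto Rs atTop atTop) {C : ℝ} 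
    (h : ∀ᶠ j in atTop, ∫ x in ball 0 (Rs j), g x ≤ C) : Integrable g :=
  (aecover_ball (μ := (volume : Measure R3)) (x := 0) hR).integrable_of_integral_bounded_of_nonneg_ae C (fun j => ion_ball hg _) (Eventually.of_forall g0) h

lemma ball_le {g w : R3 → ℝ} {C0 R s s' : ℝ} {f c : R3 → ℝ} (hc : Cuts C0 R s s' f c w) (R0 : 0 < R) (s1 : 1 ≤ s) (hg : Continuous g) :
    ∫ x in ball 0 R, g x ^ 6 ≤ ∫ x, (w x ^ 3 * g x) ^ 6 := by
  have I : Integrable fun x => (w x ^ 3 * g x) ^ 6 := by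
    refine Continuous.integrable_of_hasCompactSupport ?_ ?_
    · have := hc.wt.sm.cont
      fun_prop
    · refine hc.wt.cs.mono fun x hx => ?_
      contrapose! hx
      simp only [Function.mem_support, not_not] at hx ⊢
      simp [hx]
  refine le_trans (le_of_eq (setIntegral_congr_fun measurableSet_ball fun x hx => ?_)) (setIntegral_le_integral (s := ball 0 R) I (Eventually.of_forall fun x => by positivity))
  rw [hc.wb x ((mem_ball_zero_iff.1 hx).le.trans (by nlinarith))]; ring

lemma T_lim : ∃ C : ℝ, 0 ≤ C ∧ ∀ {θ : R3 → ℝ} {R Y : ℝ}, Continuous θ → 0 < R → 0 < Y → ∫ x in annulus R, θ x ^ 6 ≤ Y → R⁻¹ ^ 2 * Tf θ R ≤ C * Y ^ (1 / 3 : ℝ) := by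
  obtain ⟨C, C0, hC⟩ := vol_ann
  refine ⟨(C + 1) ^ (2 / 3 : ℝ), by positivity, fun {θ R Y} ct R0 Y0 h => ?_⟩
  have := hol (R := R) (f := fun x => θ x ^ 6) (g := fun _ => 1) (h := fun x => θ x ^ 2) (a := 1 / 3) (b := 2 / 3) (F := Y) (G := (C + 1) * R ^ (3:ℝ)) (by norm_num) (by norm_num) (by norm_num)
    (by fun_prop) (by fun_prop) (by fun_prop) (fun x => by positivity) (fun x => by norm_num) Y0 (by positivity) h
    ((hC R R0 1 (by norm_num)).trans (by norm_cast; have := pow_pos R0 3; linarith)) (fun x _ => by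
      rw [Real.one_rpow, mul_one, show θ x ^ 6 = (θ x ^ 2) ^ (3:ℝ) by norm_cast; ring, ← Real.rpow_mul (by positivity)]; norm_num)
  rw [Real.mul_rpow (by positivity) (by positivity), ← Real.rpow_mul R0.le, show (3 : ℝ) * (2 / 3) = (2 : ℕ) by norm_num, Real.rpow_natCast] at this
  calc _ ≤ R⁻¹ ^ 2 * _ := mul_le_mul_of_nonneg_left this (by positivity)
    _ = _ := by field_simp

set_option maxHeartbeats 1000000 in
/-- the total energy vanishes -/
theorem dens_zero {u v : Fin 3 → R3 → ℝ} {π θ : R3 → ℝ} {K q e : ℝ} {Rs : ℕ → ℝ} (hs : Sol u v π θ) (hR : Tendsto Rs atTop atTop)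
    (H : ∀ᶠ j in atTop, Hy u v θ q e K (Rs j)) (hu : Tendsto (fun j => (Rs j)⁻¹ * ∫ x in annulus (Rs j), nn u x ^ 3) atTop (nhds 0))
    (hS : Tendsto (fun j => (Rs j)⁻¹ * Sf u θ (Rs j)) atTop (nhds 0)) : 
    (∀ x, Dens u v θ x = 0) ∧ (Integrable fun x => nn v x ^ 6) ∧ Integrable fun x => θ x ^ 6 := by
  obtain ⟨j0, H0⟩ := H.exists
  have K1 := H0.K1
  have q1 := H0.q1
  have q2 := H0.q2
  have K0 : 0 < K := by linarith
  have cn := nn_cont hs.v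
  have ct := hs.t.cont
  obtain ⟨C, C0, hC⟩ := ubound K1
  have hI : Integrable (Dens u v θ) := int_of hs.dens.cont dens_nonneg hR (H.mono fun j h => hC hs h)
  obtain ⟨Cc, Cc0, Z, Z1, P, hL⟩ := locB K1 hs hI
  obtain ⟨C1, C1p, hE⟩ := EE Cc0
  obtain ⟨CT, CT0, hT⟩ := T_lim
  have Iv : Integrable fun x => nn v x ^ 6 := by
    refine int_of (C := Z ^ 15) (by fun_prop) (fun x => by positivity) hR (H.mono fun j h => ?_)
    obtain ⟨f, c, w, hc, h1, h2⟩ := hL h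
    exact (ball_le hc (by linarith [h.R1]) le_rfl cn).trans h1
  have It : Integrable fun x => θ x ^ 6 := by
    refine int_of (C := P) (by fun_prop) (fun x => by positivity) hR (H.mono fun j h => ?_)
    obtain ⟨f, c, w, hc, h1, h2⟩ := hL h
    exact (ball_le hc (by linarith [h.R1]) le_rfl ct).trans h2
  refine ⟨?_, Iv, It⟩
  have iR : Tendsto (fun j => (Rs j)⁻¹) atTop (nhds 0) := tendsto_inv_atTop_zero.comp hR
  have tv := (tail Iv hR).add iR
  have tt := (tail It hR).add iR
  rw [add_zero] at tv tt
  have b0 : 0 < (2 - q) / (6 - q) := div_pos (by linarith) (by linarith)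
  have tv' : Tendsto (fun j => 2 * K * √(((∫ x in annulus (Rs j), nn v x ^ 6) + (Rs j)⁻¹) ^ ((2 - q) / (6 - q)))) atTop (nhds 0) := by
    have := ((tv.rpow_const (p := (2 - q) / (6 - q)) (Or.inr b0.le)).sqrt).const_mul (2 * K)
    rwa [Real.zero_rpow b0.ne', Real.sqrt_zero, mul_zero] at this
  have tt' : Tendsto (fun j => CT * ((∫ x in annulus (Rs j), θ x ^ 6) + (Rs j)⁻¹) ^ (1 / 3 : ℝ)) atTop (nhds 0) := by
    have := (tt.rpow_const (p := 1 / 3) (Or.inr (by norm_num))).const_mul CT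
    rwa [Real.zero_rpow (by norm_num), mul_zero] at this
  have tr : Tendsto (fun j => 2 * K * (Rs j) ^ (-(2 / 3) : ℝ) * Z ^ 3) atTop (nhds 0) := by
    have := (((tendsto_rpow_neg_atTop (show (0:ℝ) < 2 / 3 by norm_num)).comp hR).const_mul (2 * K)).mul_const (Z ^ 3)
    simpa using this
  set τ : ℕ → ℝ := fun j => 2 * K * (Rs j) ^ (-(2 / 3) : ℝ) * Z ^ 3 + CT * ((∫ x in annulus (Rs j), θ x ^ 6) + (Rs j)⁻¹) ^ (1 / 3 : ℝ) +
    2 * K * √(((∫ x in annulus (Rs j), nn v x ^ 6) + (Rs j)⁻¹) ^ ((2 - q) / (6 - q))) + (Rs j)⁻¹ * Sf u θ (Rs j) with hτ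
  have tτ : Tendsto τ atTop (nhds 0) := by
    have := ((tr.add tt').add tv').add hS
    rwa [add_zero, add_zero, add_zero] at this
  set I := ∫ x, Dens u v θ x
  have lim := (aecover_ball (μ := (volume : Measure R3)) (x := 0) hR).integral_tendsto_of_countably_generated hI
  have key : ∀ o : ℝ, 0 < o → I ≤ C1 * (o ^ 3 + o ^ 2 + 4 * K ^ 2 * o * Z ^ 4) := by
    intro o o0
    have l2 := (tτ.const_add (o ^ 3 + o ^ 2 + 4 * K ^ 2 * o * Z ^ 4)).const_mul C1
    rw [add_zero] at l2
    refine le_of_tendsto_of_tendsto lim l2 ?_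
    filter_upwards [H, hu.eventually_lt_const (show 0 < o ^ 3 by positivity)] with j h hj
    have R0 : 0 < Rs j := by linarith [h.R1]
    obtain ⟨f, c, w, hc, h1, h2⟩ := hL h
    have cw := hc.wt.sm.cont
    have I6 : ∫ x in annulus (Rs j), (w x ^ 3 * nn v x) ^ 6 ≤ ∫ x in annulus (Rs j), nn v x ^ 6 := by
      refine setIntegral_mono (ion (by fun_prop) _) (ion (by fun_prop) _) fun x => ?_
      exact pow_le_pow_left₀ (mul_nonneg (pow_nonneg (hc.w0 x) 3) nn_nonneg) (mul_le_of_le_one_left nn_nonneg (pow_le_one₀ (hc.w0 x) (hc.w1 x))) 6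
    have iRp : 0 < (Rs j)⁻¹ := by positivity
    have hz' : ∫ x in annulus (Rs j), (w x ^ 3 * nn v x) ^ 6 ≤ Z ^ 15 := by
      refine le_trans (setIntegral_le_integral ?_ (Eventually.of_forall fun x => by positivity)) h1
      refine Continuous.integrable_of_hasCompactSupport (by fun_prop) (hc.wt.cs.mono fun x hx => ?_)
      contrapose! hx
      simp only [Function.mem_support, not_not] at hx ⊢
      simp [hx]
    obtain ⟨-, U, V, hD, hB⟩ := brk (u := u) (θ := θ) (o := o) hs.v cw hc.w0 hc.w1 q1 q2 h.e1 h.R1 K1 o0 Z1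
      (by rw [inv_mul_lt_iff₀ R0] at hj; linarith) h.h2 hz'
    have v0 : 0 ≤ ∫ x in annulus (Rs j), nn v x ^ 6 := ann_nonneg (fun x => by positivity) _
    have t0 : 0 ≤ ∫ x in annulus (Rs j), θ x ^ 6 := ann_nonneg (fun x => by positivity) _
    have hW := W_Y hs.v cw hc.w0 hc.w1 q1 q2 R0 K1 h.h2 (Y := (∫ x in annulus (Rs j), nn v x ^ 6) + (Rs j)⁻¹) (by positivity) (by linarith)
    have hN := h.N hs cw hc.w0 (by positivity) hW
    have hTT := hT ct R0 (Y := (∫ x in annulus (Rs j), θ x ^ 6) + (Rs j)⁻¹) (by positivity) (by linarith)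
    have b4 := hE hs R0 le_rfl (by norm_num) le_rfl hc hD
    have b5 : ∫ x in ball 0 (Rs j), Dens u v θ x ≤ ∫ x, Dens u v θ x * f x := by
      rw [← integral_indicator measurableSet_ball]
      refine integral_mono_of_nonneg (Eventually.of_forall fun x => Set.indicator_nonneg (fun x _ => dens_nonneg x) x) (intS hs.dens hc.ft) (Eventually.of_forall fun x => ?_)
      by_cases hx : x ∈ ball (0 : R3) (Rs j)
      · simp only [Set.indicator_of_mem hx]
        rw [hc.f1 x (by simpa using (mem_ball_zero_iff.1 hx).le), mul_one]
      · simp only [Set.indicator_of_notMem hx]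
        exact mul_nonneg (dens_nonneg x) (hc.f0 x)
    refine (b5.trans b4).trans ?_
    rw [show ((2:ℝ) - 1)⁻¹ ^ 6 = 1 by norm_num, mul_one]
    refine mul_le_mul_of_nonneg_left ?_ C1p
    rw [mul_add (Rs j)⁻¹] at hB
    simp only [hτ]
    linarith
  have I0 : I ≤ 0 := by
    have ck : Tendsto (fun o : ℝ => C1 * (o ^ 3 + o ^ 2 + 4 * K ^ 2 * o * Z ^ 4)) (nhdsWithin 0 (Set.Ioi 0)) (nhds (C1 * (0 ^ 3 + 0 ^ 2 + 4 * K ^ 2 * 0 * Z ^ 4))) :=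
      (Continuous.tendsto (by fun_prop) 0).mono_left nhdsWithin_le_nhds
    have := ge_of_tendsto ck (eventually_nhdsWithin_of_forall key)
    simpa using this
  have I00 : I = 0 := le_antisymm I0 (integral_nonneg fun x => dens_nonneg x)
  have ae := (integral_eq_zero_iff_of_nonneg (fun x => dens_nonneg x) hI).1 I00
  have := (Continuous.ae_eq_iff_eq volume hs.dens.cont continuous_zero).1 ae
  exact fun x => congrFun this x

lemma const_of_pd {f : R3 → ℝ} (hf : Sm f) (h : ∀ j x, pd f j x = 0) (x : R3) : f x = f 0 :=
  is_const_of_fderiv_eq_zero hf.diff (fun x => by ext z; rw [fderiv_coord]; simp [h]) x 0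

lemma const_int {f : R3 → ℝ} {a : ℝ} (h : ∀ x, f x = a) (hi : Integrable fun x => f x ^ 6) : a = 0 := by
  simp only [h] at hi
  rcases integrable_const_iff.1 hi with h | h
  · exact pow_eq_zero_iff (by norm_num) |>.1 h
  · have := h.measure_univ_lt_top
    rw [measure_univ_of_isAddLeftInvariant] at this
    exact absurd this (lt_irrefl _)

theorem liou {u v : Fin 3 → R3 → ℝ} {π θ : R3 → ℝ} {K q e : ℝ} {Rs : ℕ → ℝ} (hs : Sol u v π θ) (hR : Tendsto Rs atTop atTop)
    (H : ∀ᶠ j in atTop, Hy u v θ q e K (Rs j)) (hu : Tendsto (fun j => (Rs j)⁻¹ * ∫ x in annulus (Rs j), nn u x ^ 3) atTop (nhds 0))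
    (hS : Tendsto (fun j => (Rs j)⁻¹ * Sf u θ (Rs j)) atTop (nhds 0)) : (∀ x, nn u x = 0) ∧ (∀ x, nn v x = 0) ∧ ∀ x, θ x = 0 := by
  obtain ⟨hD, Iv, It⟩ := dens_zero hs hR H hu hS
  have hj : ∀ x j, (∑ i, pd (u i) j x ^ 2) + (∑ i, pd (v i) j x ^ 2) + pd θ j x ^ 2 = 0 := fun x j =>
    (Finset.sum_eq_zero_iff_of_nonneg fun j _ => by positivity).1 (hD x) j (Finset.mem_univ j)
  have sq : ∀ {f : Fin 3 → R3 → ℝ} {j x}, ∑ i, pd (f i) j x ^ 2 = 0 → ∀ i, pd (f i) j x = 0 := fun h i => by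
    have := (Finset.sum_eq_zero_iff_of_nonneg fun j _ => by positivity).1 h i (Finset.mem_univ i)
    exact pow_eq_zero_iff (by norm_num) |>.1 this
  have n0 : ∀ (f : Fin 3 → R3 → ℝ) j x, 0 ≤ ∑ i, pd (f i) j x ^ 2 := fun f j x => by positivity
  have cu : ∀ i x, u i x = u i 0 := fun i => const_of_pd (hs.u i) fun j x => sq (by nlinarith [hj x j, n0 u j x, n0 v j x, sq_nonneg (pd θ j x)]) i
  have cv : ∀ i x, v i x = v i 0 := fun i => const_of_pd (hs.v i) fun j x => sq (by nlinarith [hj x j, n0 u j x, n0 v j x, sq_nonneg (pd θ j x)]) i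
  have cθ : ∀ x, θ x = θ 0 := const_of_pd hs.t fun j x => pow_eq_zero_iff (n := 2) (by norm_num) |>.1 (by nlinarith [hj x j, n0 u j x, n0 v j x, sq_nonneg (pd θ j x)])
  have nu : ∀ x, nn u x = nn u 0 := fun x => by unfold nn; simp only [fun i => cu i x]
  have nv : ∀ x, nn v x = nn v 0 := fun x => by unfold nn; simp only [fun i => cv i x]
  refine ⟨fun x => ?_, fun x => (nv x).trans (const_int nv Iv), fun x => (cθ x).trans (const_int cθ It)⟩
  rw [nu x]
  obtain ⟨c, c0, hc⟩ := vol_low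
  have : c * nn u 0 ^ 3 ≤ 0 := by
    refine ge_of_tendsto hu ?_
    filter_upwards [hR.eventually_ge_atTop 1] with j hj
    have := hc (Rs j) hj (nn u 0 ^ 3) (pow_nonneg nn_nonneg 3)
    simp only [nu]
    rw [le_inv_mul_iff₀ (by linarith)]; linarith
  by_contra hne
  have : 0 < nn u 0 := lt_of_le_of_ne nn_nonneg (Ne.symm hne)
  have : 0 < c * nn u 0 ^ 3 := by positivity
  linarith
end

open MeasureTheory Filter Metric
noncomputable section

lemma of_lp {g : R3 → ℝ} {a m R x : ℝ} (m0 : 0 < m) (R0 : 0 < R) (h : R ^ (-a) * lpS g m (annulus R) ≤ x) : ∫ y in annulus R, |g y| ^ m ≤ (R ^ a * x) ^ m := by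
  have I0 : 0 ≤ ∫ y in annulus R, |g y| ^ m := ann_nonneg (fun y => by positivity) R
  have h1 : lpS g m (annulus R) ≤ R ^ a * x := by
    rw [Real.rpow_neg R0.le, inv_mul_le_iff₀ (by positivity)] at h; exact h
  have := Real.rpow_le_rpow (by unfold lpS; positivity) h1 m0.le
  unfold lpS at this
  rwa [← Real.rpow_mul I0, one_div, inv_mul_cancel₀ m0.ne', Real.rpow_one] at this

lemma lowp : ∃ C : ℝ, 1 ≤ C ∧ ∀ {g : R3 → ℝ} {a m s R x : ℝ}, Continuous g → 0 < s → s ≤ m → 1 ≤ R → 0 < x → ∫ y in annulus R, |g y| ^ m ≤ (R ^ a * x) ^ m →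
    ∫ y in annulus R, |g y| ^ s ≤ C * x ^ s * R ^ (a * s + 3 * (1 - s / m)) := by
  obtain ⟨C, C0, hC⟩ := vol_ann
  refine ⟨C + 1, by linarith, fun {g a m s R x} cg s0 sm R1 x0 h => ?_⟩
  have m0 : 0 < m := by linarith
  have R0 : 0 < R := by linarith
  have b0 : 0 ≤ 1 - s / m := by rw [sub_nonneg, div_le_one m0]; exact sm
  have cr : ∀ t : ℝ, 0 < t → Continuous fun y => |g y| ^ t := fun t ht => cg.abs.rpow_const fun y => Or.inr ht.le
  have := hol (R := R) (f := fun y => |g y| ^ m) (g := fun _ => 1) (h := fun y => |g y| ^ s) (a := s / m) (b := 1 - s / m) (G := (C + 1) * R ^ (3:ℝ)) (by positivity) b0 (by ring)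
    (cr m m0) (by fun_prop) (cr s s0) (fun y => by positivity) (fun y => by norm_num) (by positivity) (by positivity) h
    ((hC R R0 1 (by norm_num)).trans (by norm_cast; have := pow_pos R0 3; linarith)) (fun y _ => by
      rw [Real.one_rpow, mul_one, ← Real.rpow_mul (abs_nonneg _), mul_div_cancel₀ _ m0.ne'])
  refine this.trans ?_
  rw [← Real.rpow_mul (by positivity), mul_div_cancel₀ _ m0.ne', Real.mul_rpow (by positivity) x0.le, Real.mul_rpow (by positivity) (by positivity), ← Real.rpow_mul R0.le,
    ← Real.rpow_mul R0.le, Real.rpow_add R0]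
  have hc : (C + 1) ^ (1 - s / m) ≤ C + 1 := by
    have := Real.rpow_le_rpow_of_exponent_le (show 1 ≤ C + 1 by linarith) (show 1 - s / m ≤ 1 by linarith [div_nonneg s0.le m0.le])
    simpa using this
  calc _ = (C + 1) ^ (1 - s / m) * (x ^ s * (R ^ (a * s) * R ^ (3 * (1 - s / m)))) := by ring
    _ ≤ (C + 1) * (x ^ s * (R ^ (a * s) * R ^ (3 * (1 - s / m)))) := by gcongr
    _ = _ := by ring

lemma S_b {C p r α γ x ζ R : ℝ} {n θ : R3 → ℝ} (C1 : 1 ≤ C) (cn : Continuous n) (ct : Continuous θ) (n0 : ∀ y, 0 ≤ n y) (p3 : 3 ≤ p) (hr : 2 * (p / (p - 1)) ≤ r)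
    (hc2 : α + 2 * γ ≤ 3 / p + 6 / r - 2) (R1 : 1 ≤ R) (x0 : 0 < x) (ζ0 : 0 < ζ) (h1 : ∫ y in annulus R, |n y| ^ p ≤ (R ^ α * x) ^ p) 
    (h2 : ∫ y in annulus R, |θ y| ^ (2 * (p / (p - 1))) ≤ C * ζ ^ (2 * (p / (p - 1))) * R ^ (γ * (2 * (p / (p - 1))) + 3 * (1 - (2 * (p / (p - 1))) / r))) :
    ∫ y in annulus R, n y * θ y ^ 2 ≤ C * ζ ^ 2 * x * R := by
  have p0 : 0 < p := by linarith
  have pm : 0 < p - 1 := by linarith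
  have R0 : 0 < R := by linarith
  have P0 : 0 < p / (p - 1) := by positivity
  have r0 : 0 < r := by linarith
  have cr : ∀ (g : R3 → ℝ) (t : ℝ), Continuous g → 0 < t → Continuous fun y => |g y| ^ t := fun g t hg ht => hg.abs.rpow_const fun y => Or.inr ht.le
  have := hol (R := R) (f := fun y => |n y| ^ p) (g := fun y => |θ y| ^ (2 * (p / (p - 1)))) (h := fun y => n y * θ y ^ 2) (a := 1 / p) (b := (p - 1) / p)
    (by positivity) (by positivity) (by field_simp; ring) (cr n p cn p0) (cr θ _ ct (by positivity)) (by fun_prop) (fun y => by positivity) (fun y => by positivity)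
    (by positivity) (by positivity) h1 h2 (fun y _ => by
      rw [← Real.rpow_mul (abs_nonneg _), ← Real.rpow_mul (abs_nonneg _), mul_one_div_cancel p0.ne', Real.rpow_one, abs_of_nonneg (n0 y),
        show 2 * (p / (p - 1)) * ((p - 1) / p) = (2 : ℕ) by push_cast; field_simp, Real.rpow_natCast, sq_abs])
  refine this.trans ?_
  rw [← Real.rpow_mul (by positivity), mul_one_div_cancel p0.ne', Real.rpow_one, Real.mul_rpow (by positivity) (by positivity), Real.mul_rpow (by positivity) (by positivity),
    ← Real.rpow_mul ζ0.le, ← Real.rpow_mul R0.le, show 2 * (p / (p - 1)) * ((p - 1) / p) = (2 : ℕ) by push_cast; field_simp, Real.rpow_natCast]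
  have hc : C ^ ((p - 1) / p) ≤ C := by
    have := Real.rpow_le_rpow_of_exponent_le C1 (show (p - 1) / p ≤ 1 by rw [div_le_one p0]; linarith)
    simpa using this
  have he : R ^ α * R ^ ((γ * (2 * (p / (p - 1))) + 3 * (1 - 2 * (p / (p - 1)) / r)) * ((p - 1) / p)) ≤ R := by
    rw [← Real.rpow_add R0]
    refine (Real.rpow_le_rpow_of_exponent_le R1 ?_).trans (Real.rpow_one R).le
    have : (γ * (2 * (p / (p - 1))) + 3 * (1 - 2 * (p / (p - 1)) / r)) * ((p - 1) / p) = 2 * γ + 3 - 3 / p - 6 / r := by field_simp; ring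
    rw [this]; linarith
  calc _ = C ^ ((p - 1) / p) * (ζ ^ 2 * x) * (R ^ α * R ^ ((γ * (2 * (p / (p - 1))) + 3 * (1 - 2 * (p / (p - 1)) / r)) * ((p - 1) / p))) := by ring
    _ ≤ C * (ζ ^ 2 * x) * R := by gcongr
    _ = _ := by ring

lemma nn_norm (u : R3 → R3) (x : R3) : nn (fun i y => u y i) x = ‖u x‖ := by
  rw [EuclideanSpace.norm_eq]; simp [nn]
end

theorem liouville_tcm_A3 (u v : R3 → R3) (pr θ : R3 → ℝ)
    (hu : ContDiff ℝ (⊤ : ℕ∞) u) (hv : ContDiff ℝ (⊤ : ℕ∞) v)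
    (hpr : ContDiff ℝ (⊤ : ℕ∞) pr) (hθ : ContDiff ℝ (⊤ : ℕ∞) θ)
    (hsol : TCM u v pr θ)
    (p q r α β γ : ℝ)
    (hp1 : 3 ≤ p) (hp2 : p ≤ 9 / 2)
    (hq1 : 1 ≤ q) (hq2 : q < 2)
    (hr1 : 2 * (p / (p - 1)) ≤ r) (hr2 : r ≤ 6)
    (hα1 : 0 ≤ α) (hα2 : α ≤ 3 / p - 2 / 3)
    (hβ1 : 0 ≤ β) (hβ2 : β ≤ 3 / q - 1 / 2)
    (hγ1 : 0 ≤ γ) (hγ2 : γ ≤ 3 / r - 1 / 2)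
    (hc1 : α + ((4 * p - 6) * q / ((6 - q) * p)) * β ≤ 1)
    (hc2 : α + 2 * γ ≤ 3 / p + 6 / r - 2)
    (hc3 : (2 * q / (6 - q)) * β + γ ≤ (6 - r) / (2 * r))
    (Rs : ℕ → ℝ) (hRs : Tendsto Rs atTop atTop)
    (hX : Tendsto (fun j => XnV u α p (Rs j)) atTop (nhds 0))
    (hY : ∃ L : ℝ, Tendsto (fun j => XnV v β q (Rs j)) atTop (nhds L))
    (hZ : ∃ L : ℝ, Tendsto (fun j => XnS θ γ r (Rs j)) atTop (nhds L)) :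
    (∀ x, u x = 0) ∧ (∀ x, v x = 0) ∧ (∀ x, θ x = 0) := by
  have p0 : 0 < p := by linarith
  have q0 : 0 < q := by linarith
  have r2 : 18 / 7 ≤ r := by
    refine le_trans ?_ hr1
    rw [mul_div_assoc', div_le_div_iff₀ (by norm_num) (by linarith)]; linarith
  have r0 : 0 < r := by linarith
  have h6 : 0 < 6 - q := by linarith
  have P0 : 0 < p / (p - 1) := div_pos p0 (by linarith)
  have hs : Sol (fun i y => u y i) (fun i y => v y i) pr θ := ⟨fun i => contDiff_euclidean.1 hu i, fun i => contDiff_euclidean.1 hv i, hpr, hθ, hsol.1, hsol.2.1, hsol.2.2.1, hsol.2.2.2⟩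
  have nu : nn (fun i y => u y i) = fun x => ‖u x‖ := funext (nn_norm u)
  have nv : nn (fun i y => v y i) = fun x => ‖v x‖ := funext (nn_norm v)
  have cu : Continuous fun x => ‖u x‖ := hu.continuous.norm
  have ct := hθ.continuous
  have h3r : (6 - r) / (2 * r) = 3 / r - 1 / 2 := by field_simp; norm_num
  rw [h3r] at hc3
  set e := (2 * q / (6 - q)) * β with he
  have e0 : 0 ≤ e := by positivity
  have e1 : e ≤ 2 / 3 := by
    have : 3 / r ≤ 7 / 6 := by rw [div_le_div_iff₀ r0 (by norm_num)]; linarith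
    linarith
  obtain ⟨C, C1, hC⟩ := lowp
  obtain ⟨y, hy⟩ := hY
  obtain ⟨ζ, hζ⟩ := hZ
  have yb : ∀ᶠ j in atTop, XnV v β q (Rs j) ≤ |y| + 1 := (hy.eventually_lt_const (show y < |y| + 1 by linarith [le_abs_self y])).mono fun j h => h.le
  have ζb : ∀ᶠ j in atTop, XnS θ γ r (Rs j) ≤ |ζ| + 1 := (hζ.eventually_lt_const (show ζ < |ζ| + 1 by linarith [le_abs_self ζ])).mono fun j h => h.le
  have yp : 0 < |y| + 1 := by positivity
  have ζp : 0 < |ζ| + 1 := by positivity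
  set y' := |y| + 1
  set ζ' := |ζ| + 1
  have iR : Tendsto (fun j => (Rs j)⁻¹) atTop (nhds 0) := tendsto_inv_atTop_zero.comp hRs
  have hx := hX.add iR
  rw [add_zero] at hx
  have X0 : ∀ j, 0 < Rs j → 0 < XnV u α p (Rs j) + (Rs j)⁻¹ := fun j hj => by
    have : 0 ≤ XnV u α p (Rs j) := by
      unfold XnV lpS
      have : 0 ≤ ∫ x in annulus (Rs j), |‖u x‖| ^ p := ann_nonneg (fun x => by positivity) _
      positivity
    positivity
  have R1 := hRs.eventually_ge_atTop 1
  have hXi : ∀ j, 1 ≤ Rs j → ∫ x in annulus (Rs j), |‖u x‖| ^ p ≤ (Rs j ^ α * (XnV u α p (Rs j) + (Rs j)⁻¹)) ^ p := fun j hj =>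
    of_lp p0 (by linarith) (le_add_of_nonneg_right (inv_nonneg.2 (by linarith)))
  have hA : Tendsto (fun j => (Rs j)⁻¹ * ∫ x in annulus (Rs j), nn (fun i y => u y i) x ^ 3) atTop (nhds 0) := by
    have l := (hx.pow 3).const_mul C
    rw [zero_pow (by norm_num), mul_zero] at l
    refine squeeze_zero' (R1.mono fun j hj => ?_) (R1.mono fun j hj => ?_) l
    · exact mul_nonneg (inv_nonneg.2 (by linarith)) (ann_nonneg (fun x => pow_nonneg nn_nonneg 3) _)
    · have R0 : 0 < Rs j := by linarith
      have h := hC (s := 3) cu (by norm_num) hp1 hj (X0 j R0) (hXi j hj)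
      rw [inv_mul_le_iff₀ R0]
      have ex : (fun x => nn (fun i y => u y i) x ^ 3) = fun x => |‖u x‖| ^ (3:ℝ) := by
        funext x; rw [nn_norm, abs_norm]; norm_cast
      rw [ex]
      refine h.trans ?_
      have h1 : Rs j ^ (α * 3 + 3 * (1 - 3 / p)) ≤ Rs j := by
        refine (Real.rpow_le_rpow_of_exponent_le hj ?_).trans (Real.rpow_one _).le
        have : 3 * (3 / p) = 9 / p := by ring
        linarith
      have xx := X0 j R0
      calc _ ≤ C * (XnV u α p (Rs j) + (Rs j)⁻¹) ^ (3:ℝ) * Rs j := by gcongr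
        _ = _ := by norm_cast; ring
  have hθr : ∀ j, 1 ≤ Rs j → XnS θ γ r (Rs j) ≤ ζ' → ∫ x in annulus (Rs j), |θ x| ^ r ≤ (Rs j ^ γ * ζ') ^ r := fun j hj h => of_lp r0 (by linarith) h
  have hB : Tendsto (fun j => (Rs j)⁻¹ * Sf (fun i y => u y i) θ (Rs j)) atTop (nhds 0) := by
    have l := hx.const_mul (C * ζ' ^ 2)
    rw [mul_zero] at l
    refine squeeze_zero' (R1.mono fun j hj => ?_) ((R1.and ζb).mono fun j hj => ?_) l
    · exact mul_nonneg (inv_nonneg.2 (by linarith)) (ann_nonneg (fun x => mul_nonneg nn_nonneg (sq_nonneg _)) _)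
    · have R0 : 0 < Rs j := by linarith [hj.1]
      rw [inv_mul_le_iff₀ R0]
      have h := S_b (p := p) (r := r) (α := α) (γ := γ) C1 cu ct (fun x => norm_nonneg _) hp1 hr1 hc2 hj.1 (X0 j R0) ζp (hXi j hj.1)
        (hC ct (by positivity) hr1 hj.1 ζp (hθr j hj.1 hj.2))
      unfold Sf
      rw [nu]
      linarith
  set K := 1 + y' ^ (2 * (2 * q / (6 - q))) + C * ζ' ^ 2 with hK
  have k1 : 0 < y' ^ (2 * (2 * q / (6 - q))) := by positivity
  have k2 : 0 < C * ζ' ^ 2 := by positivity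
  have H : ∀ᶠ j in atTop, Hy (fun i y => u y i) (fun i y => v y i) θ q e K (Rs j) := by
    filter_upwards [R1, yb, ζb, hA.eventually_lt_const one_pos, hB.eventually_lt_const one_pos] with j hj hyj hzj haj hbj
    have R0 : 0 < Rs j := by linarith
    rw [inv_mul_lt_iff₀ R0, mul_one] at haj hbj
    have KR : Rs j ≤ K * Rs j := le_mul_of_one_le_left R0.le (by linarith)
    refine ⟨hq1, hq2, e0, e1, by linarith, hj, haj.le.trans KR, ?_, ?_, hbj.le.trans KR⟩
    · have h := of_lp (g := fun x => ‖v x‖) (a := β) q0 R0 hyj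
      simp only [abs_norm] at h
      rw [nv]
      have I0 : 0 ≤ ∫ x in annulus (Rs j), ‖v x‖ ^ q := ann_nonneg (fun x => by positivity) _
      refine (Real.rpow_le_rpow I0 h (by positivity)).trans ?_
      rw [← Real.rpow_mul (by positivity), Real.mul_rpow (by positivity) yp.le, ← Real.rpow_mul R0.le,
        show β * (q * (4 / (6 - q))) = 2 * e by rw [he]; field_simp; norm_num, show q * (4 / (6 - q)) = 2 * (2 * q / (6 - q)) by field_simp; norm_num, mul_comm]
      gcongr
      linarith
    · have h := hC (s := 2) ct (by norm_num) (by linarith [(one_le_div (show 0 < p - 1 by linarith)).2 (show p - 1 ≤ p by linarith)]) hj ζp (hθr j hj hzj)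
      have ex : (fun x => |θ x| ^ (2:ℝ)) = fun x => θ x ^ 2 := by
        funext x; norm_cast; exact sq_abs _
      rw [ex] at h
      refine h.trans ?_
      have h1 : Rs j ^ (γ * 2 + 3 * (1 - 2 / r)) ≤ Rs j ^ (2 - 2 * e) := by
        refine Real.rpow_le_rpow_of_exponent_le hj ?_
        have : 3 * (2 / r) = 2 * (3 / r) := by ring
        linarith
      have h2 : C * ζ' ^ (2:ℝ) ≤ K := by norm_cast; linarith
      gcongr
  obtain ⟨a, b, c⟩ := liou hs hRs H hA hB
  refine ⟨fun x => ?_, fun x => ?_, c⟩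
  · have := a x
    rwa [nn_norm, norm_eq_zero] at this
  · have := b x
    rwa [nn_norm, norm_eq_zero] at this
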